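/- arXiv:2012.02747 — 4 statements merged into one kernel-verified Lean document; each statement's English description precedes it below -/
import Mathlib

section
/- Let d ≥ 1 be an integer, let 0 < δ < d be a non-integer, let C > 1 and 0 < r < 1. Let X ⊆ B(0,1) ⊆ ℝ^d be a δ-regular set on scales [r,1] with constant C, and let X_r := X + B(0,r). Then |X_r + X_r| ≥ c · r^{d−δ−β} and |X_r − X_r| ≥ c · r^{d−δ−β}, where c > 0 depends only on C, δ, d and β = exp(−K₁·(1 + (log C)^{K₂})) for constants K₁, K₂ > 0 depending only on δ and d. -/
open MeasureTheory Metric Set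
open scoped ENNReal Pointwise

/-- `μ` is a regular measure associated to the `δ`-regular set `X` on scales `[α₀, α₁]`
with constant `C`. -/
def IsRegularMeasure {E : Type*} [NormedAddCommGroup E] [MeasurableSpace E]
    (δ α₀ α₁ C : ℝ) (X : Set E) (μ : Measure E) : Prop :=
  (∀ K : Set E, IsCompact K → μ K < ⊤) ∧
  μ Xᶜ = 0 ∧
  (∀ (x : E) (r : ℝ), α₀ ≤ r → r ≤ α₁ →
    μ (closedBall x r) ≤ ENNReal.ofReal (C * r ^ δ)) ∧
  (∀ x ∈ X, ∀ r : ℝ, α₀ ≤ r → r ≤ α₁ →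
    ENNReal.ofReal (C⁻¹ * r ^ δ) ≤ μ (closedBall x r))

/-- `X` is a `δ`-regular set on scales `[α₀, α₁]` with constant `C`. -/
def IsRegularSet {E : Type*} [NormedAddCommGroup E] [MeasurableSpace E]
    (δ α₀ α₁ C : ℝ) (X : Set E) : Prop :=
  IsClosed X ∧ X.Nonempty ∧ ∃ μ : Measure E, IsRegularMeasure δ α₀ α₁ C X μ

lemma measure_le_card_mul_of_fibers {E ι : Type*} [NormedAddCommGroup E] [MeasurableSpace E]
    {μ : Measure E} {S : Set E} (g : E → ι) (F : Finset ι) (hF : ∀ y ∈ S, g y ∈ F)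
    {b : ℝ≥0∞} {R : ℝ} (hb : ∀ y ∈ S, μ (closedBall y R) ≤ b)
    (hdist : ∀ y ∈ S, ∀ z ∈ S, g y = g z → ‖z - y‖ ≤ R) :
    μ S ≤ F.card * b := by
  have hcover : S ⊆ ⋃ i ∈ F, S ∩ g ⁻¹' {i} := fun y hy => by
    simp only [mem_iUnion]
    exact ⟨g y, hF y hy, hy, rfl⟩
  calc μ S ≤ μ (⋃ i ∈ F, S ∩ g ⁻¹' {i}) := measure_mono hcover
    _ ≤ ∑ i ∈ F, μ (S ∩ g ⁻¹' {i}) := measure_biUnion_finset_le _ _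
    _ ≤ ∑ _i ∈ F, b := by
        refine Finset.sum_le_sum fun i _ => ?_
        rcases (S ∩ g ⁻¹' {i}).eq_empty_or_nonempty with h | ⟨y, hy, hyi⟩
        · simp [h]
        · refine (measure_mono ?_).trans (hb y hy)
          rintro z ⟨hz, hzi⟩
          rw [mem_closedBall, dist_eq_norm]
          exact hdist y hy z hz (by rw [mem_preimage, mem_singleton_iff] at hyi hzi; rw [hyi, hzi])
    _ = F.card * b := by simp

lemma EuclideanSpace.norm_le_card_mul {ι : Type*} [Fintype ι] (v : EuclideanSpace ℝ ι) {c : ℝ}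
    (h : ∀ i, |v i| ≤ c) : ‖v‖ ≤ Fintype.card ι * c := by
  have h1 : ‖v‖ ≤ ∑ i, |v i| := by
    rw [EuclideanSpace.norm_eq]
    refine Real.sqrt_le_iff.2 ⟨Finset.sum_nonneg fun i _ => abs_nonneg _, ?_⟩
    exact Finset.sum_sq_le_sq_sum_of_nonneg fun i _ => abs_nonneg _
  refine h1.trans ((Finset.sum_le_sum fun i _ => h i).trans ?_)
  simp

lemma EuclideanSpace.abs_apply_le_norm {ι : Type*} [Fintype ι] (v : EuclideanSpace ℝ ι) (i : ι) :
    |v i| ≤ ‖v‖ := by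
  simpa using PiLp.norm_apply_le v i

lemma floor_div_mem_Icc {x a : ℝ} {N : ℕ} (ha : 0 < a) (h : |x| ≤ N * a) :
    ⌊x / a⌋ ∈ Finset.Icc (-(N : ℤ)) N := by
  have := abs_le.1 h
  rw [Finset.mem_Icc]
  constructor
  · rw [Int.le_floor, le_div_iff₀ ha]
    push_cast
    linarith
  · have h2 : x / a ≤ N := by rw [div_le_iff₀ ha]; linarith
    exact_mod_cast (Int.floor_le _).trans h2

lemma abs_sub_le_of_floor_div_eq {x y a : ℝ} (ha : 0 < a) (h : ⌊x / a⌋ = ⌊y / a⌋) :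
    |x - y| ≤ a := by
  have := Int.abs_sub_lt_one_of_floor_eq_floor h
  rw [← sub_div, abs_div, abs_of_pos ha, div_lt_one ha] at this
  exact this.le

lemma card_piFinset_Icc_neg (ι : Type*) [Fintype ι] [DecidableEq ι] (N : ℕ) :
    (Fintype.piFinset fun _ : ι => Finset.Icc (-(N : ℤ)) N).card =
      (2 * N + 1) ^ Fintype.card ι := by
  rw [Fintype.card_piFinset]
  simp only [Int.card_Icc, Finset.prod_const, Finset.card_univ]
  congr 1
  omega

/-- A set of dimension `δ > n` is not locally concentrated near an `n`-dimensional subspace. -/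
lemma exists_far_from_subspace {d n : ℕ} {δ r C : ℝ} {X : Set (EuclideanSpace ℝ (Fin d))}
    {μ : Measure (EuclideanSpace ℝ (Fin d))} (hμ : IsRegularMeasure δ r 1 C X μ)
    (hr : 0 < r) (hC : 1 < C) {Q : ℕ} (hdQ : d + 2 ≤ Q)
    (hQ : (5 * Q : ℝ) ^ n * (d + 2 : ℝ) ^ δ * C ^ 2 < (Q : ℝ) ^ δ)
    (W : Submodule ℝ (EuclideanSpace ℝ (Fin d))) (hW : Module.finrank ℝ W ≤ n)
    {x : EuclideanSpace ℝ (Fin d)} (hx : x ∈ X) {ρ : ℝ} (hρ : r * Q ≤ ρ) (hρ1 : ρ ≤ 1) :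
    ∃ y ∈ X, ‖y - x‖ ≤ ρ ∧ ∀ w ∈ W, ρ / Q ≤ ‖y - x - w‖ := by
  by_contra! hcon
  obtain ⟨-, hsupp, hup, hlow⟩ := hμ
  have hQ2 : (2 : ℝ) ≤ Q := by exact_mod_cast (by omega : 2 ≤ Q)
  have hQ0 : (0 : ℝ) < Q := by linarith
  have hρ0 : 0 < ρ := lt_of_lt_of_le (by positivity) hρ
  have hd2 : (d + 2 : ℝ) ≤ Q := by exact_mod_cast hdQ
  have hd0 : (0 : ℝ) ≤ d := by positivity
  have hrρ : r ≤ ρ := by nlinarith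
  have ha : 0 < ρ / Q := by positivity
  choose! w hwW hw using hcon
  set b := stdOrthonormalBasis ℝ W
  set S := X ∩ closedBall x ρ with hS
  set g : EuclideanSpace ℝ (Fin d) → (Fin (Module.finrank ℝ W) → ℤ) :=
    fun y => open Classical in
      if h : w y ∈ W then fun i => ⌊b.repr ⟨w y, h⟩ i / (ρ / Q)⌋ else 0 with hg
  have hSy : ∀ y ∈ S, y ∈ X ∧ ‖y - x‖ ≤ ρ := fun y hy => ⟨hy.1, by
    simpa [dist_eq_norm] using hy.2⟩
  have hfin : Module.finrank ℝ W ≤ d := by simpa using W.finrank_le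
  have hgF : ∀ y ∈ S, g y ∈ Fintype.piFinset
      fun _ : Fin (Module.finrank ℝ W) => Finset.Icc (-((2 * Q : ℕ) : ℤ)) (2 * Q : ℕ) := by
    intro y hy
    obtain ⟨hyX, hyx⟩ := hSy y hy
    have hyW := hwW y hyX hyx
    rw [Fintype.mem_piFinset]
    intro i
    simp only [hg, hyW, dif_pos]
    apply floor_div_mem_Icc ha
    have h1 : |b.repr ⟨w y, hyW⟩ i| ≤ ‖w y‖ := by
      refine (EuclideanSpace.abs_apply_le_norm _ i).trans ?_
      rw [LinearIsometryEquiv.norm_map]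
      rfl
    have h2 : ‖w y‖ ≤ ‖y - x‖ + ‖y - x - w y‖ := by
      have := norm_sub_le (y - x) (y - x - w y)
      rwa [sub_sub_cancel] at this
    have h3 := hw y hyX hyx
    have h4 : ρ / Q ≤ ρ := div_le_self hρ0.le (by linarith)
    have h5 : ((2 * Q : ℕ) : ℝ) * (ρ / Q) = 2 * ρ := by push_cast; field_simp
    rw [h5]
    linarith
  have hR0 : r ≤ (d + 2) * ρ / Q := by
    rw [le_div_iff₀ hQ0]; nlinarith
  have hR1 : (d + 2) * ρ / Q ≤ 1 := by
    rw [div_le_iff₀ hQ0]; nlinarith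
  have hdiam : ∀ y ∈ S, ∀ z ∈ S, g y = g z → ‖z - y‖ ≤ (d + 2) * ρ / Q := by
    intro y hy z hz hyz
    obtain ⟨hyX, hyx⟩ := hSy y hy
    obtain ⟨hzX, hzx⟩ := hSy z hz
    have hyW := hwW y hyX hyx
    have hzW := hwW z hzX hzx
    have h1 : ‖w z - w y‖ ≤ d * (ρ / Q) := by
      have h2 : ‖w z - w y‖ = ‖b.repr (⟨w z, hzW⟩ - ⟨w y, hyW⟩)‖ := by
        rw [LinearIsometryEquiv.norm_map]; rfl
      rw [h2]
      refine (EuclideanSpace.norm_le_card_mul (c := ρ / Q) _ fun i => ?_).trans ?_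
      · rw [map_sub, PiLp.sub_apply]
        apply abs_sub_le_of_floor_div_eq ha
        have := congrFun hyz i
        simp only [hg, hyW, hzW, dif_pos] at this
        exact this.symm
      · rw [Fintype.card_fin]
        gcongr
    have h3 := hw y hyX hyx
    have h4 := hw z hzX hzx
    have h5 : z - y = (w z - w y) + (z - x - w z) - (y - x - w y) := by abel
    have h6 : ‖z - y‖ ≤ ‖w z - w y‖ + ‖z - x - w z‖ + ‖y - x - w y‖ := by
      rw [h5]
      exact (norm_sub_le _ _).trans (by gcongr; exact norm_add_le _ _)
    have h7 : (d + 2) * ρ / Q = d * (ρ / Q) + ρ / Q + ρ / Q := by ring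
    linarith
  have hmass := measure_le_card_mul_of_fibers (μ := μ) g _ hgF
    (fun y _ => hup y _ hR0 hR1) hdiam
  have hball : μ (closedBall x ρ) ≤ μ S := by
    have : closedBall x ρ ⊆ S ∪ Xᶜ := fun y hy => by
      by_cases h : y ∈ X
      · exact Or.inl ⟨h, hy⟩
      · exact Or.inr h
    refine (measure_mono this).trans ((measure_union_le _ _).trans ?_)
    rw [hsupp, add_zero]
  have key := (hlow x hx ρ hrρ hρ1).trans (hball.trans hmass)
  rw [card_piFinset_Icc_neg, Fintype.card_fin, ← ENNReal.ofReal_natCast,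
    ← ENNReal.ofReal_mul (by positivity), ENNReal.ofReal_le_ofReal_iff (by positivity)] at key
  push_cast at key
  have hcard : (2 * (2 * Q : ℝ) + 1) ^ Module.finrank ℝ W ≤ (5 * Q : ℝ) ^ n :=
    calc (2 * (2 * Q : ℝ) + 1) ^ Module.finrank ℝ W ≤ (5 * Q : ℝ) ^ Module.finrank ℝ W := by
          gcongr; linarith
      _ ≤ (5 * Q : ℝ) ^ n := pow_le_pow_right₀ (by linarith) hW
  have hC0 : 0 < C := by linarith
  have hpow : ((d + 2) * ρ / Q : ℝ) ^ δ = (d + 2 : ℝ) ^ δ * ρ ^ δ / (Q : ℝ) ^ δ := by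
    rw [Real.div_rpow (by positivity) hQ0.le, Real.mul_rpow (by positivity) hρ0.le]
  rw [hpow] at key
  have hρδ : 0 < ρ ^ δ := Real.rpow_pos_of_pos hρ0 _
  have hQδ : 0 < (Q : ℝ) ^ δ := Real.rpow_pos_of_pos hQ0 _
  have key2 : C⁻¹ * ρ ^ δ ≤ (5 * Q : ℝ) ^ n * (C * ((d + 2 : ℝ) ^ δ * ρ ^ δ / (Q : ℝ) ^ δ)) :=
    key.trans (by gcongr)
  have e : (5 * Q : ℝ) ^ n * (C * ((d + 2 : ℝ) ^ δ * ρ ^ δ / (Q : ℝ) ^ δ)) =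
      ((5 * Q : ℝ) ^ n * (d + 2 : ℝ) ^ δ * C ^ 2) / (Q : ℝ) ^ δ * (C⁻¹ * ρ ^ δ) := by
    field_simp
  rw [e] at key2
  have hlt : ((5 * Q : ℝ) ^ n * (d + 2 : ℝ) ^ δ * C ^ 2) / (Q : ℝ) ^ δ < 1 := by
    rwa [div_lt_one hQδ]
  have : 0 < C⁻¹ * ρ ^ δ := by positivity
  nlinarith

/-- Nonzero integer combinations of `v` have norm at least `t`. -/
def IntSeparated {E ι : Type*} [NormedAddCommGroup E] [Fintype ι] (t : ℝ) (v : ι → E) : Prop :=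
  ∀ b : ι → ℤ, b ≠ 0 → t ≤ ‖∑ i, b i • v i‖

lemma IntSeparated.snoc {E : Type*} [NormedAddCommGroup E] [NormedSpace ℝ E] {l : ℕ} {t : ℝ}
    {v : Fin l → E} (hv : IntSeparated t v) {u : E}
    (hu : ∀ w ∈ Submodule.span ℝ (range v), t ≤ ‖u - w‖) :
    IntSeparated t (Fin.snoc v u : Fin (l + 1) → E) := by
  intro b hb
  simp only [Fin.sum_univ_castSucc, Fin.snoc_castSucc, Fin.snoc_last]
  by_cases h0 : b (Fin.last l) = 0
  · rw [h0, zero_smul, add_zero]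
    refine hv (fun i => b i.castSucc) fun h => hb ?_
    funext i
    refine Fin.lastCases h0 (fun j => ?_) i
    exact congrFun h j
  · set c : ℝ := (b (Fin.last l) : ℝ) with hc
    have hc0 : c ≠ 0 := by simpa [hc] using h0
    have hc1 : 1 ≤ |c| := by
      rw [hc, ← Int.cast_abs]
      exact_mod_cast Int.one_le_abs h0
    set w := ∑ i : Fin l, b i.castSucc • v i with hw
    have hwW : w ∈ Submodule.span ℝ (range v) :=
      Submodule.sum_mem _ fun i _ => by
        rw [← Int.cast_smul_eq_zsmul ℝ]
        exact Submodule.smul_mem _ _ (Submodule.subset_span ⟨i, rfl⟩)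
    have h1 := hu (-(c⁻¹ • w)) (Submodule.neg_mem _ (Submodule.smul_mem _ _ hwW))
    have h2 : w + b (Fin.last l) • u = c • (u - -(c⁻¹ • w)) := by
      rw [sub_neg_eq_add, smul_add, smul_smul, mul_inv_cancel₀ hc0, one_smul, hc,
        Int.cast_smul_eq_zsmul, add_comm]
    rw [h2, norm_smul, Real.norm_eq_abs]
    nlinarith [norm_nonneg (u - -(c⁻¹ • w))]

/-- Around each point, a set of dimension `δ > n` contains a nondegenerate `(n + 1)`-frame. -/
lemma exists_frame {d n : ℕ} {δ r C : ℝ} {X : Set (EuclideanSpace ℝ (Fin d))}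
    {μ : Measure (EuclideanSpace ℝ (Fin d))} (hμ : IsRegularMeasure δ r 1 C X μ)
    (hr : 0 < r) (hC : 1 < C) {Q : ℕ} (hdQ : d + 2 ≤ Q)
    (hQ : (5 * Q : ℝ) ^ n * (d + 2 : ℝ) ^ δ * C ^ 2 < (Q : ℝ) ^ δ)
    {x : EuclideanSpace ℝ (Fin d)} (hx : x ∈ X) {ρ : ℝ} (hρ : r * Q ≤ ρ) (hρ1 : ρ ≤ 1) :
    ∃ v : Fin (n + 1) → EuclideanSpace ℝ (Fin d),
      (∀ l, x + v l ∈ X ∧ ‖v l‖ ≤ ρ) ∧ IntSeparated (ρ / Q) v := by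
  suffices h : ∀ l ≤ n + 1, ∃ v : Fin l → EuclideanSpace ℝ (Fin d),
      (∀ l, x + v l ∈ X ∧ ‖v l‖ ≤ ρ) ∧ IntSeparated (ρ / Q) v from h _ le_rfl
  intro l
  induction l with
  | zero =>
    intro _
    exact ⟨Fin.elim0, fun l => l.elim0, fun b hb => absurd (Subsingleton.elim _ _) hb⟩
  | succ l ih =>
    intro hl
    obtain ⟨v, hvX, hv⟩ := ih (by omega)
    obtain ⟨y, hyX, hyx, hy⟩ := exists_far_from_subspace hμ hr hC hdQ hQ
      (Submodule.span ℝ (range v))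
      ((finrank_range_le_card v).trans (by simpa using Nat.le_of_succ_le_succ hl)) hx hρ hρ1
    refine ⟨Fin.snoc v (y - x), fun i => ?_, hv.snoc hy⟩
    refine Fin.lastCases ?_ (fun j => ?_) i
    · simpa using ⟨hyX, hyx⟩
    · simpa using hvX j

/-- The `k`-fold sumset of `X`. -/
def kSum {E : Type*} [AddCommMonoid E] (k : ℕ) (X : Set E) : Set E :=
  {p | ∃ x : Fin k → E, (∀ i, x i ∈ X) ∧ ∑ i, x i = p}

/-- If every point of `X` is the base point of a nondegenerate `(n + 1)`-frame at scale `ρ`, then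
near each point of a sufficiently long sumset of `X` there are `L ^ (n + 1)` separated points of
that sumset. -/
lemma exists_separated_family_kSum {d n k L N Q : ℕ} {ρ : ℝ} {X : Set (EuclideanSpace ℝ (Fin d))}
    (hL : 0 < L) (hQ0 : 0 < Q) (hN0 : 0 < N) (hρ : 0 < ρ)
    (hframe : ∀ x ∈ X, ∃ v : Fin (n + 1) → EuclideanSpace ℝ (Fin d),
      (∀ l, x + v l ∈ X ∧ ‖v l‖ ≤ ρ) ∧ IntSeparated (ρ / Q) v)
    (hN : 2 * (n + 1) * L * d * Q ≤ N)
    (hk : (2 * N + 1) ^ ((n + 1) * d) * ((n + 1) * L) ≤ k)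
    {p : EuclideanSpace ℝ (Fin d)} (hp : p ∈ kSum k X) :
    ∃ f : (Fin (n + 1) → Fin L) → EuclideanSpace ℝ (Fin d),
      (∀ a, f a ∈ kSum k X ∧ ‖f a - p‖ ≤ (n + 1) * L * ρ) ∧
      ∀ a a', a ≠ a' → ρ / (2 * Q) ≤ ‖f a - f a'‖ := by
  obtain ⟨x, hxX, rfl⟩ := hp
  choose v hvX hv using fun i => hframe (x i) (hxX i)
  have hNr : (0 : ℝ) < N := by exact_mod_cast hN0
  have ha : 0 < ρ / N := by positivity
  obtain ⟨y, -, hy⟩ := Finset.exists_le_card_fiber_of_mul_le_card_of_maps_to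
    (s := (Finset.univ : Finset (Fin k)))
    (t := Fintype.piFinset fun _ : Fin (n + 1) × Fin d => Finset.Icc (-(N : ℤ)) N)
    (f := fun i j => ⌊v i j.1 j.2 / (ρ / N)⌋) (n := (n + 1) * L)
    (fun i _ => by
      rw [Fintype.mem_piFinset]
      intro j
      apply floor_div_mem_Icc ha
      rw [mul_div_cancel₀ _ hNr.ne']
      exact (EuclideanSpace.abs_apply_le_norm _ _).trans (hvX i j.1).2)
    ⟨fun _ => 0, by simp⟩
    (by rw [card_piFinset_Icc_neg]; simpa using hk)
  set T := {i ∈ (Finset.univ : Finset (Fin k)) | (fun j : Fin (n + 1) × Fin d =>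
    ⌊v i j.1 j.2 / (ρ / N)⌋) = y} with hT
  obtain ⟨e⟩ : Nonempty (Fin (n + 1) × Fin L ↪ T) :=
    Function.Embedding.nonempty_of_card_le (by simpa using hy)
  set ι : Fin (n + 1) × Fin L → Fin k := fun j => e j with hι
  have hinj : Function.Injective ι := Subtype.val_injective.comp e.injective
  have hclose : ∀ j j' l, ‖v (ι j) l - v (ι j') l‖ ≤ d * (ρ / N) := by
    intro j j' l
    have hj := (Finset.mem_filter.1 (e j).2).2
    have hj' := (Finset.mem_filter.1 (e j').2).2
    refine (EuclideanSpace.norm_le_card_mul (c := ρ / N) _ fun c => ?_).trans (by simp)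
    rw [PiLp.sub_apply]
    exact abs_sub_le_of_floor_div_eq ha ((congrFun hj (l, c)).trans (congrFun hj' (l, c)).symm)
  set g : (Fin (n + 1) → Fin L) → Fin (n + 1) × Fin L → EuclideanSpace ℝ (Fin d) :=
    fun a j => if j.2 < a j.1 then v (ι j) j.1 else 0 with hg
  have hgnorm : ∀ a j, ‖g a j‖ ≤ ρ := by
    intro a j
    simp only [hg]
    split_ifs
    · exact (hvX _ _).2
    · simpa using hρ.le
  refine ⟨fun a => ∑ i, x i + ∑ j, g a j, fun a => ⟨?_, ?_⟩, fun a a' haa => ?_⟩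
  · refine ⟨fun i => x i + Function.extend ι (g a) 0 i, fun i => ?_, ?_⟩
    · by_cases h : ∃ j, ι j = i
      · obtain ⟨j, rfl⟩ := h
        dsimp only
        rw [hinj.extend_apply]
        simp only [hg]
        split_ifs
        · exact (hvX _ _).1
        · simpa using hxX _
      · dsimp only
        rw [Function.extend_apply' _ _ _ h]
        simpa using hxX i
    · rw [Finset.sum_add_distrib]
      congr 1
      refine (Fintype.sum_of_injective ι hinj _ _ (fun i hi => ?_) fun j => ?_).symm
      · exact Function.extend_apply' _ _ _ hi
      · exact (hinj.extend_apply _ _ _).symm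
  · rw [add_sub_cancel_left]
    refine (norm_sum_le_of_le _ fun j _ => hgnorm a j).trans ?_
    simp
  · set j₀ : Fin (n + 1) × Fin L := (0, ⟨0, hL⟩)
    set s : (Fin (n + 1) → Fin L) → Fin (n + 1) × Fin L → ℤ :=
      fun a j => if j.2 < a j.1 then 1 else 0 with hs
    have hsum : ∀ a l, ∑ t, s a (l, t) = (a l : ℤ) := by
      intro a l
      simp only [hs, Finset.sum_boole]
      rw [Finset.filter_gt_eq_Iio, Fin.card_Iio]
    set b : Fin (n + 1) → ℤ := fun l => ∑ t, (s a (l, t) - s a' (l, t)) with hb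
    have hb0 : b ≠ 0 := by
      intro h
      apply haa
      funext l
      have h1 := congrFun h l
      simp only [hb, Finset.sum_sub_distrib, hsum, Pi.zero_apply] at h1
      exact Fin.ext (by omega)
    have h1 := hv (ι j₀) b hb0
    have h2 : ∑ l, b l • v (ι j₀) l = ∑ j, (s a j - s a' j) • v (ι j₀) j.1 := by
      rw [Fintype.sum_prod_type]
      exact Finset.sum_congr rfl fun l _ => by rw [hb, Finset.sum_smul]
    have h3 : ‖∑ j, (s a j - s a' j) • v (ι j₀) j.1 - ∑ j, (g a j - g a' j)‖ ≤
        (n + 1) * L * (d * (ρ / N)) := by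
      rw [← Finset.sum_sub_distrib]
      refine (norm_sum_le_of_le (f := fun j => (s a j - s a' j) • v (ι j₀) j.1 - (g a j - g a' j))
        _ (n := fun _ => d * (ρ / N)) fun j _ => ?_).trans (by simp)
      have h4 := hclose j j₀ j.1
      have h5 : 0 ≤ d * (ρ / N) := by positivity
      simp only [hs, hg]
      split_ifs
      · simpa using h5
      · simpa [norm_sub_rev] using h4
      · simpa [← sub_eq_neg_add] using h4
      · simpa using h5
    have h4 : ((n : ℝ) + 1) * L * (d * (ρ / N)) ≤ ρ / (2 * Q) := by
      have hQr : (0 : ℝ) < Q := by exact_mod_cast hQ0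
      have hNN : (2 * (n + 1) * L * d * Q : ℝ) ≤ N := by exact_mod_cast hN
      have e1 : ((n : ℝ) + 1) * L * (d * (ρ / N)) = ((n + 1) * L * d * ρ) / N := by ring
      rw [e1, div_le_div_iff₀ hNr (by positivity)]
      nlinarith
    have h5 : ∑ i, x i + ∑ j, g a j - (∑ i, x i + ∑ j, g a' j) = ∑ j, (g a j - g a' j) := by
      rw [Finset.sum_sub_distrib]; abel
    simp only [h5]
    rw [h2] at h1
    have h6 := norm_sub_norm_le (∑ j, (s a j - s a' j) • v (ι j₀) j.1) (∑ j, (g a j - g a' j))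
    have h7 : ρ / (2 * Q) = ρ / Q / 2 := by rw [div_div, mul_comm]
    rw [h7] at h4 ⊢
    linarith

/-- A set which branches at every scale contains large separated subsets. -/
lemma exists_separated_finset {E κ : Type*} [NormedAddCommGroup E] [Fintype κ] {S : Set E}
    {D σ m r₁ : ℝ} (hD : 0 ≤ D) (hσ : 0 < σ) (hm : 2 ≤ m) (hDm : 8 * D ≤ σ * m)
    (hbr : ∀ p ∈ S, ∀ ρ, r₁ ≤ ρ → ρ ≤ 1 → ∃ f : κ → E,
      (∀ a, f a ∈ S ∧ ‖f a - p‖ ≤ D * ρ) ∧ ∀ a a', a ≠ a' → σ * ρ ≤ ‖f a - f a'‖)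
    (J : ℕ) : ∀ ρ : ℝ, 0 < ρ → ρ ≤ 1 → (J ≠ 0 → r₁ ≤ ρ / m ^ J) → ∀ p ∈ S, ∃ F : Finset E,
      (∀ q ∈ F, q ∈ S ∧ ‖q - p‖ ≤ 2 * D * ρ) ∧ F.card = Fintype.card κ ^ J ∧
      ∀ q ∈ F, ∀ q' ∈ F, q ≠ q' → σ / 2 * (ρ / m ^ J) ≤ ‖q - q'‖ := by
  classical
  induction J with
  | zero =>
    intro ρ hρ _ _ p hp
    refine ⟨{p}, ?_, by simp, ?_⟩
    · intro q hq
      rw [Finset.mem_singleton.1 hq]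
      exact ⟨hp, by simp; positivity⟩
    · intro q hq q' hq' h
      rw [Finset.mem_singleton.1 hq, Finset.mem_singleton.1 hq'] at h
      exact absurd rfl h
  | succ J ih =>
    intro ρ hρ hρ1 hJ p hp
    have hm0 : 0 < m := by linarith
    have hJ' := hJ (by simp)
    have hpow : ρ / m ^ (J + 1) = ρ / m / m ^ J := by rw [pow_succ', div_div]
    have hle : ρ / m ^ (J + 1) ≤ ρ := div_le_self hρ.le (one_le_pow₀ (by linarith))
    obtain ⟨f, hf, hfsep⟩ := hbr p hp ρ (hJ'.trans hle) hρ1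
    have hρm : ρ / m ≤ ρ := div_le_self hρ.le (by linarith)
    choose F hF hFcard hFsep using fun a => ih (ρ / m) (by positivity) (hρm.trans hρ1)
      (fun _ => by rwa [← hpow]) (f a) (hf a).1
    have hDρ : 2 * D * (ρ / m) ≤ σ * ρ / 4 := by
      have : 2 * D * (ρ / m) = 2 * D * ρ / m := by ring
      rw [this, div_le_iff₀ hm0]
      nlinarith
    have hDρ2 : 2 * D * (ρ / m) ≤ D * ρ := by
      have : 2 * D * (ρ / m) = 2 * D * ρ / m := by ring
      rw [this, div_le_iff₀ hm0]
      nlinarith [mul_nonneg hD hρ.le]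
    have hsep : ∀ a a', a ≠ a' → ∀ q ∈ F a, ∀ q' ∈ F a', σ / 2 * ρ ≤ ‖q - q'‖ := by
      intro a a' haa q hq q' hq'
      have h1 := (hF a q hq).2
      have h2 := (hF a' q' hq').2
      have h3 := hfsep a a' haa
      have h4 : f a - f a' = (q - q') + (q' - f a') - (q - f a) := by abel
      have h5 : ‖f a - f a'‖ ≤ ‖q - q'‖ + ‖q' - f a'‖ + ‖q - f a‖ := by
        rw [h4]
        exact (norm_sub_le _ _).trans (by gcongr; exact norm_add_le _ _)
      linarith
    refine ⟨Finset.univ.biUnion F, ?_, ?_, ?_⟩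
    · intro q hq
      obtain ⟨a, -, hqa⟩ := Finset.mem_biUnion.1 hq
      refine ⟨(hF a q hqa).1, ?_⟩
      have h1 := (hF a q hqa).2
      have h2 := (hf a).2
      have h3 := norm_add_le (q - f a) (f a - p)
      rw [sub_add_sub_cancel] at h3
      linarith
    · rw [Finset.card_biUnion]
      · simp only [hFcard, Finset.sum_const, Finset.card_univ, smul_eq_mul, pow_succ']
      · intro a _ a' _ haa
        rw [Function.onFun, Finset.disjoint_left]
        intro q hq hq'
        have h1 := hsep a a' haa q hq q hq'
        rw [sub_self, norm_zero] at h1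
        have : 0 < σ / 2 * ρ := by positivity
        linarith
    · intro q hq q' hq' hqq
      obtain ⟨a, -, hqa⟩ := Finset.mem_biUnion.1 hq
      obtain ⟨a', -, hqa'⟩ := Finset.mem_biUnion.1 hq'
      by_cases haa : a = a'
      · subst haa
        rw [hpow]
        exact hFsep a q hqa q' hqa' hqq
      · refine le_trans ?_ (hsep a a' haa q hqa q' hqa')
        gcongr

/-- The index of the cell of side `h` containing `x`. -/
noncomputable def cell {d : ℕ} (h : ℝ) (x : EuclideanSpace ℝ (Fin d)) : Fin d → ℤ :=
  fun c => ⌊x c / h⌋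

lemma cell_mul_le {d : ℕ} {h : ℝ} (hh : 0 < h) (x : EuclideanSpace ℝ (Fin d)) (c : Fin d) :
    cell h x c * h ≤ x c ∧ x c < cell h x c * h + h := by
  constructor
  · rw [← le_div_iff₀ hh]
    exact Int.floor_le _
  · rw [← add_one_mul, ← div_lt_iff₀ hh]
    exact Int.lt_floor_add_one _

lemma volume_cell_preimage {d : ℕ} {h : ℝ} (hh : 0 < h) (a : Fin d → ℤ) :
    MeasurableSet (cell h ⁻¹' {a}) ∧ volume (cell h ⁻¹' {a}) = ENNReal.ofReal (h ^ d) := by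
  have hset : cell h ⁻¹' {a} = (MeasurableEquiv.toLp 2 (Fin d → ℝ)).symm ⁻¹'
      (univ.pi fun c => Ico (a c * h) (a c * h + h)) := by
    ext x
    have hx : (MeasurableEquiv.toLp 2 (Fin d → ℝ)).symm x = fun c => x c := rfl
    simp only [mem_preimage, mem_singleton_iff, mem_univ_pi, hx, mem_Ico]
    constructor
    · rintro rfl c
      exact cell_mul_le hh x c
    · intro H
      funext c
      obtain ⟨h1, h2⟩ := H c
      rw [← le_div_iff₀ hh] at h1
      rw [← add_one_mul, ← div_lt_iff₀ hh] at h2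
      exact Int.floor_eq_iff.2 ⟨h1, h2⟩
  have hmeas : MeasurableSet (univ.pi fun c => Ico (a c * h) (a c * h + h) : Set (Fin d → ℝ)) :=
    MeasurableSet.univ_pi fun _ => measurableSet_Ico
  refine ⟨hset ▸ (MeasurableEquiv.measurable _) hmeas, ?_⟩
  rw [hset, (EuclideanSpace.volume_preserving_symm_measurableEquiv_toLp (Fin d)).measure_preimage
    hmeas.nullMeasurableSet, Real.volume_pi_Ico]
  simp [ENNReal.ofReal_pow hh.le]

lemma card_mul_le_volume {d : ℕ} {h : ℝ} (hh : 0 < h) (B : Finset (Fin d → ℤ))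
    {U : Set (EuclideanSpace ℝ (Fin d))} (hU : ∀ p, cell h p ∈ B → p ∈ U) :
    ENNReal.ofReal (B.card * h ^ d) ≤ volume U := by
  calc ENNReal.ofReal (B.card * h ^ d) = ∑ a ∈ B, volume (cell h ⁻¹' {a}) := by
        rw [Finset.sum_congr rfl fun a _ => (volume_cell_preimage hh a).2,
          ENNReal.ofReal_mul (by positivity)]
        simp
    _ = volume (⋃ a ∈ B, cell h ⁻¹' {a}) := by
        refine (measure_biUnion_finset (fun a _ a' _ haa => ?_)
          fun a _ => (volume_cell_preimage hh a).1).symm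
        exact Disjoint.preimage _ (by simpa using haa)
    _ ≤ volume U := by
        refine measure_mono fun p hp => hU p ?_
        simp only [mem_iUnion, mem_preimage, mem_singleton_iff] at hp
        obtain ⟨a, ha, rfl⟩ := hp
        exact ha

/-- The cells meeting a bounded set, as a finset. -/
lemma exists_cell_finset {d : ℕ} {h : ℝ} (hh : 0 < h) {X : Set (EuclideanSpace ℝ (Fin d))}
    (hX : X ⊆ closedBall 0 1) : ∃ A : Finset (Fin d → ℤ), ∀ a, a ∈ A ↔ ∃ x ∈ X, cell h x = a := by
  have hfin : (cell h '' X).Finite := by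
    obtain ⟨N, hN⟩ := exists_nat_ge (1 / h)
    refine (Finset.finite_toSet (Fintype.piFinset
      fun _ : Fin d => Finset.Icc (-(N : ℤ)) N)).subset ?_
    rintro _ ⟨x, hx, rfl⟩
    rw [Finset.mem_coe, Fintype.mem_piFinset]
    intro c
    apply floor_div_mem_Icc hh
    rw [div_le_iff₀ hh] at hN
    have := hX hx
    rw [mem_closedBall_zero_iff] at this
    exact (EuclideanSpace.abs_apply_le_norm x c).trans (this.trans hN)
  exact ⟨hfin.toFinset, fun a => by simp⟩

lemma rpow_neg_le_card_cells {d : ℕ} (hd : 0 < d) {δ r C : ℝ}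
    {X : Set (EuclideanSpace ℝ (Fin d))}
    {μ : Measure (EuclideanSpace ℝ (Fin d))} (hμ : IsRegularMeasure δ r 1 C X μ)
    (hr : 0 < r) (hr1 : r < 1) (hC : 1 < C) (hne : X.Nonempty) {A : Finset (Fin d → ℤ)}
    (hA : ∀ x ∈ X, cell (r / d) x ∈ A) : (C ^ 2)⁻¹ * r ^ (-δ) ≤ A.card := by
  obtain ⟨-, hsupp, hup, hlow⟩ := hμ
  obtain ⟨x, hx⟩ := hne
  have hd' : (0 : ℝ) < d := by exact_mod_cast hd
  have hh : 0 < r / d := by positivity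
  have hC0 : 0 < C := by linarith
  have h1 : μ X ≤ A.card * ENNReal.ofReal (C * r ^ δ) := by
    refine measure_le_card_mul_of_fibers (cell (r / d)) A hA (R := r)
      (fun y _ => hup y r le_rfl hr1.le) fun y _ z _ hyz => ?_
    refine (EuclideanSpace.norm_le_card_mul (c := r / d) _ fun c => ?_).trans ?_
    · exact abs_sub_le_of_floor_div_eq hh (congrFun hyz c).symm
    · rw [Fintype.card_fin, mul_div_cancel₀ _ hd'.ne']
  have h2 : μ (closedBall x 1) ≤ μ X := by
    refine (measure_mono (subset_univ _)).trans ?_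
    rw [← union_compl_self X]
    refine (measure_union_le _ _).trans ?_
    rw [hsupp, add_zero]
  have h3 := (hlow x hx 1 hr1.le le_rfl).trans (h2.trans h1)
  rw [← ENNReal.ofReal_natCast, ← ENNReal.ofReal_mul (by positivity),
    ENNReal.ofReal_le_ofReal_iff (by positivity), Real.one_rpow, mul_one] at h3
  have hrδ : 0 < r ^ δ := Real.rpow_pos_of_pos hr _
  rw [Real.rpow_neg hr.le, ← mul_inv, inv_le_iff_one_le_mul₀ (by positivity)]
  rw [inv_le_iff_one_le_mul₀ hC0] at h3
  linarith

lemma card_le_card_nsmul_cells {d k : ℕ} (hd : 0 < d) {r : ℝ} (hr : 0 < r)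
    {X : Set (EuclideanSpace ℝ (Fin d))} {A : Finset (Fin d → ℤ)}
    (hA : ∀ x ∈ X, cell (r / d) x ∈ A) {F : Finset (EuclideanSpace ℝ (Fin d))}
    (hF : ∀ q ∈ F, q ∈ kSum k X)
    (hsep : ∀ q ∈ F, ∀ q' ∈ F, q ≠ q' → 2 * k * r < ‖q - q'‖) : F.card ≤ (k • A).card := by
  have hd' : (0 : ℝ) < d := by exact_mod_cast hd
  have hh : 0 < r / d := by positivity
  choose! x hxX hx using hF
  refine Finset.card_le_card_of_injOn (fun q => ∑ i, cell (r / d) (x q i)) ?_ ?_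
  · intro q hq
    rw [Finset.mem_coe, Finset.mem_nsmul]
    exact ⟨fun i => ⟨_, hA _ (hxX q hq i)⟩, by rw [List.sum_ofFn]⟩
  · intro q hq q' hq' hqq
    by_contra hne
    refine absurd (hsep q hq q' hq' hne) (not_lt.2 ?_)
    have hclose : ∀ q ∈ F, ∀ c, |q c - (∑ i, cell (r / d) (x q i)) c * (r / d)| ≤ k * (r / d) := by
      intro q hq c
      have e : q c - ((∑ i, cell (r / d) (x q i)) c : ℤ) * (r / d) =
          ∑ i, (x q i c - cell (r / d) (x q i) c * (r / d)) := by
        have hqc : q c = ∑ i, x q i c := by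
          conv_lhs => rw [← hx q hq]
          simp
        rw [Finset.sum_sub_distrib, ← Finset.sum_mul, hqc]
        simp [Finset.sum_apply]
      rw [e]
      refine (Finset.abs_sum_le_sum_abs _ _).trans ((Finset.sum_le_sum (g := fun _ => r / d)
        fun i _ => ?_).trans (by simp))
      have := cell_mul_le hh (x q i) c
      rw [abs_le]
      constructor <;> linarith
    refine (EuclideanSpace.norm_le_card_mul (c := 2 * k * (r / d)) _ fun c => ?_).trans ?_
    · have h1 := abs_le.1 (hclose q hq c)
      have h2 := abs_le.1 (hclose q' hq' c)
      dsimp only at hqq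
      rw [← hqq] at h2
      rw [PiLp.sub_apply, abs_le]
      constructor <;> linarith
    · rw [Fintype.card_fin]
      apply le_of_eq
      field_simp

lemma mem_add_of_cell_mem {d : ℕ} (hd : 0 < d) {r : ℝ} (hr : 0 < r)
    {X : Set (EuclideanSpace ℝ (Fin d))} {A : Finset (Fin d → ℤ)}
    (hA : ∀ a ∈ A, ∃ x ∈ X, cell (r / d) x = a) {p : EuclideanSpace ℝ (Fin d)}
    (hp : cell (r / d) p ∈ A + A) : p ∈ (X + closedBall 0 r) + (X + closedBall 0 r) := by
  have hd' : (0 : ℝ) < d := by exact_mod_cast hd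
  have hh : 0 < r / d := by positivity
  obtain ⟨a, ha, a', ha', haa⟩ := Finset.mem_add.1 hp
  obtain ⟨x, hx, rfl⟩ := hA a ha
  obtain ⟨y, hy, rfl⟩ := hA a' ha'
  have he : ‖(2⁻¹ : ℝ) • (p - x - y)‖ ≤ r := by
    refine (EuclideanSpace.norm_le_card_mul (c := r / d) _ fun c => ?_).trans ?_
    · have h1 := cell_mul_le hh x c
      have h2 := cell_mul_le hh y c
      have h3 := cell_mul_le hh p c
      rw [← haa, Pi.add_apply, Int.cast_add] at h3
      simp only [PiLp.smul_apply, PiLp.sub_apply, smul_eq_mul]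
      rw [abs_le]
      constructor <;> linarith
    · rw [Fintype.card_fin, mul_div_cancel₀ _ hd'.ne']
  refine ⟨x + (2⁻¹ : ℝ) • (p - x - y), add_mem_add hx (by simpa using he),
    y + (2⁻¹ : ℝ) • (p - x - y), add_mem_add hy (by simpa using he), ?_⟩
  simp only
  module

lemma mem_sub_of_cell_mem {d : ℕ} (hd : 0 < d) {r : ℝ} (hr : 0 < r)
    {X : Set (EuclideanSpace ℝ (Fin d))} {A : Finset (Fin d → ℤ)}
    (hA : ∀ a ∈ A, ∃ x ∈ X, cell (r / d) x = a) {p : EuclideanSpace ℝ (Fin d)}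
    (hp : cell (r / d) p ∈ A - A) : p ∈ (X + closedBall 0 r) - (X + closedBall 0 r) := by
  have hd' : (0 : ℝ) < d := by exact_mod_cast hd
  have hh : 0 < r / d := by positivity
  obtain ⟨a, ha, a', ha', haa⟩ := Finset.mem_sub.1 hp
  obtain ⟨x, hx, rfl⟩ := hA a ha
  obtain ⟨y, hy, rfl⟩ := hA a' ha'
  have he : ‖(2⁻¹ : ℝ) • (p - x + y)‖ ≤ r := by
    refine (EuclideanSpace.norm_le_card_mul (c := r / d) _ fun c => ?_).trans ?_
    · have h1 := cell_mul_le hh x c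
      have h2 := cell_mul_le hh y c
      have h3 := cell_mul_le hh p c
      rw [← haa, Pi.sub_apply, Int.cast_sub] at h3
      simp only [PiLp.smul_apply, PiLp.sub_apply, PiLp.add_apply, smul_eq_mul]
      rw [abs_le]
      constructor <;> linarith
    · rw [Fintype.card_fin, mul_div_cancel₀ _ hd'.ne']
  refine ⟨x + (2⁻¹ : ℝ) • (p - x + y), add_mem_add hx (by simpa using he),
    y + -((2⁻¹ : ℝ) • (p - x + y)), add_mem_add hy ?_, ?_⟩
  · rw [mem_closedBall_zero_iff, norm_neg]
    exact he
  · simp only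
    module

/-- The `k`-fold sumset of the cells of `X` has dimension at least `s > δ`. -/
lemma rpow_neg_le_card_nsmul_cells {d n k L N Q : ℕ} (hd : 0 < d) {δ r C m s : ℝ}
    {X : Set (EuclideanSpace ℝ (Fin d))}
    {μ : Measure (EuclideanSpace ℝ (Fin d))} (hμ : IsRegularMeasure δ r 1 C X μ)
    (hr : 0 < r) (hC : 1 < C) (hne : X.Nonempty) (hdQ : d + 2 ≤ Q)
    (hQ : (5 * Q : ℝ) ^ n * (d + 2 : ℝ) ^ δ * C ^ 2 < (Q : ℝ) ^ δ)
    (hL : 0 < L) (hN0 : 0 < N) (hN : 2 * (n + 1) * L * d * Q ≤ N) (hk0 : 0 < k)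
    (hk : (2 * N + 1) ^ ((n + 1) * d) * ((n + 1) * L) ≤ k)
    (hm : 2 ≤ m) (hmL : 16 * (n + 1) * L * Q ≤ m) (hs : 0 < s)
    (hms : m ^ s ≤ (L : ℝ) ^ (n + 1)) {A : Finset (Fin d → ℤ)}
    (hA : ∀ x ∈ X, cell (r / d) x ∈ A) :
    (m * (16 * k * Q * r)) ^ (-s) ≤ (k • A).card := by
  obtain ⟨x₀, hx₀⟩ := hne
  have hQ0 : 0 < Q := by omega
  have hQr : (0 : ℝ) < Q := by exact_mod_cast hQ0
  have hk1 : (1 : ℝ) ≤ k := by exact_mod_cast hk0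
  have hm0 : 0 < m := by linarith
  set G : ℝ := 16 * k * Q * r with hG
  have hG0 : 0 < G := by positivity
  rcases lt_or_ge 1 G with hG1 | hG1
  · have h1 : (m * G) ^ (-s) ≤ 1 :=
      Real.rpow_le_one_of_one_le_of_nonpos (by nlinarith) (by linarith)
    have h2 : (k • A).Nonempty := Finset.Nonempty.nsmul ⟨_, hA x₀ hx₀⟩
    refine h1.trans ?_
    exact_mod_cast h2.card_pos
  · obtain ⟨J, hJ, hJ'⟩ := exists_nat_pow_near (x := 1 / G) (y := m)
      (by rw [le_div_iff₀ hG0]; linarith) (by linarith)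
    have hGJ : G ≤ 1 / m ^ J := by
      rw [le_div_iff₀ hG0] at hJ
      rw [le_div_iff₀ (by positivity)]
      linarith
    have hrG : r * Q ≤ G := by
      have : 0 < r * Q := by positivity
      rw [hG]
      nlinarith
    obtain ⟨F, hF, hFcard, hFsep⟩ := exists_separated_finset (S := kSum k X)
      (κ := Fin (n + 1) → Fin L) (D := (n + 1) * L) (σ := 1 / (2 * Q)) (m := m) (r₁ := G)
      (by positivity) (by positivity) hm
      (by
        rw [one_div, inv_mul_eq_div, le_div_iff₀ (by positivity)]
        linarith)
      (fun p hp ρ hρ hρ1 => by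
        obtain ⟨f, hf, hf'⟩ := exists_separated_family_kSum hL hQ0 hN0 (hG0.trans_le hρ)
          (fun x hx => exists_frame hμ hr hC hdQ hQ hx (hrG.trans hρ) hρ1) hN hk hp
        refine ⟨f, hf, fun a a' haa => ?_⟩
        rw [one_div, inv_mul_eq_div]
        exact hf' a a' haa)
      J 1 one_pos le_rfl (fun _ => hGJ) (∑ _i : Fin k, x₀) ⟨fun _ => x₀, fun _ => hx₀, rfl⟩
    have hFA := card_le_card_nsmul_cells hd hr hA (fun q hq => (hF q hq).1)
      (fun q hq q' hq' hqq => by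
        refine lt_of_lt_of_le ?_ (hFsep q hq q' hq' hqq)
        have h1 : 1 / (2 * (Q : ℝ)) / 2 * G ≤ 1 / (2 * Q) / 2 * (1 / m ^ J) := by gcongr
        refine lt_of_lt_of_le ?_ h1
        have h2 : 1 / (2 * (Q : ℝ)) / 2 * G = 4 * k * r := by
          rw [hG]
          field_simp
          norm_num
        rw [h2]
        nlinarith [mul_pos (zero_lt_one.trans_le hk1) hr])
    have hcard : ((m ^ s) ^ J : ℝ) ≤ (k • A).card := by
      refine (pow_le_pow_left₀ (by positivity) hms J).trans ?_
      rw [hFcard] at hFA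
      have : ((Fintype.card (Fin (n + 1) → Fin L) ^ J : ℕ) : ℝ) ≤ (k • A).card := by
        exact_mod_cast hFA
      simpa using this
    refine le_trans ?_ hcard
    rw [Real.rpow_neg (by positivity), ← Real.inv_rpow (by positivity), ← Real.rpow_natCast,
      ← Real.rpow_mul hm0.le, mul_comm s, Real.rpow_mul hm0.le, Real.rpow_natCast]
    refine Real.rpow_le_rpow (by positivity) ?_ hs.le
    rw [pow_succ, ← div_lt_iff₀ hm0] at hJ'
    refine le_of_lt (lt_of_eq_of_lt ?_ hJ')
    rw [mul_inv, one_div, mul_comm, div_eq_mul_inv]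

lemma rpow_le_of_pluennecke {a P k' : ℝ} {k : ℕ} {c₁ c₂ r δ s : ℝ} (hk : 0 < k)
    (hc₁ : 0 < c₁) (hc₂ : 0 < c₂) (hr : 0 < r) (hP : 0 ≤ P)
    (ha : c₁ * r ^ (-δ) ≤ a) (hk' : c₂ * r ^ (-s) ≤ k') (hpl : k' ≤ (P / a) ^ k * a) :
    (c₂ * c₁ ^ (k - 1)) ^ (1 / k : ℝ) * r ^ (-δ - (s - δ) / k) ≤ P := by
  obtain ⟨j, rfl⟩ : ∃ j, k = j + 1 := ⟨k - 1, by omega⟩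
  have hrδ : 0 < r ^ (-δ) := Real.rpow_pos_of_pos hr _
  have hrs : 0 < r ^ (-s) := Real.rpow_pos_of_pos hr _
  have ha0 : 0 < a := lt_of_lt_of_le (by positivity) ha
  refine le_of_pow_le_pow_left₀ (n := j + 1) (by simp) hP ?_
  have h1 : k' * a ^ j ≤ P ^ (j + 1) := by
    have : (P / a) ^ (j + 1) * a * a ^ j = P ^ (j + 1) := by
      rw [mul_assoc, ← pow_succ', ← mul_pow, div_mul_cancel₀ _ ha0.ne']
    rw [← this]
    gcongr
  refine le_trans ?_ h1
  have hj : ((j + 1 : ℕ) : ℝ) ≠ 0 := by positivity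
  have h2 : ((c₂ * c₁ ^ (j + 1 - 1)) ^ (1 / (j + 1 : ℕ) : ℝ) *
      r ^ (-δ - (s - δ) / (j + 1 : ℕ))) ^ (j + 1) = (c₂ * r ^ (-s)) * (c₁ * r ^ (-δ)) ^ j := by
    rw [mul_pow, ← Real.rpow_natCast, ← Real.rpow_mul (by positivity), one_div,
      inv_mul_cancel₀ hj, Real.rpow_one, ← Real.rpow_natCast (r ^ _), ← Real.rpow_mul hr.le,
      mul_pow, ← Real.rpow_natCast (r ^ (-δ)), ← Real.rpow_mul hr.le]
    have e : (-δ - (s - δ) / (j + 1 : ℕ)) * (j + 1 : ℕ) = -s + -δ * j := by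
      field_simp
      push_cast
      ring
    rw [e, Real.rpow_add hr, Nat.add_sub_cancel]
    ring
  rw [h2]
  have : 0 ≤ k' := le_trans (by positivity) hk'
  gcongr

/-- Parameters, polynomial in `C`, for which the branching argument applies. -/
lemma exists_parameters (d n : ℕ) {δ s : ℝ} (hn : (n : ℝ) < δ) (hδs : δ < s) (hsn : s < n + 1) :
    ∃ K : ℝ, 0 < K ∧ ∀ C : ℝ, 1 < C → ∃ Q L N k : ℕ, ∃ m : ℝ,
      d + 2 ≤ Q ∧ (5 * Q : ℝ) ^ n * (d + 2 : ℝ) ^ δ * C ^ 2 < (Q : ℝ) ^ δ ∧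
      0 < L ∧ 0 < N ∧ 2 * (n + 1) * L * d * Q ≤ N ∧ 0 < k ∧
      (2 * N + 1) ^ ((n + 1) * d) * ((n + 1) * L) ≤ k ∧
      2 ≤ m ∧ 16 * (n + 1) * L * Q ≤ m ∧ m ^ s ≤ (L : ℝ) ^ (n + 1) ∧
      Real.exp (-K * (1 + Real.log C)) ≤ (s - δ) / k := by
  obtain ⟨A, hA⟩ := exists_nat_ge (2 * s / (n + 1 - s))
  rw [div_le_iff₀ (by linarith)] at hA
  have hn0 : (0 : ℝ) ≤ n := by positivity
  have hδn : 0 < δ - n := by linarith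
  set b : ℝ := 2 / (δ - n) with hb
  set T : ℝ := (5 : ℝ) ^ n * (d + 2 : ℝ) ^ δ with hT
  have hT0 : 0 < T := by positivity
  set M : ℝ := 16 * (n + 1) + d + 2 + T ^ (1 / (δ - n)) with hM
  have hTp : 0 < T ^ (1 / (δ - n)) := Real.rpow_pos_of_pos hT0 _
  have hM1 : 1 ≤ M := by
    have : (0 : ℝ) ≤ d := by positivity
    linarith
  set e : ℕ := (A + 4) * ((n + 1) * d) + (A + 1) with he
  have hlogM : 0 < Real.log (2 * M) := Real.log_pos (by linarith)
  have hb0 : 0 < b := by positivity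
  refine ⟨|Real.log (s - δ)| + e * (Real.log (2 * M) + b), by positivity, fun C hC => ?_⟩
  have hC0 : 0 < C := by linarith
  have hCb : 1 ≤ C ^ b := Real.one_le_rpow hC.le hb0.le
  set Q : ℕ := ⌈M * C ^ b⌉₊ with hQdef
  have hMQ : M * C ^ b ≤ Q := Nat.le_ceil _
  have hMC : 1 ≤ M * C ^ b := by nlinarith
  have hQM : (Q : ℝ) ≤ 2 * M * C ^ b := by
    have := (Nat.ceil_lt_add_one (zero_le_one.trans hMC)).le
    linarith
  have hMQ' : M ≤ Q := by nlinarith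
  have hQbig : 16 * (n + 1) + d + 2 ≤ Q := by
    have : (16 * (n + 1) + d + 2 : ℝ) ≤ Q := by linarith
    exact_mod_cast this
  have hQ0 : 0 < Q := by omega
  have hQr : (1 : ℝ) ≤ Q := by exact_mod_cast hQ0
  have hQr0 : (0 : ℝ) < Q := by linarith
  refine ⟨Q, Q ^ A, Q ^ (A + 3), Q ^ e, (Q : ℝ) ^ (A + 2), by omega, ?_, by positivity,
    by positivity, ?_, by positivity, ?_, ?_, ?_, ?_, ?_⟩
  · have h1 : T * C ^ 2 < (Q : ℝ) ^ (δ - n) := by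
      have h2 : (T ^ (1 / (δ - n)) * C ^ b) ^ (δ - n) = T * C ^ 2 := by
        rw [Real.mul_rpow hTp.le (by positivity), ← Real.rpow_mul hT0.le, ← Real.rpow_mul hC0.le,
          hb, div_mul_cancel₀ _ hδn.ne', div_mul_cancel₀ _ hδn.ne', Real.rpow_one]
        norm_cast
      rw [← h2]
      refine Real.rpow_lt_rpow (by positivity) ?_ hδn
      refine lt_of_lt_of_le ?_ hMQ
      have : T ^ (1 / (δ - n)) < M := by
        have : (0 : ℝ) ≤ d := by positivity
        linarith
      gcongr
    have h3 : (Q : ℝ) ^ δ = (Q : ℝ) ^ (δ - n) * (Q : ℝ) ^ n := by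
      rw [← Real.rpow_natCast, ← Real.rpow_add hQr0, sub_add_cancel]
    rw [h3, mul_pow]
    calc (5 : ℝ) ^ n * (Q : ℝ) ^ n * (d + 2 : ℝ) ^ δ * C ^ 2 = T * C ^ 2 * (Q : ℝ) ^ n := by
          rw [hT]; ring
      _ < _ := by gcongr
  · calc 2 * (n + 1) * Q ^ A * d * Q ≤ Q * Q ^ A * Q * Q := by
          gcongr <;> omega
      _ = Q ^ (A + 3) := by ring
  · calc (2 * Q ^ (A + 3) + 1) ^ ((n + 1) * d) * ((n + 1) * Q ^ A)
        ≤ (Q ^ (A + 4)) ^ ((n + 1) * d) * (Q * Q ^ A) := by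
          have h1 : 1 ≤ Q ^ (A + 3) := Nat.one_le_pow _ _ hQ0
          have h2 : 2 * Q ^ (A + 3) + 1 ≤ Q ^ (A + 4) := by
            rw [pow_succ Q (A + 3)]
            nlinarith
          gcongr
          omega
      _ = Q ^ e := by rw [he, pow_add Q (_ * _), pow_mul Q (A + 4), pow_succ' Q A]
  · have h2 : (2 : ℝ) ≤ Q := by exact_mod_cast (by omega : 2 ≤ Q)
    exact h2.trans (le_self_pow₀ hQr (by simp))
  · have : (16 * (n + 1) : ℝ) ≤ Q := by exact_mod_cast (by omega : 16 * (n + 1) ≤ Q)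
    push_cast
    calc 16 * (n + 1) * (Q : ℝ) ^ A * Q ≤ Q * (Q : ℝ) ^ A * Q := by gcongr
      _ = (Q : ℝ) ^ (A + 2) := by ring
  · push_cast
    rw [← pow_mul, ← Real.rpow_natCast, ← Real.rpow_natCast, ← Real.rpow_mul hQr0.le]
    refine Real.rpow_le_rpow_of_exponent_le hQr ?_
    push_cast
    linarith
  · have hsδ : 0 < s - δ := by linarith
    push_cast
    rw [← Real.le_log_iff_exp_le (by positivity), Real.log_div hsδ.ne' (by positivity),
      Real.log_pow]
    have hlogC : 0 < Real.log C := Real.log_pos hC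
    have hlogQ : Real.log Q ≤ Real.log (2 * M) + b * Real.log C := by
      refine (Real.log_le_log hQr0 hQM).trans (le_of_eq ?_)
      rw [Real.log_mul (by positivity) (by positivity), Real.log_rpow hC0]
    have h1 : (e : ℝ) * Real.log Q ≤ e * (Real.log (2 * M) + b * Real.log C) := by gcongr
    have h2 := neg_abs_le (Real.log (s - δ))
    have h3 : 0 ≤ |Real.log (s - δ)| * Real.log C := by positivity
    have h4 : 0 ≤ e * Real.log (2 * M) * Real.log C := by positivity
    have h5 : 0 ≤ e * b := by positivity
    linarith

/-- **Expansion under sums and differences.** For non-integer `0 < δ < d`, if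
`X ⊆ B(0,1) ⊆ ℝᵈ` is `δ`-regular on scales `[r,1]` with constant `C` and
`X_r = X + B(0,r)`, then `|X_r + X_r|, |X_r - X_r| ≥ c · r^(d-δ-β)` where
`β = exp(-K₁(1 + (log C)^K₂))` for `K₁, K₂ > 0` depending only on `δ, d`, and `c > 0`
depends only on `C, δ, d`. -/
theorem sumset_expansion_regular :
    ∀ (d : ℕ), 1 ≤ d → ∀ δ : ℝ, 0 < δ → δ < d → (∀ n : ℤ, δ ≠ n) →
      ∃ K₁ K₂ : ℝ, 0 < K₁ ∧ 0 < K₂ ∧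
        ∀ C : ℝ, 1 < C →
          ∃ c : ℝ, 0 < c ∧
            ∀ (r : ℝ) (X : Set (EuclideanSpace ℝ (Fin d))),
              0 < r → r < 1 →
              X ⊆ closedBall 0 1 →
              IsRegularSet δ r 1 C X →
              ENNReal.ofReal
                  (c * r ^ ((d : ℝ) - δ - Real.exp (-K₁ * (1 + Real.log C ^ K₂)))) ≤
                volume ((X + closedBall 0 r) + (X + closedBall 0 r)) ∧
              ENNReal.ofReal
                  (c * r ^ ((d : ℝ) - δ - Real.exp (-K₁ * (1 + Real.log C ^ K₂)))) ≤
                volume ((X + closedBall 0 r) - (X + closedBall 0 r)) := by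
  intro d hd δ hδ0 hδd hδ
  have hd0 : 0 < d := hd
  have hd' : (0 : ℝ) < d := by exact_mod_cast hd0
  set n := ⌊δ⌋₊ with hn
  have hn1 : (n : ℝ) < δ :=
    lt_of_le_of_ne (Nat.floor_le hδ0.le) fun h => hδ n (by rw [← h]; simp)
  have hn2 : δ < n + 1 := Nat.lt_floor_add_one δ
  set s : ℝ := (δ + (n + 1)) / 2 with hs
  obtain ⟨K, hK, hpar⟩ := exists_parameters d n (δ := δ) (s := s) hn1 (by linarith) (by linarith)
  refine ⟨K, 1, hK, one_pos, fun C hC => ?_⟩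
  obtain ⟨Q, L, N, k, m, hdQ, hQ, hL, hN0, hN, hk0, hk, hm, hmL, hms, hβ⟩ := hpar C hC
  rw [Real.rpow_one]
  have hC0 : 0 < C := by linarith
  have hm0 : 0 < m := by linarith
  have hQ0 : (0 : ℝ) < Q := by exact_mod_cast (by omega : 0 < Q)
  have hkr : (0 : ℝ) < k := by exact_mod_cast hk0
  set c₁ : ℝ := (C ^ 2)⁻¹ with hc₁
  set c₂ : ℝ := (m * (16 * k * Q)) ^ (-s) with hc₂
  have hc₁0 : 0 < c₁ := by positivity
  have hc₂0 : 0 < c₂ := by positivity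
  set c : ℝ := (c₂ * c₁ ^ (k - 1)) ^ (1 / k : ℝ) with hc
  have hc0 : 0 < c := by positivity
  refine ⟨c / (d : ℝ) ^ d, by positivity, fun r X hr hr1 hX ⟨_, hne, μ, hμ⟩ => ?_⟩
  have hh : 0 < r / d := by positivity
  obtain ⟨A, hA⟩ := exists_cell_finset hh hX
  have hAX : ∀ x ∈ X, cell (r / d) x ∈ A := fun x hx => (hA _).2 ⟨x, hx, rfl⟩
  have hAne : A.Nonempty := hne.elim fun x hx => ⟨_, hAX x hx⟩
  have hcardA := rpow_neg_le_card_cells hd0 hμ hr hr1 hC hne hAX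
  have hcardk := rpow_neg_le_card_nsmul_cells hd0 hμ hr hC hne hdQ hQ hL hN0 hN hk0 hk hm hmL
    (by linarith) hms hAX
  rw [← mul_assoc, Real.mul_rpow (by positivity) hr.le] at hcardk
  have hvol : ∀ (P : Finset (Fin d → ℤ)) (U : Set (EuclideanSpace ℝ (Fin d))),
      ((k • A).card : ℝ) ≤ ((P.card : ℝ) / A.card) ^ k * A.card →
      (∀ p, cell (r / d) p ∈ P → p ∈ U) →
      ENNReal.ofReal (c / (d : ℝ) ^ d * r ^ ((d : ℝ) - δ - Real.exp (-K * (1 + Real.log C)))) ≤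
        volume U := by
    intro P U hP hPU
    refine le_trans (ENNReal.ofReal_le_ofReal ?_) (card_mul_le_volume hh P hPU)
    have h1 := rpow_le_of_pluennecke hk0 hc₁0 hc₂0 hr (by positivity) hcardA hcardk hP
    have h2 : r ^ ((d : ℝ) - δ - Real.exp (-K * (1 + Real.log C))) ≤
        r ^ (-δ - (s - δ) / k) * r ^ d := by
      rw [← Real.rpow_natCast r d, ← Real.rpow_add hr]
      exact Real.rpow_le_rpow_of_exponent_ge hr hr1.le (by linarith)
    calc c / (d : ℝ) ^ d * r ^ ((d : ℝ) - δ - Real.exp (-K * (1 + Real.log C)))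
        ≤ c / (d : ℝ) ^ d * (r ^ (-δ - (s - δ) / k) * r ^ d) := by gcongr
      _ = (c * r ^ (-δ - (s - δ) / k)) * (r / d) ^ d := by rw [div_pow]; ring
      _ ≤ P.card * (r / d) ^ d := by gcongr
  refine ⟨hvol (A + A) _ ?_ fun p hp => mem_add_of_cell_mem hd0 hr (fun a ha => (hA a).1 ha) hp,
    hvol (A - A) _ ?_ fun p hp => mem_sub_of_cell_mem hd0 hr (fun a ha => (hA a).1 ha) hp⟩
  · simpa using (NNRat.cast_le (K := ℝ)).2
      (Finset.pluennecke_ruzsa_inequality_nsmul_add hAne A k)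
  · simpa using (NNRat.cast_le (K := ℝ)).2
      (Finset.pluennecke_ruzsa_inequality_nsmul_sub hAne A k)
end

section
/- There exists an absolute constant C₂ > 0 with the following property. Let 0 < δ < 1, C > 1 and 0 < ε ≤ 1/2, and set r₀ := exp(−C₂ · C^{16} · (log(C/ε))² / (ε² · min(δ, 1−δ))). Let X ⊆ ℝ be a δ-regular set on scales [r₀, 1] with constant C, and let μ = μ_X be an associated regular measure. Then E(μ|_{[−1,1]}, r₀) ≤ ε · r₀^δ, where μ|_{[−1,1]} is the restriction of μ to [−1,1]. -/
open MeasureTheory Metric Set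
open scoped ENNReal Pointwise

/-- The additive energy `E(μ, r)` of a measure `μ` at scale `r`. -/
noncomputable def addEnergy {E : Type*} [NormedAddCommGroup E] [MeasurableSpace E]
    (μ : Measure E) (r : ℝ) : ℝ≥0∞ :=
  (μ.prod (μ.prod (μ.prod μ)))
    {p : E × E × E × E | ‖p.1 + p.2.1 - p.2.2.1 - p.2.2.2‖ ≤ r}

/-- Double counting for a measurable relation between two measure spaces. -/
lemma double_count {α β : Type*} [MeasurableSpace α] [MeasurableSpace β]
    (μ : Measure α) (ν : Measure β) [SFinite μ] [SFinite ν]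
    {S : Set (α × β)} (hS : MeasurableSet S) {A : Set α} {T : Set β} (hT : MeasurableSet T)
    {c d : ℝ≥0∞} (hc : ∀ x ∈ A, c ≤ ν {y | (x, y) ∈ S})
    (hd : ∀ y, μ {x | (x, y) ∈ S} ≤ d) (hST : ∀ p ∈ S, p.2 ∈ T) :
    c * μ A ≤ d * ν T := by
  calc c * μ A ≤ c * μ {x | c ≤ ν (Prod.mk x ⁻¹' S)} := by
        gcongr
        exact fun x hx => hc x hx
    _ ≤ ∫⁻ x, ν (Prod.mk x ⁻¹' S) ∂μ :=
        mul_meas_ge_le_lintegral (measurable_measure_prodMk_left hS) c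
    _ = μ.prod ν S := (Measure.prod_apply hS).symm
    _ = ∫⁻ y, μ ((fun x => (x, y)) ⁻¹' S) ∂ν := Measure.prod_apply_symm hS
    _ ≤ ∫⁻ y, T.indicator (fun _ => d) y ∂ν := by
        refine lintegral_mono fun y => ?_
        by_cases hy : y ∈ T
        · rw [indicator_of_mem hy]
          exact hd y
        · rw [indicator_of_notMem hy]
          have : (fun x => (x, y)) ⁻¹' S = ∅ := by
            ext x
            simp only [mem_preimage, mem_empty_iff_false, iff_false]
            exact fun h => hy (hST _ h)
          rw [this, measure_empty]
    _ = d * ν T := lintegral_indicator_const hT d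

/-- The largest element of `X` that is at most `y` (when there is one). -/
noncomputable def leftPoint (X : Set ℝ) (y : ℝ) : ℝ := sSup (X ∩ Iic y)

lemma le_leftPoint {X : Set ℝ} {x y : ℝ} (hx : x ∈ X) (hxy : x ≤ y) : x ≤ leftPoint X y :=
  le_csSup ⟨y, fun _ h => h.2⟩ ⟨hx, hxy⟩

lemma leftPoint_mem {X : Set ℝ} (hX : IsClosed X) {x y : ℝ} (hx : x ∈ X) (hxy : x ≤ y) :
    leftPoint X y ∈ X ∩ Iic y :=
  (hX.inter isClosed_Iic).csSup_mem ⟨x, hx, hxy⟩ ⟨y, fun _ h => h.2⟩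

lemma measurable_leftPoint {X : Set ℝ} (hX : IsClosed X) : Measurable (leftPoint X) := by
  refine measurable_of_Ioi fun c => ?_
  have : leftPoint X ⁻¹' Ioi c =
      {y | ∃ x ∈ X, c < x ∧ x ≤ y} ∪ {y | (∀ x ∈ X, y < x) ∧ c < 0} := by
    ext y
    simp only [mem_preimage, mem_Ioi, mem_union, mem_ofPred_eq]
    by_cases h : ∃ x ∈ X, x ≤ y
    · obtain ⟨x, hx, hxy⟩ := h
      have h1 := leftPoint_mem hX hx hxy
      constructor
      · intro h2
        exact Or.inl ⟨_, h1.1, h2, h1.2⟩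
      · rintro (⟨z, hz, hcz, hzy⟩ | ⟨h2, -⟩)
        · exact hcz.trans_le (le_leftPoint hz hzy)
        · exact absurd (h2 x hx) (not_lt.2 hxy)
    · push Not at h
      have h0 : leftPoint X y = 0 := by
        have : X ∩ Iic y = ∅ := by
          ext x
          simp only [mem_inter_iff, mem_Iic, mem_empty_iff_false, iff_false, not_and, not_le]
          exact h x
        simp [leftPoint, this]
      rw [h0]
      constructor
      · exact fun h2 => Or.inr ⟨h, h2⟩
      · rintro (⟨z, hz, hcz, hzy⟩ | ⟨-, h2⟩)
        · exact absurd (h z hz) (not_lt.2 hzy)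
        · exact h2
  rw [this]
  refine MeasurableSet.union (OrdConnected.measurableSet ⟨?_⟩)
    (OrdConnected.measurableSet ⟨?_⟩)
  · rintro y ⟨x, hx, hcx, hxy⟩ z - w hw
    exact ⟨x, hx, hcx, hxy.trans hw.1⟩
  · rintro y - z ⟨h, hc⟩ w hw
    exact ⟨fun x hx => hw.2.trans_lt (h x hx), hc⟩

/-- The number of dyadic scales `2⁻ʲ` for which `d` lies between `2⁻⁽ʲ⁺ᵏ⁾` and `4 · 2⁻ʲ` is at
most `k + 2`. -/
lemma card_dyadic_window_le (d : ℝ) (k n : ℕ) :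
    ((Finset.range n).filter fun j : ℕ =>
      (1 / 2 : ℝ) ^ (j + k) < d ∧ d ≤ 4 * (1 / 2 : ℝ) ^ j).card ≤ k + 2 := by
  set s := (Finset.range n).filter fun j : ℕ =>
      (1 / 2 : ℝ) ^ (j + k) < d ∧ d ≤ 4 * (1 / 2 : ℝ) ^ j with hs
  rcases s.eq_empty_or_nonempty with h | h
  · simp [h]
  have hm := Finset.mem_filter.1 (s.min'_mem h)
  have : s ⊆ Finset.Ico (s.min' h) (s.min' h + (k + 2)) := by
    intro j hj
    have hj' := Finset.mem_filter.1 hj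
    refine Finset.mem_Ico.2 ⟨s.min'_le j hj, ?_⟩
    by_contra! hlt
    have h1 : (1 / 2 : ℝ) ^ j ≤ (1 / 2 : ℝ) ^ (s.min' h + (k + 2)) :=
      pow_le_pow_of_le_one (by norm_num) (by norm_num) hlt
    have h2 : (1 / 2 : ℝ) ^ (s.min' h + (k + 2)) = (1 / 2 : ℝ) ^ (s.min' h + k) / 4 := by
      rw [← add_assoc, pow_add _ _ 2]
      norm_num
      ring
    linarith [hm.2.1, hj'.2.2]
  calc s.card ≤ _ := Finset.card_le_card this
    _ = k + 2 := by simp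

lemma sum_ge_of_le_mul_add {v e : ℕ → ℝ} {q b : ℝ} (hq : q ≤ 1) (hv0 : 0 ≤ v 0) (n : ℕ)
    (hb : ∀ j ≤ n, b ≤ v j) (h : ∀ j < n, v j ≤ q * v (j + 1) + e j) :
    n * ((1 - q) * b) ≤ v n + ∑ j ∈ Finset.range n, e j := by
  have key : ∀ m ≤ n, v 0 + m * ((1 - q) * b) ≤ v m + ∑ j ∈ Finset.range m, e j := by
    intro m
    induction m with
    | zero => simp
    | succ m ih =>
      intro hm
      have h1 := ih (by omega)
      have h2 := h m (by omega)
      have h3 := mul_le_mul_of_nonneg_left (hb (m + 1) hm) (sub_nonneg.2 hq)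
      rw [Finset.sum_range_succ]
      push_cast
      linarith
  linarith [key n le_rfl]

lemma sum_le_of_eq_sub_mul {u e : ℕ → ℝ} {q B : ℝ} (hq0 : 0 ≤ q) (hq : q ≤ 1) (n : ℕ)
    (hu0 : 0 ≤ u n) (hB : ∀ j ≤ n, u j ≤ B) (h : ∀ j < n, e j = u j - q * u (j + 1)) :
    ∑ j ∈ Finset.range n, e j ≤ B + n * ((1 - q) * B) := by
  have key : ∀ m ≤ n, ∑ j ∈ Finset.range m, e j + q * u m ≤ q * B + m * ((1 - q) * B) := by
    intro m
    induction m with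
    | zero => simpa using mul_le_mul_of_nonneg_left (hB 0 (by omega)) hq0
    | succ m ih =>
      intro hm
      have h1 := ih (by omega)
      have h2 := h m (by omega)
      have h3 := mul_le_mul_of_nonneg_left (hB m (by omega)) (sub_nonneg.2 hq)
      rw [Finset.sum_range_succ]
      push_cast
      linarith
  have hB0 : 0 ≤ B := hu0.trans (hB n le_rfl)
  have := key n le_rfl
  nlinarith [mul_nonneg hq0 hu0, mul_nonneg (sub_nonneg.2 hq) hB0]

lemma one_sub_two_rpow_neg_ge {θ : ℝ} (h0 : 0 ≤ θ) (h1 : θ ≤ 1) :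
    θ / 2 ≤ 1 - (1 / 2 : ℝ) ^ θ := by
  have := rpow_one_add_le_one_add_mul_self (s := -1 / 2) (by norm_num) h0 h1
  norm_num at this ⊢
  linarith

lemma one_sub_two_rpow_neg_le {θ : ℝ} (h0 : 0 ≤ θ) :
    1 - (1 / 2 : ℝ) ^ θ ≤ θ := by
  have h : Real.exp (-(θ * Real.log 2)) = (1 / 2 : ℝ) ^ θ := by
    rw [Real.rpow_def_of_pos (by norm_num), one_div, Real.log_inv]
    ring_nf
  have h2 := Real.add_one_le_exp (-(θ * Real.log 2))
  have h3 : Real.log 2 ≤ 1 := by linarith [Real.log_two_lt_d9]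
  nlinarith

/-- Regularity of a measure on a window of the line, with total mass controlled by the constant. -/
structure IsWindowRegular (δ r C : ℝ) (X : Set ℝ) (ρ : Measure ℝ) : Prop where
  pos : 0 < r
  one_lt : 1 < C
  delta_pos : 0 < δ
  delta_lt : δ < 1
  closed : IsClosed X
  nonempty : X.Nonempty
  null : ρ Xᶜ = 0
  univ_le : ρ univ ≤ ENNReal.ofReal (9 * C)
  upper : ∀ x s : ℝ, r ≤ s → s ≤ 1 → ρ (closedBall x s) ≤ ENNReal.ofReal (C * s ^ δ)
  lower : ∀ x ∈ X, x ∈ Icc (-8 : ℝ) 8 → ∀ s : ℝ, r ≤ s → s ≤ 1 →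
    ENNReal.ofReal (C⁻¹ * s ^ δ) ≤ ρ (closedBall x s)

/-- The part of `[-7, 7]` within distance `s` of `X`. -/
def nearSet (X : Set ℝ) (s : ℝ) : Set ℝ := {y | y ∈ Icc (-7 : ℝ) 7 ∧ infDist y X ≤ s}

/-- Points `y` at distance at most `s` to the right of some `a ∈ X` that is not followed by
another point of `X`, such that `a + t` lies at distance between `2 e` and `2 s` from `X`. -/
def bandSet (X : Set ℝ) (s e t : ℝ) : Set ℝ :=
  {y | y ∈ Icc (-1 : ℝ) 5 ∧ leftPoint X y ∈ X ∧ leftPoint X y ≤ y ∧ y ≤ leftPoint X y + s ∧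
    2 * e < infDist (leftPoint X y + t) X ∧ infDist (leftPoint X y + t) X ≤ 2 * s}

/-- Points of `[-1, 5]` in a gap of `X`, at distance between `s / 2` and `s` from its left end. -/
def gapSet (X : Set ℝ) (s : ℝ) : Set ℝ :=
  {y | y ∈ Icc (-1 : ℝ) 5 ∧ leftPoint X y ∈ X ∧ leftPoint X y + s / 2 < y ∧
    y ≤ leftPoint X y + s}

/-- Points of the gap set for which the left end of the gap is moved close to `X` by `t`. -/
def hitSet (X : Set ℝ) (s e t : ℝ) : Set ℝ :=
  {y | y ∈ gapSet X s ∧ infDist (leftPoint X y + t) X ≤ 2 * e}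

lemma measurableSet_gapSet {X : Set ℝ} (hX : IsClosed X) (s : ℝ) :
    MeasurableSet (gapSet X s) := by
  have hm := measurable_leftPoint hX
  refine measurableSet_Icc.inter ((hm hX.measurableSet).inter (MeasurableSet.inter
    (measurableSet_lt (hm.add_const _) measurable_id)
    (measurableSet_le measurable_id (hm.add_const _))))

lemma measurableSet_bandSet_prod {X : Set ℝ} (hX : IsClosed X) (s e : ℝ) :
    MeasurableSet {p : ℝ × ℝ | p.2 ∈ bandSet X s e p.1} := by
  have hm := (measurable_leftPoint hX).comp (measurable_snd : Measurable (Prod.snd : ℝ × ℝ → ℝ))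
  have hd : Measurable fun p : ℝ × ℝ => infDist (leftPoint X p.2 + p.1) X :=
    (continuous_infDist_pt X).measurable.comp (hm.add measurable_fst)
  refine (measurable_snd measurableSet_Icc).inter ((hm hX.measurableSet).inter
    (MeasurableSet.inter (measurableSet_le hm measurable_snd) (MeasurableSet.inter
    (measurableSet_le measurable_snd (hm.add_const _)) (MeasurableSet.inter
    (measurableSet_lt measurable_const hd) (measurableSet_le hd measurable_const)))))

lemma measurableSet_hitSet_prod {X : Set ℝ} (hX : IsClosed X) (s e : ℝ) :
    MeasurableSet {p : ℝ × ℝ | p.2 ∈ hitSet X s e p.1} := by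
  have hm := (measurable_leftPoint hX).comp (measurable_snd : Measurable (Prod.snd : ℝ × ℝ → ℝ))
  have hd : Measurable fun p : ℝ × ℝ => infDist (leftPoint X p.2 + p.1) X :=
    (continuous_infDist_pt X).measurable.comp (hm.add measurable_fst)
  exact (measurable_snd (measurableSet_gapSet hX s)).inter (measurableSet_le hd measurable_const)

lemma volume_real_le_six {A : Set ℝ} (hA : A ⊆ Icc (-1 : ℝ) 5) : volume A ≤ 6 := by
  refine (measure_mono hA).trans ?_
  rw [Real.volume_Icc]
  norm_num

lemma volume_abs_sub_le (a b : ℝ) : volume {y : ℝ | |a - y| ≤ b} = ENNReal.ofReal (2 * b) := by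
  rw [← Real.volume_closedBall a b]
  congr 1
  ext y
  rw [mem_closedBall, Real.dist_eq, abs_sub_comm]
  rfl

namespace IsWindowRegular

variable {δ r C : ℝ} {X : Set ℝ} {ρ : Measure ℝ}

lemma volume_nearSet_le [IsFiniteMeasure ρ] (h : IsWindowRegular δ r C X ρ) {s : ℝ}
    (hrs : r ≤ s) (hs : s ≤ 1) :
    volume (nearSet X s) ≤ ENNReal.ofReal (36 * C ^ 2 * s ^ (1 - δ)) := by
  have hs0 : 0 < s := h.pos.trans_le hrs
  have hC : 0 < C := by linarith [h.one_lt]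
  have key : ENNReal.ofReal (C⁻¹ * s ^ δ) * volume (nearSet X s) ≤
      ENNReal.ofReal (2 * (2 * s)) * ρ univ := by
    refine double_count volume ρ (S := {p : ℝ × ℝ | |p.2 - p.1| ≤ 2 * s}) ?_ MeasurableSet.univ
      ?_ ?_ (fun _ _ => mem_univ _)
    · exact measurableSet_le (by fun_prop) (by fun_prop)
    · rintro y ⟨hy, hys⟩
      obtain ⟨x, hx, hxy⟩ := h.closed.exists_infDist_eq_dist h.nonempty y
      rw [hxy, Real.dist_eq, abs_le] at hys
      refine (h.lower x hx ⟨by linarith [hy.1], by linarith [hy.2]⟩ s hrs hs).trans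
        (measure_mono fun u hu => ?_)
      rw [mem_closedBall, Real.dist_eq, abs_le] at hu
      change |u - y| ≤ 2 * s
      exact abs_le.2 ⟨by linarith, by linarith⟩
    · exact fun u => (volume_abs_sub_le u (2 * s)).le
  have key2 : ENNReal.ofReal (C⁻¹ * s ^ δ) * volume (nearSet X s) ≤
      ENNReal.ofReal (C⁻¹ * s ^ δ) * ENNReal.ofReal (36 * C ^ 2 * s ^ (1 - δ)) := by
    refine (key.trans (mul_le_mul_right h.univ_le _)).trans (le_of_eq ?_)
    rw [← ENNReal.ofReal_mul (by positivity), ← ENNReal.ofReal_mul (by positivity)]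
    congr 1
    have : s = s ^ δ * s ^ (1 - δ) := by
      rw [← Real.rpow_add hs0]
      simp
    calc 2 * (2 * s) * (9 * C) = 36 * C * s := by ring
      _ = 36 * C * (s ^ δ * s ^ (1 - δ)) := by rw [← this]
      _ = _ := by field_simp
  exact (ENNReal.mul_le_mul_iff_right (by simp; positivity) (by simp)).1 key2

lemma mul_measure_le_volume [IsFiniteMeasure ρ] (h : IsWindowRegular δ r C X ρ) {s : ℝ}
    (hrs : r ≤ s) (hs : s ≤ 1) {W : Set ℝ} (hW : MeasurableSet W)
    (hN : MeasurableSet {y : ℝ | ∃ x ∈ W, x ≤ y ∧ y ≤ x + s}) :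
    ENNReal.ofReal s * ρ W ≤
      ENNReal.ofReal (C * s ^ δ) * volume {y : ℝ | ∃ x ∈ W, x ≤ y ∧ y ≤ x + s} := by
  refine double_count ρ volume (S := {p : ℝ × ℝ | p.1 ∈ W ∧ p.1 ≤ p.2 ∧ p.2 ≤ p.1 + s}) ?_ hN
    ?_ ?_ ?_
  · exact (measurable_fst hW).inter ((measurableSet_le measurable_fst measurable_snd).inter
      (measurableSet_le measurable_snd (measurable_fst.add_const _)))
  · intro x hx
    have : {y | (x, y) ∈ {p : ℝ × ℝ | p.1 ∈ W ∧ p.1 ≤ p.2 ∧ p.2 ≤ p.1 + s}} = Icc x (x + s) := by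
      ext y
      simp [hx]
    rw [this, Real.volume_Icc]
    simp
  · intro y
    refine (measure_mono fun x hx => ?_).trans (h.upper y s hrs hs)
    rw [mem_closedBall, Real.dist_eq, abs_le]
    exact ⟨by linarith [hx.2.2], by linarith [hx.2.1, h.pos]⟩
  · exact fun p hp => ⟨p.1, hp.1, hp.2⟩

lemma slice_bound [IsFiniteMeasure ρ] (h : IsWindowRegular δ r C X ρ) (t : ℝ) (n : ℕ)
    (hr : r ≤ (1 / 2) ^ n) (e : ℕ → ℝ) (he : ∀ j, 4 * e j ≤ (1 / 2) ^ j) :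
    ENNReal.ofReal (n * ((1 - (1 / 2) ^ (1 - δ)) * C⁻¹)) *
        (ρ.restrict (Icc (-1) 1)) {x | infDist (x + t) X ≤ r} ≤
      ENNReal.ofReal (36 * C ^ 2) + ∑ j ∈ Finset.range n,
        ENNReal.ofReal (((1 / 2 : ℝ) ^ j) ^ (δ - 1)) *
          (volume (bandSet X ((1 / 2) ^ j) (e j) t) +
            volume (hitSet X ((1 / 2) ^ j) (e j) t)) := by
  have hC : 0 < C := by linarith [h.one_lt]
  set s : ℕ → ℝ := fun j => (1 / 2) ^ j with hs
  have hs0 : ∀ j, 0 < s j := fun j => by positivity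
  have hs1 : ∀ j, s j ≤ 1 := fun j => pow_le_one₀ (by norm_num) (by norm_num)
  have hss : ∀ j, s (j + 1) = s j / 2 := fun j => by simp only [hs]; rw [pow_succ]; ring
  have hrs : ∀ j ≤ n, r ≤ s j := fun j hj =>
    hr.trans (pow_le_pow_of_le_one (by norm_num) (by norm_num) hj)
  set W : ℕ → Set ℝ := fun j =>
    {x | x ∈ X ∧ x ∈ Icc (-1) (3 - 2 * s j) ∧ infDist (x + t) X ≤ s j} with hWdef
  have hWc : ∀ j, IsCompact (W j) := fun j => by
    have h1 : IsClosed {x | infDist (x + t) X ≤ s j} :=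
      isClosed_le ((continuous_infDist_pt X).comp (continuous_add_const t)) continuous_const
    have : W j = Icc (-1) (3 - 2 * s j) ∩ (X ∩ {x | infDist (x + t) X ≤ s j}) := by
      ext x
      simp only [hWdef, mem_ofPred_eq, mem_inter_iff]
      tauto
    rw [this]
    exact isCompact_Icc.inter_right (h.closed.inter h1)
  set N : ℕ → Set ℝ := fun j => {y | ∃ x ∈ W j, x ≤ y ∧ y ≤ x + s j} with hNdef
  have hNm : ∀ j, MeasurableSet (N j) := fun j => by
    have : N j = W j + Icc 0 (s j) := by
      ext y
      rw [mem_add]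
      constructor
      · rintro ⟨x, hx, h1, h2⟩
        exact ⟨x, hx, y - x, ⟨by linarith, by linarith⟩, by ring⟩
      · rintro ⟨x, hx, z, hz, rfl⟩
        exact ⟨x, hx, by linarith [hz.1], by linarith [hz.2]⟩
    rw [this]
    exact ((hWc j).add isCompact_Icc).isClosed.measurableSet
  have hNsub : ∀ j, N j ⊆ Icc (-1 : ℝ) 5 := by
    rintro j y ⟨x, hx, h1, h2⟩
    exact ⟨by linarith [hx.2.1.1], by linarith [hx.2.1.2, hs0 j]⟩
  have hBsub : ∀ j, bandSet X (s j) (e j) t ⊆ Icc (-1 : ℝ) 5 := fun j y hy => hy.1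
  have hHsub : ∀ j, hitSet X (s j) (e j) t ⊆ Icc (-1 : ℝ) 5 := fun j y hy => hy.1.1
  have fin : ∀ {A : Set ℝ}, A ⊆ Icc (-1 : ℝ) 5 → volume A ≠ ⊤ := fun hA =>
    ((volume_real_le_six hA).trans_lt (by norm_num)).ne
  set w := (ρ.restrict (Icc (-1) 1)) {x | infDist (x + t) X ≤ r} with hw
  have hwW : ∀ j ≤ n, w.toReal ≤ ρ.real (W j) := fun j hj => by
    refine ENNReal.toReal_mono (measure_ne_top _ _) ?_
    have hm : MeasurableSet {x | infDist (x + t) X ≤ r} :=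
      measurableSet_le ((continuous_infDist_pt X).measurable.comp
        (measurable_id.add_const t)) measurable_const
    rw [hw, Measure.restrict_apply hm]
    calc ρ ({x | infDist (x + t) X ≤ r} ∩ Icc (-1) 1) ≤ ρ (W j ∪ Xᶜ) := by
          refine measure_mono fun x hx => ?_
          by_cases hxX : x ∈ X
          · exact Or.inl ⟨hxX, ⟨hx.2.1, by linarith [hx.2.2, hs1 j]⟩, hx.1.trans (hrs j hj)⟩
          · exact Or.inr hxX
      _ ≤ ρ (W j) + ρ Xᶜ := measure_union_le _ _
      _ = ρ (W j) := by rw [h.null, add_zero]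
  have hp0 : ∀ j, 0 < s j ^ (δ - 1) := fun j => Real.rpow_pos_of_pos (hs0 j) _
  have hq : ∀ j, (1 / 2 : ℝ) ^ (1 - δ) * s (j + 1) ^ (δ - 1) = s j ^ (δ - 1) := fun j => by
    rw [hss, div_eq_mul_one_div (s j), Real.mul_rpow (hs0 j).le (by norm_num), mul_left_comm,
      ← Real.rpow_add (by norm_num)]
    simp
  have hlow : ∀ j ≤ n, C⁻¹ * w.toReal ≤ s j ^ (δ - 1) * volume.real (N j) := fun j hj => by
    have h1 := h.mul_measure_le_volume (hrs j hj) (hs1 j) (hWc j).isClosed.measurableSet (hNm j)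
    have h2 := ENNReal.toReal_mono (ENNReal.mul_ne_top (by simp) (fin (hNsub j))) h1
    rw [ENNReal.toReal_mul, ENNReal.toReal_mul, ENNReal.toReal_ofReal (hs0 j).le,
      ENNReal.toReal_ofReal (mul_nonneg hC.le (Real.rpow_nonneg (hs0 j).le _))] at h2
    have h3 : s j * w.toReal ≤ C * s j ^ δ * volume.real (N j) :=
      (mul_le_mul_of_nonneg_left (hwW j hj) (hs0 j).le).trans h2
    rw [Real.rpow_sub_one (hs0 j).ne', inv_mul_le_iff₀ hC]
    have h4 := (le_div_iff₀' (hs0 j)).2 h3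
    calc w.toReal ≤ _ := h4
      _ = _ := by ring
  have hstep : ∀ j, volume.real (N j) ≤ volume.real (N (j + 1)) +
      (volume.real (bandSet X (s j) (e j) t) + volume.real (hitSet X (s j) (e j) t)) := fun j => by
    have hsub : N j ⊆ N (j + 1) ∪ (bandSet X (s j) (e j) t ∪ hitSet X (s j) (e j) t) := by
      rintro y ⟨x, hx, hxy, hyx⟩
      obtain ⟨haX, hay⟩ := leftPoint_mem h.closed hx.1 hxy
      have hxa := le_leftPoint hx.1 hxy
      have hy5 : y ∈ Icc (-1 : ℝ) 5 := hNsub j ⟨x, hx, hxy, hyx⟩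
      have hdist : infDist (leftPoint X y + t) X ≤ 2 * s j := by
        have h1 := infDist_le_infDist_add_dist (s := X) (x := leftPoint X y + t) (y := x + t)
        rw [Real.dist_eq, abs_of_nonneg (by linarith)] at h1
        have hay' : leftPoint X y ≤ y := hay
        linarith [hx.2.2]
      have hay' : leftPoint X y ≤ y := hay
      by_cases hd : 2 * e j < infDist (leftPoint X y + t) X
      · exact Or.inr (Or.inl ⟨hy5, haX, hay, by linarith, hd, hdist⟩)
      · push Not at hd
        by_cases hyN : y ∈ N (j + 1)
        · exact Or.inl hyN
        · refine Or.inr (Or.inr ⟨⟨hy5, haX, ?_, by linarith⟩, hd⟩)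
          by_contra! hlt
          refine hyN ⟨leftPoint X y, ⟨haX, ⟨by linarith [hx.2.1.1], ?_⟩, ?_⟩, hay, ?_⟩
          · rw [hss]
            linarith [hx.2.1.2]
          · rw [hss]
            have := he j
            change 4 * e j ≤ s j at this
            linarith
          · rw [hss]
            exact hlt
    have hfin : volume (N (j + 1) ∪ (bandSet X (s j) (e j) t ∪ hitSet X (s j) (e j) t)) ≠ ⊤ :=
      fin (union_subset (hNsub _) (union_subset (hBsub j) (hHsub j)))
    exact (measureReal_mono hsub hfin).trans ((measureReal_union_le _ _).trans
      (by gcongr; exact measureReal_union_le _ _))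
  have hlast : s n ^ (δ - 1) * volume.real (N n) ≤ 36 * C ^ 2 := by
    have hsub : N n ⊆ nearSet X (s n) := by
      rintro y ⟨x, hx, hxy, hyx⟩
      have hy5 : y ∈ Icc (-1 : ℝ) 5 := hNsub n ⟨x, hx, hxy, hyx⟩
      refine ⟨⟨by linarith [hy5.1], by linarith [hy5.2]⟩, (infDist_le_dist_of_mem hx.1).trans ?_⟩
      rw [Real.dist_eq, abs_of_nonneg (by linarith)]
      linarith
    have h1 := (measure_mono hsub).trans (h.volume_nearSet_le (hrs n le_rfl) (hs1 n))
    have h2 : volume.real (N n) ≤ 36 * C ^ 2 * s n ^ (1 - δ) :=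
      ENNReal.toReal_le_of_le_ofReal (mul_nonneg (by positivity)
        (Real.rpow_nonneg (hs0 n).le _)) h1
    calc s n ^ (δ - 1) * volume.real (N n) ≤ s n ^ (δ - 1) * (36 * C ^ 2 * s n ^ (1 - δ)) := by
          gcongr
      _ = 36 * C ^ 2 * (s n ^ (δ - 1) * s n ^ (1 - δ)) := by ring
      _ = 36 * C ^ 2 := by
          rw [← Real.rpow_add (hs0 n)]
          simp
  have hsum := sum_ge_of_le_mul_add (v := fun j => s j ^ (δ - 1) * volume.real (N j))
    (e := fun j => s j ^ (δ - 1) * (volume.real (bandSet X (s j) (e j) t) +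
      volume.real (hitSet X (s j) (e j) t)))
    (q := (1 / 2 : ℝ) ^ (1 - δ)) (b := C⁻¹ * w.toReal)
    (Real.rpow_le_one (by norm_num) (by norm_num) (by linarith [h.delta_lt]))
    (mul_nonneg (hp0 0).le measureReal_nonneg) n hlow (fun j _ => by
      have := mul_le_mul_of_nonneg_left (hstep j) (hp0 j).le
      rw [← mul_assoc, hq]
      linarith)
  have hwfin : w ≠ ⊤ := measure_ne_top _ _
  have hterm : ∀ j, ENNReal.ofReal (s j ^ (δ - 1)) *
      (volume (bandSet X (s j) (e j) t) + volume (hitSet X (s j) (e j) t)) =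
      ENNReal.ofReal (s j ^ (δ - 1) * (volume.real (bandSet X (s j) (e j) t) +
        volume.real (hitSet X (s j) (e j) t))) := fun j => by
    rw [ENNReal.ofReal_mul (hp0 j).le, ENNReal.ofReal_add measureReal_nonneg measureReal_nonneg,
      ofReal_measureReal (fin (hBsub j)), ofReal_measureReal (fin (hHsub j))]
  change _ ≤ _ + ∑ j ∈ Finset.range n, ENNReal.ofReal (s j ^ (δ - 1)) *
    (volume (bandSet X (s j) (e j) t) + volume (hitSet X (s j) (e j) t))
  simp_rw [hterm]
  rw [← ENNReal.ofReal_sum_of_nonneg (fun j _ => mul_nonneg (hp0 j).le (by positivity)),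
    ← ENNReal.ofReal_add (by positivity)
      (Finset.sum_nonneg fun j _ => mul_nonneg (hp0 j).le (by positivity)),
    ← ENNReal.ofReal_toReal hwfin, ← ENNReal.ofReal_mul' ENNReal.toReal_nonneg]
  refine ENNReal.ofReal_le_ofReal ?_
  linarith

lemma sum_gap_le [IsFiniteMeasure ρ] (h : IsWindowRegular δ r C X ρ) (n : ℕ)
    (hr : r ≤ (1 / 2) ^ n) :
    ∑ j ∈ Finset.range n,
      ((1 / 2 : ℝ) ^ j) ^ (δ - 1) * volume.real (gapSet X ((1 / 2) ^ j)) ≤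
      36 * C ^ 2 * (1 + n * (1 - δ)) := by
  set s : ℕ → ℝ := fun j => (1 / 2) ^ j with hs
  have hs0 : ∀ j, 0 < s j := fun j => by positivity
  have hs1 : ∀ j, s j ≤ 1 := fun j => pow_le_one₀ (by norm_num) (by norm_num)
  have hss : ∀ j, s (j + 1) = s j / 2 := fun j => by simp only [hs]; rw [pow_succ]; ring
  have hrs : ∀ j ≤ n, r ≤ s j := fun j hj =>
    hr.trans (pow_le_pow_of_le_one (by norm_num) (by norm_num) hj)
  have hm := measurable_leftPoint h.closed
  set F : ℕ → Set ℝ := fun j => {y | y ∈ Icc (-1 : ℝ) 5 ∧ leftPoint X y ∈ X ∧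
    leftPoint X y ≤ y ∧ y ≤ leftPoint X y + s j} with hF
  have hFm : ∀ j, MeasurableSet (F j) := fun j =>
    measurableSet_Icc.inter ((hm h.closed.measurableSet).inter (MeasurableSet.inter
      (measurableSet_le hm measurable_id) (measurableSet_le measurable_id (hm.add_const _))))
  have hFfin : ∀ j, volume (F j) ≠ ⊤ := fun j =>
    ((volume_real_le_six fun y hy => hy.1).trans_lt (by norm_num)).ne
  have hgap : ∀ j, volume.real (gapSet X (s j)) =
      volume.real (F j) - volume.real (F (j + 1)) := fun j => by
    have h1 : F (j + 1) ⊆ F j := by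
      rintro y ⟨h1, h2, h3, h4⟩
      refine ⟨h1, h2, h3, ?_⟩
      rw [hss] at h4
      linarith [hs0 j]
    have h2 : gapSet X (s j) = F j \ F (j + 1) := by
      ext y
      simp only [gapSet, hF, mem_sdiff, mem_ofPred_eq, hss]
      constructor
      · rintro ⟨h1, h2, h3, h4⟩
        exact ⟨⟨h1, h2, by linarith [hs0 j], h4⟩, fun h5 => absurd h5.2.2.2 (not_le.2 h3)⟩
      · rintro ⟨⟨h1, h2, h3, h4⟩, h5⟩
        refine ⟨h1, h2, ?_, h4⟩
        by_contra! h6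
        exact h5 ⟨h1, h2, h3, h6⟩
    rw [h2, measureReal_sdiff h1 (hFm _) (hFfin _)]
  have hp0 : ∀ j, 0 < s j ^ (δ - 1) := fun j => Real.rpow_pos_of_pos (hs0 j) _
  have hq : ∀ j, (1 / 2 : ℝ) ^ (1 - δ) * s (j + 1) ^ (δ - 1) = s j ^ (δ - 1) := fun j => by
    rw [hss, div_eq_mul_one_div (s j), Real.mul_rpow (hs0 j).le (by norm_num), mul_left_comm,
      ← Real.rpow_add (by norm_num)]
    simp
  have hup : ∀ j ≤ n, s j ^ (δ - 1) * volume.real (F j) ≤ 36 * C ^ 2 := fun j hj => by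
    have hsub : F j ⊆ nearSet X (s j) := by
      rintro y ⟨h1, h2, h3, h4⟩
      refine ⟨⟨by linarith [h1.1], by linarith [h1.2]⟩, (infDist_le_dist_of_mem h2).trans ?_⟩
      rw [Real.dist_eq, abs_of_nonneg (by linarith)]
      linarith
    have h1 := (measure_mono hsub).trans (h.volume_nearSet_le (hrs j hj) (hs1 j))
    have h2 : volume.real (F j) ≤ 36 * C ^ 2 * s j ^ (1 - δ) :=
      ENNReal.toReal_le_of_le_ofReal (mul_nonneg (by positivity)
        (Real.rpow_nonneg (hs0 j).le _)) h1
    calc s j ^ (δ - 1) * volume.real (F j) ≤ s j ^ (δ - 1) * (36 * C ^ 2 * s j ^ (1 - δ)) := by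
          gcongr
      _ = 36 * C ^ 2 * (s j ^ (δ - 1) * s j ^ (1 - δ)) := by ring
      _ = 36 * C ^ 2 := by
          rw [← Real.rpow_add (hs0 j)]
          simp
  have hsum := sum_le_of_eq_sub_mul (u := fun j => s j ^ (δ - 1) * volume.real (F j))
    (e := fun j => s j ^ (δ - 1) * volume.real (gapSet X (s j)))
    (q := (1 / 2 : ℝ) ^ (1 - δ)) (B := 36 * C ^ 2) (by positivity)
    (Real.rpow_le_one (by norm_num) (by norm_num) (by linarith [h.delta_lt])) n
    (mul_nonneg (hp0 n).le measureReal_nonneg) hup (fun j _ => by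
      rw [← mul_assoc, hq, hgap]
      ring)
  refine hsum.trans ?_
  have h1 := one_sub_two_rpow_neg_le (θ := 1 - δ) (by linarith [h.delta_lt])
  have h2 : (n : ℝ) * ((1 - (1 / 2 : ℝ) ^ (1 - δ)) * (36 * C ^ 2)) ≤
      n * ((1 - δ) * (36 * C ^ 2)) := by gcongr
  linarith

lemma volume_bandSet_le [IsFiniteMeasure ρ] (h : IsWindowRegular δ r C X ρ) {s e : ℝ}
    (hre : r ≤ e) (hes : e ≤ s) (hs : s ≤ 1) (t : ℝ) :
    ENNReal.ofReal (C⁻¹ * e ^ δ) * volume (bandSet X s e t) ≤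
      ENNReal.ofReal (2 * (2 * s)) *
        ρ {u | e < infDist (u + t) X ∧ infDist (u + t) X ≤ 4 * s} := by
  have hm := (measurable_leftPoint h.closed).comp (measurable_fst : Measurable (Prod.fst : ℝ × ℝ → ℝ))
  have hd : Measurable fun u : ℝ => infDist (u + t) X :=
    (continuous_infDist_pt X).measurable.comp (measurable_id.add_const t)
  refine double_count volume ρ
    (S := {p : ℝ × ℝ | p.1 ∈ bandSet X s e t ∧ |p.2 - leftPoint X p.1| ≤ e}) ?_ ?_ ?_ ?_ ?_
  · refine MeasurableSet.inter ?_ ?_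
    · exact measurable_fst ((measurable_prodMk_left (x := t))
        (measurableSet_bandSet_prod h.closed s e))
    · exact measurableSet_le (continuous_abs.measurable.comp (measurable_snd.sub hm))
        measurable_const
  · exact (measurableSet_lt measurable_const hd).inter (measurableSet_le hd measurable_const)
  · intro y hy
    obtain ⟨h1, h2, h3, h4, -⟩ := id hy
    refine (h.lower _ h2 ⟨by linarith [h1.1], by linarith [h1.2]⟩ e hre (hes.trans hs)).trans
      (measure_mono fun u hu => ⟨hy, ?_⟩)
    rwa [mem_closedBall, Real.dist_eq] at hu
  · intro u
    rw [← volume_abs_sub_le u]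
    refine measure_mono fun y hy => ?_
    obtain ⟨⟨h1, h2, h3, h4, -⟩, h5⟩ := hy
    change |u - leftPoint X y| ≤ e at h5
    change |u - y| ≤ 2 * s
    change leftPoint X y ≤ y at h3
    change y ≤ leftPoint X y + s at h4
    rw [abs_le] at h5 ⊢
    constructor <;> linarith
  · rintro ⟨y, u⟩ ⟨⟨h1, h2, h3, h4, h5, h6⟩, h7⟩
    change |u - leftPoint X y| ≤ e at h7
    change 2 * e < infDist (leftPoint X y + t) X at h5
    change infDist (leftPoint X y + t) X ≤ 2 * s at h6
    have h8 := infDist_le_infDist_add_dist (s := X) (x := leftPoint X y + t) (y := u + t)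
    have h9 := infDist_le_infDist_add_dist (s := X) (x := u + t) (y := leftPoint X y + t)
    rw [dist_add_right, Real.dist_eq] at h8 h9
    rw [abs_sub_comm] at h8
    exact ⟨by simp only; linarith, by simp only; linarith [h.pos]⟩

/-- Points that do not lie in `X` or have no point of `X` at distance between `8 e` and `s / 4`
to their right. -/
def isolatedSet (X : Set ℝ) (s e : ℝ) : Set ℝ :=
  {x | x ∈ X → leftPoint X (x + s / 4) < x + 8 * e}

lemma measurableSet_isolatedSet {X : Set ℝ} (hX : IsClosed X) (s e : ℝ) :
    MeasurableSet (isolatedSet X s e) := by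
  have hm := (measurable_leftPoint hX).comp (measurable_id.add_const (s / 4))
  have : isolatedSet X s e = Xᶜ ∪ {x | leftPoint X (x + s / 4) < x + 8 * e} := by
    ext x
    simp only [isolatedSet, mem_ofPred_eq, mem_union, mem_compl_iff]
    tauto
  rw [this]
  exact hX.measurableSet.compl.union (measurableSet_lt hm (measurable_id.add_const _))

lemma measure_isolatedSet_le [IsFiniteMeasure ρ] (h : IsWindowRegular δ r C X ρ) {s e : ℝ}
    (hre : r ≤ e) (hes : 8 * e ≤ s) (hs : s ≤ 1) :
    (ρ.restrict (Icc (-1) 1)) (isolatedSet X s e) ≤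
      ENNReal.ofReal (1152 * C ^ 3 * (e / s) ^ δ) := by
  have he0 : 0 < e := h.pos.trans_le hre
  have hs0 : 0 < s := by linarith
  have hC : 0 < C := by linarith [h.one_lt]
  have hX := h.closed.measurableSet
  set A := isolatedSet X s e ∩ (X ∩ Icc (-1) 1) with hA
  have hIm := measurableSet_isolatedSet h.closed s e
  have hAm : MeasurableSet A := hIm.inter (hX.inter measurableSet_Icc)
  have hle : (ρ.restrict (Icc (-1) 1)) (isolatedSet X s e) ≤ ρ A := by
    rw [Measure.restrict_apply hIm]
    calc ρ (isolatedSet X s e ∩ Icc (-1) 1) ≤ ρ (A ∪ Xᶜ) := by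
          refine measure_mono fun x hx => ?_
          by_cases hxX : x ∈ X
          · exact Or.inl ⟨hx.1, hxX, hx.2⟩
          · exact Or.inr hxX
      _ ≤ ρ A + ρ Xᶜ := measure_union_le _ _
      _ = ρ A := by rw [h.null, add_zero]
  have key : ENNReal.ofReal (s / 4) * ρ A ≤
      ENNReal.ofReal (C * (8 * e) ^ δ) * volume (nearSet X s) := by
    refine double_count ρ volume
      (S := {p : ℝ × ℝ | p.1 ∈ A ∧ p.2 ≤ p.1 ∧ p.1 < p.2 + s / 4}) ?_ ?_ ?_ ?_ ?_
    · exact (measurable_fst hAm).inter ((measurableSet_le measurable_snd measurable_fst).inter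
        (measurableSet_lt measurable_fst (measurable_snd.add_const _)))
    · exact measurableSet_Icc.inter
        (measurableSet_le (continuous_infDist_pt X).measurable measurable_const)
    · intro x hx
      have : {y | (x, y) ∈ {p : ℝ × ℝ | p.1 ∈ A ∧ p.2 ≤ p.1 ∧ p.1 < p.2 + s / 4}} =
          Ioc (x - s / 4) x := by
        ext y
        simp only [mem_ofPred_eq, hx, true_and, mem_Ioc]
        constructor
        · exact fun h => ⟨by linarith [h.2], h.1⟩
        · exact fun h => ⟨h.2, by linarith [h.1]⟩
      rw [this, Real.volume_Ioc]
      simp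
    · intro y
      rcases eq_empty_or_nonempty
        {x | (x, y) ∈ {p : ℝ × ℝ | p.1 ∈ A ∧ p.2 ≤ p.1 ∧ p.1 < p.2 + s / 4}} with h0 | ⟨z, hz⟩
      · rw [h0, measure_empty]
        exact zero_le
      · have close : ∀ x x' : ℝ, x ∈ A → x' ∈ A → y ≤ x → x' < y + s / 4 → x' - x ≤ 8 * e := by
          intro x x' hx hx' hyx hxy
          have h1 := hx.1 hx.2.1
          have h2 := le_leftPoint (X := X) (y := x + s / 4) hx'.2.1 (by linarith)
          linarith
        refine (measure_mono fun x hx => ?_).trans (h.upper z (8 * e) (by linarith) (by linarith))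
        rw [mem_closedBall, Real.dist_eq, abs_le]
        have h1 := close x z hx.1 hz.1 hx.2.1 hz.2.2
        have h2 := close z x hz.1 hx.1 hz.2.1 hx.2.2
        exact ⟨by linarith, h2⟩
    · rintro ⟨x, y⟩ ⟨hx, h1, h2⟩
      change y ≤ x at h1
      change x < y + s / 4 at h2
      have h3 : x ∈ Icc (-1 : ℝ) 1 := hx.2.2
      refine ⟨⟨by simp only; linarith [h3.1], by simp only; linarith [h3.2]⟩,
        (infDist_le_dist_of_mem hx.2.1).trans ?_⟩
      rw [Real.dist_eq, abs_le]
      exact ⟨by linarith, by linarith⟩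
  have key2 : ENNReal.ofReal (s / 4) * ρ A ≤
      ENNReal.ofReal (s / 4) * ENNReal.ofReal (1152 * C ^ 3 * (e / s) ^ δ) := by
    refine (key.trans (mul_le_mul_right
      (h.volume_nearSet_le (by linarith) hs) _)).trans ?_
    rw [← ENNReal.ofReal_mul (by positivity), ← ENNReal.ofReal_mul (by positivity)]
    refine ENNReal.ofReal_le_ofReal ?_
    have h8 : (8 * e) ^ δ ≤ 8 * e ^ δ := by
      rw [Real.mul_rpow (by norm_num) he0.le]
      gcongr
      exact Real.rpow_le_self_of_one_le (by norm_num) h.delta_lt.le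
    have hse : s ^ (1 - δ) * e ^ δ = s * (e / s) ^ δ := by
      rw [Real.rpow_sub hs0, Real.rpow_one, Real.div_rpow he0.le hs0.le]
      ring
    calc C * (8 * e) ^ δ * (36 * C ^ 2 * s ^ (1 - δ))
        ≤ C * (8 * e ^ δ) * (36 * C ^ 2 * s ^ (1 - δ)) := by gcongr
      _ = 288 * C ^ 3 * (s ^ (1 - δ) * e ^ δ) := by ring
      _ = s / 4 * (1152 * C ^ 3 * (e / s) ^ δ) := by rw [hse]; ring
  exact hle.trans ((ENNReal.mul_le_mul_iff_right (by simpa using hs0) (by simp)).1 key2)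

end IsWindowRegular

/-- The measure of the triples `(u, v, w)` such that `u + v - w` lies at distance between `e` and
`4 s` from `X`. -/
noncomputable def excess (X : Set ℝ) (ρ : Measure ℝ) (s e : ℝ) : ℝ≥0∞ :=
  ∫⁻ w, (ρ.prod ρ) {p | e < infDist (p.1 + p.2 - w) X ∧ infDist (p.1 + p.2 - w) X ≤ 4 * s} ∂ρ

lemma measurableSet_excess (X : Set ℝ) (s e : ℝ) :
    MeasurableSet {q : ℝ × ℝ × ℝ | e < infDist (q.2.1 + q.2.2 - q.1) X ∧
      infDist (q.2.1 + q.2.2 - q.1) X ≤ 4 * s} := by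
  have hd : Measurable fun q : ℝ × ℝ × ℝ => infDist (q.2.1 + q.2.2 - q.1) X :=
    (continuous_infDist_pt X).measurable.comp (by fun_prop)
  exact (measurableSet_lt measurable_const hd).inter (measurableSet_le hd measurable_const)

lemma sum_excess_le (X : Set ℝ) (ρ : Measure ℝ) [IsFiniteMeasure ρ] (k n : ℕ) :
    ∑ j ∈ Finset.range n, excess X ρ ((1 / 2) ^ j) ((1 / 2) ^ (j + k)) ≤
      (k + 2 : ℕ) * ρ univ ^ 3 := by
  have hslice : ∀ (w : ℝ) (j : ℕ), MeasurableSet {p : ℝ × ℝ |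
      (1 / 2) ^ (j + k) < infDist (p.1 + p.2 - w) X ∧
        infDist (p.1 + p.2 - w) X ≤ 4 * (1 / 2) ^ j} := fun w j =>
    (measurable_prodMk_left (x := w)) (measurableSet_excess X ((1 / 2) ^ j) ((1 / 2) ^ (j + k)))
  have hbound : ∀ w : ℝ, ∑ j ∈ Finset.range n, (ρ.prod ρ) {p |
      (1 / 2) ^ (j + k) < infDist (p.1 + p.2 - w) X ∧
        infDist (p.1 + p.2 - w) X ≤ 4 * (1 / 2) ^ j} ≤ (k + 2 : ℕ) * ρ univ ^ 2 := by
    intro w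
    simp_rw [← fun j => lintegral_indicator_one (μ := ρ.prod ρ) (hslice w j)]
    rw [← lintegral_finsetSum _ fun j _ => measurable_one.indicator (hslice w j)]
    calc _ ≤ ∫⁻ _, ((k + 2 : ℕ) : ℝ≥0∞) ∂(ρ.prod ρ) := by
          refine lintegral_mono fun p => ?_
          simp only [indicator_apply, mem_ofPred_eq, Pi.one_apply]
          rw [Finset.sum_boole]
          exact_mod_cast card_dyadic_window_le _ k n
      _ = _ := by
          rw [lintegral_const, ← univ_prod_univ, Measure.prod_prod, sq]
  unfold excess
  have hme : ∀ j : ℕ, Measurable fun w => (ρ.prod ρ) {p : ℝ × ℝ |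
      (1 / 2) ^ (j + k) < infDist (p.1 + p.2 - w) X ∧
        infDist (p.1 + p.2 - w) X ≤ 4 * (1 / 2) ^ j} := fun j =>
    measurable_measure_prodMk_left (measurableSet_excess X ((1 / 2) ^ j) ((1 / 2) ^ (j + k)))
  rw [← lintegral_finsetSum _ fun j _ => hme j]
  calc _ ≤ ∫⁻ _, (k + 2 : ℕ) * ρ univ ^ 2 ∂ρ := lintegral_mono hbound
    _ = _ := by rw [lintegral_const, pow_succ _ 2, mul_assoc]

namespace IsWindowRegular

variable {δ r C : ℝ} {X : Set ℝ} {ρ : Measure ℝ}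

lemma lintegral_bandSet_le [IsFiniteMeasure ρ] (h : IsWindowRegular δ r C X ρ) {s e : ℝ}
    (hre : r ≤ e) (hes : e ≤ s) (hs : s ≤ 1) :
    ENNReal.ofReal (C⁻¹ * e ^ δ) * ∫⁻ q, volume (bandSet X s e (q.1 - q.2))
        ∂((ρ.restrict (Icc (-1) 1)).prod (ρ.restrict (Icc (-1) 1))) ≤
      ENNReal.ofReal (2 * (2 * s)) * excess X ρ s e := by
  set ν := ρ.restrict (Icc (-1) 1) with hν
  have hνρ : ν ≤ ρ := Measure.restrict_le_self
  have hmb : Measurable fun q : ℝ × ℝ => volume (bandSet X s e (q.1 - q.2)) :=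
    (measurable_measure_prodMk_left (measurableSet_bandSet_prod h.closed s e)).comp
      (measurable_fst.sub measurable_snd)
  rw [lintegral_prod_symm _ hmb.aemeasurable, ← lintegral_const_mul' _ _ ENNReal.ofReal_ne_top, excess,
    ← lintegral_const_mul' _ _ ENNReal.ofReal_ne_top]
  refine lintegral_mono' hνρ fun x => ?_
  simp only
  have hset : MeasurableSet {p : ℝ × ℝ | e < infDist (p.1 + p.2 - x) X ∧
      infDist (p.1 + p.2 - x) X ≤ 4 * s} :=
    (measurable_prodMk_left (x := x)) (measurableSet_excess X s e)
  rw [Measure.prod_apply_symm hset, ← lintegral_const_mul' _ _ ENNReal.ofReal_ne_top,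
    ← lintegral_const_mul' _ _ ENNReal.ofReal_ne_top]
  refine lintegral_mono' hνρ fun z => ?_
  have := h.volume_bandSet_le hre hes hs (z - x)
  simp_rw [← add_sub_assoc] at this
  exact this

lemma volume_prod_hitSet_le [IsFiniteMeasure ρ] (h : IsWindowRegular δ r C X ρ) {s e : ℝ}
    (hre : r ≤ e) (hes : 32 * e ≤ s) (hs : s ≤ 1) {z : ℝ} (hz : z ∈ Icc (-1 : ℝ) 1) :
    ENNReal.ofReal (C⁻¹ * e ^ δ) ^ 2 * (volume.prod (ρ.restrict (Icc (-1) 1)))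
        {q : ℝ × ℝ | q.1 ∈ hitSet X s e (z - q.2) ∧ q.2 ∈ Icc (-1 : ℝ) 1 ∧
          q.2 ∉ isolatedSet X s e} ≤
      ENNReal.ofReal (C * (3 * e) ^ δ) * ENNReal.ofReal (2 * (2 * s)) *
        (ρ.prod ρ) {p | e < infDist (p.1 + p.2 - z) X ∧ infDist (p.1 + p.2 - z) X ≤ 4 * s} := by
  have he0 : 0 < e := h.pos.trans_le hre
  have hm := measurable_leftPoint h.closed
  set ν := ρ.restrict (Icc (-1) 1) with hν
  have hset : MeasurableSet {p : ℝ × ℝ | e < infDist (p.1 + p.2 - z) X ∧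
      infDist (p.1 + p.2 - z) X ≤ 4 * s} :=
    (measurable_prodMk_left (x := z)) (measurableSet_excess X s e)
  refine double_count (volume.prod ν) (ρ.prod ρ)
    (S := {w : (ℝ × ℝ) × (ℝ × ℝ) | w.2 ∈ {p : ℝ × ℝ | e < infDist (p.1 + p.2 - z) X ∧
      infDist (p.1 + p.2 - z) X ≤ 4 * s} ∧ |w.2.1 + w.2.2 - z - w.1.1| ≤ 2 * s ∧
      |w.1.2 - (leftPoint X w.1.1 + z - w.2.1)| ≤ 3 * e}) ?_ hset ?_ ?_ (fun _ hp => hp.1)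
  · refine (measurable_snd hset).inter (MeasurableSet.inter ?_ ?_)
    · exact measurableSet_le (f := fun w : (ℝ × ℝ) × (ℝ × ℝ) => |w.2.1 + w.2.2 - z - w.1.1|)
        (by fun_prop) measurable_const
    · exact measurableSet_le
        (f := fun w : (ℝ × ℝ) × (ℝ × ℝ) => |w.1.2 - (leftPoint X w.1.1 + z - w.2.1)|)
        (by fun_prop) measurable_const
  · rintro ⟨y, x⟩ ⟨⟨⟨hy, haX, hay, hya⟩, hit⟩, hx, hiso⟩
    simp only [isolatedSet, mem_ofPred_eq, not_forall, not_lt] at hiso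
    obtain ⟨hxX, hx8⟩ := hiso
    set a := leftPoint X y with ha
    change a + s / 2 < y at hay
    change y ≤ a + s at hya
    change infDist (a + (z - x)) X ≤ 2 * e at hit
    change y ∈ Icc (-1 : ℝ) 5 at hy
    change x ∈ Icc (-1 : ℝ) 1 at hx
    obtain ⟨x₄, hx₄, hdist⟩ := h.closed.exists_infDist_eq_dist h.nonempty (a + (z - x))
    rw [hdist, Real.dist_eq, abs_le] at hit
    obtain ⟨hx'X, hx'⟩ := leftPoint_mem h.closed hxX (show x ≤ x + s / 4 by linarith)
    set x' := leftPoint X (x + s / 4) with hx'def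
    change x' ≤ x + s / 4 at hx'
    rw [sq]
    calc ENNReal.ofReal (C⁻¹ * e ^ δ) * ENNReal.ofReal (C⁻¹ * e ^ δ)
        ≤ ρ (closedBall x₄ e) * ρ (closedBall x' e) := by
          refine mul_le_mul' ?_ ?_
          · exact h.lower _ hx₄ ⟨by linarith [hy.1, hz.1, hx.2], by linarith [hy.2, hz.2, hx.1]⟩
              e hre (by linarith)
          · exact h.lower _ hx'X ⟨by linarith [hx.1], by linarith [hx.2]⟩ e hre (by linarith)
      _ = (ρ.prod ρ) (closedBall x₄ e ×ˢ closedBall x' e) := (Measure.prod_prod _ _).symm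
      _ ≤ _ := by
          refine measure_mono ?_
          rintro ⟨u, v⟩ ⟨hu, hv⟩
          simp only [mem_closedBall, Real.dist_eq, abs_le] at hu hv
          refine ⟨⟨?_, ?_⟩, ?_, ?_⟩
          · refine (show e < 4 * e by linarith).trans_le ?_
            rw [le_infDist h.nonempty]
            intro b hb
            change 4 * e ≤ dist (u + v - z) b
            rw [Real.dist_eq, le_abs]
            by_cases hby : b ≤ y
            · have := le_leftPoint hb hby
              left
              linarith
            · right
              linarith
          · refine (infDist_le_dist_of_mem haX).trans ?_
            change dist (u + v - z) a ≤ 4 * s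
            rw [Real.dist_eq, abs_le]
            constructor <;> linarith
          · change |u + v - z - y| ≤ 2 * s
            rw [abs_le]
            constructor <;> linarith
          · change |x - (a + z - u)| ≤ 3 * e
            rw [abs_le]
            constructor <;> linarith
  · rintro ⟨u, v⟩
    have hR : MeasurableSet {q : ℝ × ℝ | |u + v - z - q.1| ≤ 2 * s ∧
        |q.2 - (leftPoint X q.1 + z - u)| ≤ 3 * e} :=
      MeasurableSet.inter
        (measurableSet_le (f := fun q : ℝ × ℝ => |u + v - z - q.1|) (by fun_prop) measurable_const)
        (measurableSet_le (f := fun q : ℝ × ℝ => |q.2 - (leftPoint X q.1 + z - u)|)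
          (by fun_prop) measurable_const)
    have hI : MeasurableSet {y : ℝ | |u + v - z - y| ≤ 2 * s} :=
      measurableSet_le (by fun_prop) measurable_const
    calc _ ≤ (volume.prod ν) {q : ℝ × ℝ | |u + v - z - q.1| ≤ 2 * s ∧
          |q.2 - (leftPoint X q.1 + z - u)| ≤ 3 * e} := measure_mono fun q hq => hq.2
      _ = ∫⁻ y, ν (Prod.mk y ⁻¹' {q : ℝ × ℝ | |u + v - z - q.1| ≤ 2 * s ∧
          |q.2 - (leftPoint X q.1 + z - u)| ≤ 3 * e}) := Measure.prod_apply hR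
      _ ≤ ∫⁻ y, {y : ℝ | |u + v - z - y| ≤ 2 * s}.indicator
          (fun _ => ENNReal.ofReal (C * (3 * e) ^ δ)) y := by
          refine lintegral_mono fun y => ?_
          by_cases hy : |u + v - z - y| ≤ 2 * s
          · rw [indicator_of_mem (show y ∈ {y : ℝ | |u + v - z - y| ≤ 2 * s} from hy)]
            refine ((Measure.restrict_le_self _).trans (measure_mono ?_)).trans
              (h.upper (leftPoint X y + z - u) (3 * e) (by linarith) (by linarith))
            intro x hx
            rw [mem_closedBall, Real.dist_eq]
            exact hx.2
          · rw [indicator_of_notMem (show y ∉ {y : ℝ | |u + v - z - y| ≤ 2 * s} from hy)]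
            refine le_of_eq (measure_mono_null (t := ∅) (fun x hx => hy hx.1) measure_empty)
      _ = _ := by rw [lintegral_indicator_const hI, volume_abs_sub_le]

lemma lintegral_hitSet_le [IsFiniteMeasure ρ] (h : IsWindowRegular δ r C X ρ) {s e : ℝ}
    (hre : r ≤ e) (hes : 32 * e ≤ s) (hs : s ≤ 1) :
    ENNReal.ofReal (C⁻¹ * e ^ δ) ^ 2 * ∫⁻ q, volume (hitSet X s e (q.1 - q.2))
        ∂((ρ.restrict (Icc (-1) 1)).prod (ρ.restrict (Icc (-1) 1))) ≤
      ENNReal.ofReal (C * (3 * e) ^ δ) * ENNReal.ofReal (2 * (2 * s)) * excess X ρ s e +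
        ENNReal.ofReal (C⁻¹ * e ^ δ) ^ 2 * (volume (gapSet X s) *
          (ρ.restrict (Icc (-1) 1)) (isolatedSet X s e) * (ρ.restrict (Icc (-1) 1)) univ) := by
  set ν := ρ.restrict (Icc (-1) 1) with hν
  have hνρ : ν ≤ ρ := Measure.restrict_le_self
  set c := ENNReal.ofReal (C⁻¹ * e ^ δ) ^ 2 with hc
  have hcfin : c ≠ ⊤ := by simp [hc]
  set d := ENNReal.ofReal (C * (3 * e) ^ δ) * ENNReal.ofReal (2 * (2 * s)) with hd
  have hdfin : d ≠ ⊤ := ENNReal.mul_ne_top ENNReal.ofReal_ne_top ENNReal.ofReal_ne_top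
  have hmb : Measurable fun q : ℝ × ℝ => volume (hitSet X s e (q.1 - q.2)) :=
    (measurable_measure_prodMk_left (measurableSet_hitSet_prod h.closed s e)).comp
      (measurable_fst.sub measurable_snd)
  have hpt : ∀ z ∈ Icc (-1 : ℝ) 1, c * ∫⁻ x, volume (hitSet X s e (z - x)) ∂ν ≤
      d * (ρ.prod ρ) {p | e < infDist (p.1 + p.2 - z) X ∧ infDist (p.1 + p.2 - z) X ≤ 4 * s} +
        c * (volume (gapSet X s) * ν (isolatedSet X s e)) := by
    intro z hz
    have hset : MeasurableSet {q : ℝ × ℝ | q.1 ∈ hitSet X s e (z - q.2)} :=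
      (show Measurable fun q : ℝ × ℝ => (z - q.2, q.1) by fun_prop)
        (measurableSet_hitSet_prod h.closed s e)
    have h1 : ∫⁻ x, volume (hitSet X s e (z - x)) ∂ν =
        (volume.prod ν) {q : ℝ × ℝ | q.1 ∈ hitSet X s e (z - q.2)} :=
      (Measure.prod_apply_symm hset).symm
    have h2 : {q : ℝ × ℝ | q.1 ∈ hitSet X s e (z - q.2)} ⊆
        {q : ℝ × ℝ | q.1 ∈ hitSet X s e (z - q.2) ∧ q.2 ∈ Icc (-1 : ℝ) 1 ∧
          q.2 ∉ isolatedSet X s e} ∪ gapSet X s ×ˢ (isolatedSet X s e ∪ (Icc (-1) 1)ᶜ) := by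
      rintro ⟨y, x⟩ hq
      by_cases hx : x ∈ isolatedSet X s e ∪ (Icc (-1) 1)ᶜ
      · exact Or.inr ⟨hq.1, hx⟩
      · simp only [mem_union, mem_compl_iff, not_or, not_not] at hx
        exact Or.inl ⟨hq, hx.2, hx.1⟩
    have h3 : ν (isolatedSet X s e ∪ (Icc (-1) 1)ᶜ) ≤ ν (isolatedSet X s e) := by
      refine (measure_union_le _ _).trans (le_of_eq ?_)
      rw [hν, Measure.restrict_apply measurableSet_Icc.compl, compl_inter_self, measure_empty,
        add_zero]
    calc c * ∫⁻ x, volume (hitSet X s e (z - x)) ∂ν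
        ≤ c * ((volume.prod ν) {q : ℝ × ℝ | q.1 ∈ hitSet X s e (z - q.2) ∧
            q.2 ∈ Icc (-1 : ℝ) 1 ∧ q.2 ∉ isolatedSet X s e} +
            volume (gapSet X s) * ν (isolatedSet X s e)) := by
          rw [h1]
          gcongr
          refine (measure_mono h2).trans ((measure_union_le _ _).trans ?_)
          rw [Measure.prod_prod]
          gcongr
      _ ≤ _ := by
          rw [mul_add]
          exact add_le_add (h.volume_prod_hitSet_le hre hes hs hz) le_rfl
  rw [lintegral_prod _ hmb.aemeasurable, ← lintegral_const_mul' _ _ hcfin]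
  have hme : Measurable fun z => (ρ.prod ρ) {p : ℝ × ℝ | e < infDist (p.1 + p.2 - z) X ∧
      infDist (p.1 + p.2 - z) X ≤ 4 * s} :=
    measurable_measure_prodMk_left (measurableSet_excess X s e)
  calc _ ≤ ∫⁻ z, (d * (ρ.prod ρ) {p | e < infDist (p.1 + p.2 - z) X ∧
          infDist (p.1 + p.2 - z) X ≤ 4 * s} +
          c * (volume (gapSet X s) * ν (isolatedSet X s e))) ∂ν :=
        lintegral_mono_ae ((ae_restrict_mem measurableSet_Icc).mono hpt)
    _ = d * ∫⁻ z, (ρ.prod ρ) {p | e < infDist (p.1 + p.2 - z) X ∧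
          infDist (p.1 + p.2 - z) X ≤ 4 * s} ∂ν +
          c * (volume (gapSet X s) * ν (isolatedSet X s e) * ν univ) := by
        rw [lintegral_add_right _ measurable_const, lintegral_const_mul' _ _ hdfin,
          lintegral_const]
        ring
    _ ≤ _ := by
        gcongr
        exact lintegral_mono' hνρ le_rfl

lemma addEnergy_le [IsFiniteMeasure ρ] (h : IsWindowRegular δ r C X ρ) (hr : r ≤ 1) :
    addEnergy (ρ.restrict (Icc (-1) 1)) r ≤ ENNReal.ofReal (C * r ^ δ) *
      ∫⁻ q, (ρ.restrict (Icc (-1) 1)) {x | infDist (x + (q.1 - q.2)) X ≤ r}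
        ∂((ρ.restrict (Icc (-1) 1)).prod (ρ.restrict (Icc (-1) 1))) := by
  set ν := ρ.restrict (Icc (-1) 1) with hν
  have hνρ : ν ≤ ρ := Measure.restrict_le_self
  set c := ENNReal.ofReal (C * r ^ δ) with hc
  have hcfin : c ≠ ⊤ := by simp [hc]
  have hd : Measurable fun z => infDist z X := (continuous_infDist_pt X).measurable
  have hE : MeasurableSet {p : ℝ × ℝ × ℝ × ℝ | ‖p.1 + p.2.1 - p.2.2.1 - p.2.2.2‖ ≤ r} :=
    measurableSet_le (by fun_prop) measurable_const
  have hQ : MeasurableSet {p : ℝ × ℝ × ℝ | infDist (p.1 + p.2.1 - p.2.2) X ≤ r} :=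
    measurableSet_le (hd.comp (by fun_prop)) measurable_const
  have hinner : ∀ b : ℝ, ν {x | ‖b - x‖ ≤ r} ≤ {b | infDist b X ≤ r}.indicator (fun _ => c) b := by
    intro b
    by_cases hb : infDist b X ≤ r
    · rw [indicator_of_mem (show b ∈ {b | infDist b X ≤ r} from hb)]
      refine (hνρ _).trans ((measure_mono fun x hx => ?_).trans (h.upper b r le_rfl hr))
      rw [mem_closedBall, dist_comm, dist_eq_norm]
      exact hx
    · rw [indicator_of_notMem (show b ∉ {b | infDist b X ≤ r} from hb)]
      refine (hνρ _).trans ((measure_mono (t := Xᶜ) fun x hx hxX => hb ?_).trans h.null.le)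
      rw [mem_ofPred_eq, ← dist_eq_norm] at hx
      exact (infDist_le_dist_of_mem hxX).trans hx
  calc addEnergy ν r = ∫⁻ x₁, ∫⁻ x₂, ∫⁻ x₃, ν {x₄ | ‖x₁ + x₂ - x₃ - x₄‖ ≤ r} ∂ν ∂ν ∂ν := by
        rw [addEnergy, Measure.prod_apply hE]
        refine lintegral_congr fun x₁ => ?_
        have hE₁ := (measurable_prodMk_left (x := x₁)) hE
        rw [Measure.prod_apply hE₁]
        refine lintegral_congr fun x₂ => ?_
        have hE₂ := (measurable_prodMk_left (x := x₂)) hE₁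
        rw [Measure.prod_apply hE₂]
        rfl
    _ ≤ ∫⁻ x₁, ∫⁻ x₂, c * ν {x₃ | infDist (x₁ + x₂ - x₃) X ≤ r} ∂ν ∂ν := by
        refine lintegral_mono fun x₁ => lintegral_mono fun x₂ => ?_
        have hm : MeasurableSet {x₃ | infDist (x₁ + x₂ - x₃) X ≤ r} :=
          measurableSet_le (hd.comp (by fun_prop)) measurable_const
        rw [← lintegral_indicator_const hm]
        exact lintegral_mono fun x₃ => hinner _
    _ = c * (ν.prod (ν.prod ν)) {p : ℝ × ℝ × ℝ | infDist (p.1 + p.2.1 - p.2.2) X ≤ r} := by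
        simp_rw [lintegral_const_mul' _ _ hcfin]
        rw [Measure.prod_apply hQ]
        congr 1
        refine lintegral_congr fun x₁ => ?_
        rw [Measure.prod_apply ((measurable_prodMk_left (x := x₁)) hQ)]
        rfl
    _ = _ := by
        rw [Measure.prod_apply_symm hQ]
        simp_rw [← add_sub_assoc]
        rfl

end IsWindowRegular

lemma IsRegularMeasure.isWindowRegular {δ r C : ℝ} {X : Set ℝ} {μ : Measure ℝ}
    (h : IsRegularMeasure δ r 1 C X μ) (hr : 0 < r) (hr1 : r ≤ 1) (hC : 1 < C) (hδ : 0 < δ)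
    (hδ1 : δ < 1) (hX : IsClosed X) (hne : X.Nonempty) :
    IsWindowRegular δ r C X (μ.restrict (Icc (-9) 9)) where
  pos := hr
  one_lt := hC
  delta_pos := hδ
  delta_lt := hδ1
  closed := hX
  nonempty := hne
  null := le_antisymm ((Measure.restrict_le_self _).trans h.2.1.le) zero_le
  univ_le := by
    rw [Measure.restrict_apply_univ]
    have hsub : Icc (-9 : ℝ) 9 ⊆ ⋃ i ∈ Finset.range 9, closedBall (2 * (i : ℝ) - 8) 1 := by
      intro x hx
      have h0 : 0 ≤ (x + 9) / 2 := by linarith [hx.1]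
      have h1 := Nat.floor_le h0
      have h2 := Nat.lt_floor_add_one ((x + 9) / 2)
      simp only [mem_iUnion, mem_closedBall, Real.dist_eq, abs_le, Finset.mem_range]
      by_cases h9 : ⌊(x + 9) / 2⌋₊ < 9
      · exact ⟨⌊(x + 9) / 2⌋₊, h9, by linarith, by linarith⟩
      · have h9' : (9 : ℝ) ≤ ⌊(x + 9) / 2⌋₊ := by exact_mod_cast not_lt.1 h9
        refine ⟨8, by norm_num, ?_, ?_⟩ <;> norm_num <;> linarith [hx.2]
    calc μ (Icc (-9) 9) ≤ ∑ i ∈ Finset.range 9, μ (closedBall (2 * (i : ℝ) - 8) 1) :=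
          (measure_mono hsub).trans (measure_biUnion_finset_le _ _)
      _ ≤ ∑ i ∈ Finset.range 9, ENNReal.ofReal C := Finset.sum_le_sum fun i _ => by
          simpa using h.2.2.1 (2 * (i : ℝ) - 8) 1 hr1 le_rfl
      _ = ENNReal.ofReal (9 * C) := by
          rw [Finset.sum_const, Finset.card_range, ENNReal.ofReal_mul (by norm_num)]
          simp
  upper := fun x s hrs hs => (Measure.restrict_le_self _).trans (h.2.2.1 x s hrs hs)
  lower := fun x hx hx8 s hrs hs => by
    rw [Measure.restrict_eq_self]
    · exact h.2.2.2 x hx s hrs hs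
    · rw [Real.closedBall_eq_Icc]
      exact Icc_subset_Icc (by linarith [hx8.1]) (by linarith [hx8.2])

lemma ofReal_mul_le_of_ofReal_mul_le {a p : ℝ} {x y : ℝ≥0∞} (ha : 0 < a) (hp : 0 ≤ p)
    (h : ENNReal.ofReal a * x ≤ y) : ENNReal.ofReal p * x ≤ ENNReal.ofReal (p / a) * y := by
  calc ENNReal.ofReal p * x = ENNReal.ofReal (p / a) * (ENNReal.ofReal a * x) := by
        rw [← mul_assoc, ← ENNReal.ofReal_mul (by positivity), div_mul_cancel₀ _ ha.ne']
    _ ≤ _ := by gcongr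

namespace IsWindowRegular

variable {δ r C : ℝ} {X : Set ℝ} {ρ : Measure ℝ}

lemma measure_restrict_univ_le (h : IsWindowRegular δ r C X ρ) (hr : r ≤ 1) :
    (ρ.restrict (Icc (-1) 1)) univ ≤ ENNReal.ofReal C := by
  have := h.upper 0 1 hr le_rfl
  rw [Real.closedBall_eq_Icc] at this
  simpa using this

lemma weighted_lintegral_le [IsFiniteMeasure ρ] (h : IsWindowRegular δ r C X ρ) {s e η : ℝ}
    (hre : r ≤ e) (hes : 32 * e ≤ s) (hs : s ≤ 1) (he : e ^ δ = η * s ^ δ) :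
    ENNReal.ofReal (s ^ (δ - 1)) *
      (∫⁻ q, volume (bandSet X s e (q.1 - q.2))
        ∂((ρ.restrict (Icc (-1) 1)).prod (ρ.restrict (Icc (-1) 1))) +
      ∫⁻ q, volume (hitSet X s e (q.1 - q.2))
        ∂((ρ.restrict (Icc (-1) 1)).prod (ρ.restrict (Icc (-1) 1)))) ≤
      ENNReal.ofReal (16 * C ^ 3 / η) * excess X ρ s e +
        ENNReal.ofReal (s ^ (δ - 1) * volume.real (gapSet X s)) *
          ENNReal.ofReal (1152 * C ^ 4 * η) := by
  have he0 : 0 < e := h.pos.trans_le hre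
  have hs0 : 0 < s := by linarith
  have hC : 0 < C := by linarith [h.one_lt]
  have hC1 := h.one_lt.le
  have hsδ : 0 < s ^ δ := Real.rpow_pos_of_pos hs0 _
  have heδ : 0 < e ^ δ := Real.rpow_pos_of_pos he0 _
  have hη : 0 < η := pos_of_mul_pos_left (he ▸ heδ) hsδ.le
  have ha : 0 < C⁻¹ * e ^ δ := by positivity
  have hp : 0 ≤ s ^ (δ - 1) := by positivity
  have hps : s ^ (δ - 1) * s = s ^ δ := by
    rw [Real.rpow_sub_one hs0.ne', div_mul_cancel₀ _ hs0.ne']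
  have hband := ofReal_mul_le_of_ofReal_mul_le ha hp
    (h.lintegral_bandSet_le hre (by linarith) hs)
  have hhit := h.lintegral_hitSet_le hre hes hs
  rw [← ENNReal.ofReal_pow ha.le, ← ENNReal.ofReal_mul (by positivity)] at hhit
  replace hhit := ofReal_mul_le_of_ofReal_mul_le (by positivity) hp hhit
  rw [mul_add, ← mul_assoc (ENNReal.ofReal (_ / _)) (ENNReal.ofReal _),
    ← mul_assoc (ENNReal.ofReal (_ / _)) (ENNReal.ofReal _), ← ENNReal.ofReal_mul (by positivity),
    ← ENNReal.ofReal_mul (by positivity), div_mul_cancel₀ _ (by positivity)] at hhit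
  rw [← mul_assoc, ← ENNReal.ofReal_mul (by positivity)] at hband
  have hiso := h.measure_isolatedSet_le hre (by linarith) hs
  have hη' : (e / s) ^ δ = η := by
    rw [Real.div_rpow he0.le hs0.le, he, mul_div_cancel_right₀ _ hsδ.ne']
  rw [hη'] at hiso
  have hgap : volume (gapSet X s) = ENNReal.ofReal (volume.real (gapSet X s)) :=
    (ofReal_measureReal (((volume_real_le_six fun y hy => hy.1).trans_lt (by simp)).ne)).symm
  have hb : s ^ (δ - 1) / (C⁻¹ * e ^ δ) * (2 * (2 * s)) ≤ 4 * C ^ 3 / η := by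
    have : s ^ (δ - 1) / (C⁻¹ * e ^ δ) * (2 * (2 * s)) = 4 * C ^ 1 / η := by
      rw [he, ← hps]
      field_simp
      norm_num
    rw [this]
    gcongr 4 * ?_ / η
    exact pow_le_pow_right₀ hC1 (by norm_num)
  have hh : s ^ (δ - 1) / (C⁻¹ * e ^ δ) ^ 2 * (C * (3 * e) ^ δ * (2 * (2 * s))) ≤
      12 * C ^ 3 / η := by
    have h3 : (3 : ℝ) ^ δ ≤ 3 := by
      simpa using Real.rpow_le_rpow_of_exponent_le (x := 3) (by norm_num) h.delta_lt.le
    have : s ^ (δ - 1) / (C⁻¹ * e ^ δ) ^ 2 * (C * (3 * e) ^ δ * (2 * (2 * s))) =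
        4 * 3 ^ δ * C ^ 3 / η := by
      rw [Real.mul_rpow (by norm_num) he0.le, he, ← hps]
      field_simp
      norm_num
    rw [this]
    gcongr
    linarith
  rw [mul_add]
  calc _ ≤ ENNReal.ofReal (4 * C ^ 3 / η) * excess X ρ s e +
        (ENNReal.ofReal (12 * C ^ 3 / η) * excess X ρ s e +
          ENNReal.ofReal (s ^ (δ - 1)) * (ENNReal.ofReal (volume.real (gapSet X s)) *
            ENNReal.ofReal (1152 * C ^ 3 * η) * ENNReal.ofReal C)) := by
        refine add_le_add (hband.trans ?_) (hhit.trans ?_)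
        · gcongr
        · rw [hgap]
          gcongr
          exact h.measure_restrict_univ_le (by linarith)
    _ = _ := by
        rw [← add_assoc, ← add_mul, ← ENNReal.ofReal_add (by positivity) (by positivity),
          mul_assoc (ENNReal.ofReal (volume.real _)), ← ENNReal.ofReal_mul (by positivity),
          ← mul_assoc, ← ENNReal.ofReal_mul (by positivity)]
        congr 3 <;> ring

lemma lintegral_slice_le [IsFiniteMeasure ρ] (h : IsWindowRegular δ r C X ρ) {k n : ℕ}
    (hk : 5 ≤ k) (hr : r ≤ (1 / 2) ^ (n + k)) :
    ENNReal.ofReal (n * ((1 - δ) / 2 * C⁻¹)) *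
      ∫⁻ q, (ρ.restrict (Icc (-1) 1)) {x | infDist (x + (q.1 - q.2)) X ≤ r}
        ∂((ρ.restrict (Icc (-1) 1)).prod (ρ.restrict (Icc (-1) 1))) ≤
      ENNReal.ofReal (36 * C ^ 4 + 16 * C ^ 3 / ((1 / 2) ^ k) ^ δ * ((k + 2) * (9 * C) ^ 3) +
        36 * C ^ 2 * (1 + n * (1 - δ)) * (1152 * C ^ 4 * ((1 / 2) ^ k) ^ δ)) := by
  have hC : 0 < C := by linarith [h.one_lt]
  have hθ : 0 < 1 - δ := by linarith [h.delta_lt]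
  have h2 : ∀ a b : ℕ, a ≤ b → (1 / 2 : ℝ) ^ b ≤ (1 / 2) ^ a := fun a b hab =>
    pow_le_pow_of_le_one (by norm_num) (by norm_num) hab
  have h32 : ∀ j : ℕ, 32 * (1 / 2 : ℝ) ^ (j + k) ≤ (1 / 2) ^ j := fun j => by
    calc 32 * (1 / 2 : ℝ) ^ (j + k) ≤ 32 * (1 / 2) ^ (j + 5) := by
          gcongr 32 * ?_
          exact h2 _ _ (by omega)
      _ = _ := by rw [pow_add]; ring
  have hrn : r ≤ (1 / 2) ^ n := hr.trans (h2 _ _ (by omega))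
  have hr1 : r ≤ 1 := hrn.trans (pow_le_one₀ (by norm_num) (by norm_num))
  set η : ℝ := ((1 / 2) ^ k) ^ δ with hη
  have hη0 : 0 < η := by positivity
  set ν := ρ.restrict (Icc (-1) 1) with hν
  have hmb : ∀ s e : ℝ, Measurable fun q : ℝ × ℝ => volume (bandSet X s e (q.1 - q.2)) :=
    fun s e => (measurable_measure_prodMk_left (measurableSet_bandSet_prod h.closed s e)).comp
      (measurable_fst.sub measurable_snd)
  have hmh : ∀ s e : ℝ, Measurable fun q : ℝ × ℝ => volume (hitSet X s e (q.1 - q.2)) :=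
    fun s e => (measurable_measure_prodMk_left (measurableSet_hitSet_prod h.closed s e)).comp
      (measurable_fst.sub measurable_snd)
  have hνu : (ν.prod ν) univ ≤ ENNReal.ofReal (C ^ 2) := by
    rw [← univ_prod_univ, Measure.prod_prod, sq, ENNReal.ofReal_mul hC.le]
    exact mul_le_mul' (h.measure_restrict_univ_le hr1) (h.measure_restrict_univ_le hr1)
  have hexc : ∑ j ∈ Finset.range n, excess X ρ ((1 / 2) ^ j) ((1 / 2) ^ (j + k)) ≤
      ENNReal.ofReal ((k + 2) * (9 * C) ^ 3) := by
    refine (sum_excess_le X ρ k n).trans ?_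
    rw [ENNReal.ofReal_mul (by positivity), ENNReal.ofReal_pow (by positivity)]
    gcongr
    · rw [← ENNReal.ofReal_natCast]
      push_cast
      exact le_rfl
    · exact h.univ_le
  have hmw : ∀ j : ℕ, Measurable fun q : ℝ × ℝ => ENNReal.ofReal (((1 / 2 : ℝ) ^ j) ^ (δ - 1)) *
      (volume (bandSet X ((1 / 2) ^ j) ((1 / 2) ^ (j + k)) (q.1 - q.2)) +
        volume (hitSet X ((1 / 2) ^ j) ((1 / 2) ^ (j + k)) (q.1 - q.2))) :=
    fun j => ((hmb _ _).add (hmh _ _)).const_mul _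
  calc _ ≤ ENNReal.ofReal (n * ((1 - (1 / 2) ^ (1 - δ)) * C⁻¹)) *
        ∫⁻ q, ν {x | infDist (x + (q.1 - q.2)) X ≤ r} ∂(ν.prod ν) := by
        gcongr
        exact one_sub_two_rpow_neg_ge hθ.le (by linarith [h.delta_pos])
    _ = ∫⁻ q, ENNReal.ofReal (n * ((1 - (1 / 2) ^ (1 - δ)) * C⁻¹)) *
        ν {x | infDist (x + (q.1 - q.2)) X ≤ r} ∂(ν.prod ν) :=
        (lintegral_const_mul' _ _ ENNReal.ofReal_ne_top).symm
    _ ≤ ∫⁻ q, (ENNReal.ofReal (36 * C ^ 2) + ∑ j ∈ Finset.range n,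
        ENNReal.ofReal (((1 / 2 : ℝ) ^ j) ^ (δ - 1)) *
          (volume (bandSet X ((1 / 2) ^ j) ((1 / 2) ^ (j + k)) (q.1 - q.2)) +
            volume (hitSet X ((1 / 2) ^ j) ((1 / 2) ^ (j + k)) (q.1 - q.2)))) ∂(ν.prod ν) :=
        lintegral_mono fun q => h.slice_bound (q.1 - q.2) n hrn _ fun j => by
          linarith [h32 j, show (0 : ℝ) < (1 / 2) ^ (j + k) by positivity]
    _ = ENNReal.ofReal (36 * C ^ 2) * (ν.prod ν) univ + ∑ j ∈ Finset.range n,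
        ENNReal.ofReal (((1 / 2 : ℝ) ^ j) ^ (δ - 1)) *
          (∫⁻ q, volume (bandSet X ((1 / 2) ^ j) ((1 / 2) ^ (j + k)) (q.1 - q.2)) ∂(ν.prod ν) +
            ∫⁻ q, volume (hitSet X ((1 / 2) ^ j) ((1 / 2) ^ (j + k)) (q.1 - q.2))
              ∂(ν.prod ν)) := by
        rw [lintegral_add_left measurable_const, lintegral_const, lintegral_finsetSum _
          fun j _ => hmw j]
        congr 1
        refine Finset.sum_congr rfl fun j _ => ?_
        rw [lintegral_const_mul' _ _ ENNReal.ofReal_ne_top, lintegral_add_left (hmb _ _)]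
    _ ≤ ENNReal.ofReal (36 * C ^ 2) * ENNReal.ofReal (C ^ 2) + ∑ j ∈ Finset.range n,
        (ENNReal.ofReal (16 * C ^ 3 / η) * excess X ρ ((1 / 2) ^ j) ((1 / 2) ^ (j + k)) +
          ENNReal.ofReal (((1 / 2 : ℝ) ^ j) ^ (δ - 1) * volume.real (gapSet X ((1 / 2) ^ j))) *
            ENNReal.ofReal (1152 * C ^ 4 * η)) := by
        gcongr with j hj
        refine h.weighted_lintegral_le (hr.trans (h2 _ _ ?_)) (h32 j)
          (pow_le_one₀ (by norm_num) (by norm_num)) ?_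
        · have := Finset.mem_range.1 hj
          omega
        · rw [hη, ← Real.mul_rpow (by positivity) (by positivity), pow_add, mul_comm]
    _ ≤ ENNReal.ofReal (36 * C ^ 2) * ENNReal.ofReal (C ^ 2) +
        (ENNReal.ofReal (16 * C ^ 3 / η) * ENNReal.ofReal ((k + 2) * (9 * C) ^ 3) +
          ENNReal.ofReal (36 * C ^ 2 * (1 + n * (1 - δ))) * ENNReal.ofReal (1152 * C ^ 4 * η)) := by
        rw [Finset.sum_add_distrib, ← Finset.mul_sum, ← Finset.sum_mul,
          ← ENNReal.ofReal_sum_of_nonneg fun j _ => by positivity]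
        gcongr
        exact h.sum_gap_le n hrn
    _ = _ := by
        rw [← ENNReal.ofReal_mul (by positivity), ← ENNReal.ofReal_mul (by positivity),
          ← ENNReal.ofReal_mul (by positivity), ← ENNReal.ofReal_add (by positivity)
          (by positivity), ← ENNReal.ofReal_add (by positivity) (by positivity)]
        congr 1
        ring

lemma addEnergy_le_of_scales [IsFiniteMeasure ρ] (h : IsWindowRegular δ r C X ρ) {k n : ℕ}
    {ε : ℝ} (hk : 5 ≤ k) (hr : r ≤ (1 / 2) ^ (n + k))
    (hkn : 36 * C ^ 4 + 16 * C ^ 3 / ((1 / 2) ^ k) ^ δ * ((k + 2) * (9 * C) ^ 3) +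
        36 * C ^ 2 * (1 + n * (1 - δ)) * (1152 * C ^ 4 * ((1 / 2) ^ k) ^ δ) ≤
      n * ((1 - δ) / 2 * C⁻¹) * (ε / C)) :
    addEnergy (ρ.restrict (Icc (-1) 1)) r ≤ ENNReal.ofReal (ε * r ^ δ) := by
  have hC : 0 < C := by linarith [h.one_lt]
  have hθ : 0 < 1 - δ := by linarith [h.delta_lt]
  have hr0 := h.pos
  have hn : 0 < n := by
    rcases Nat.eq_zero_or_pos n with rfl | hn
    · exfalso
      refine hkn.not_gt ?_
      rw [Nat.cast_zero, zero_mul, zero_mul]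
      positivity
    · exact hn
  have hQ := (h.lintegral_slice_le hk hr).trans (ENNReal.ofReal_le_ofReal hkn)
  have hn' : (0 : ℝ) < n * ((1 - δ) / 2 * C⁻¹) := by positivity
  rw [ENNReal.ofReal_mul hn'.le,
    ENNReal.mul_le_mul_iff_right (ENNReal.ofReal_pos.2 hn').ne' ENNReal.ofReal_ne_top] at hQ
  calc _ ≤ _ := h.addEnergy_le (hr.trans (pow_le_one₀ (by norm_num) (by norm_num)))
    _ ≤ ENNReal.ofReal (C * r ^ δ) * ENNReal.ofReal (ε / C) := by gcongr
    _ = _ := by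
        rw [← ENNReal.ofReal_mul (by positivity)]
        congr 1
        field_simp

end IsWindowRegular

/-- The number of scales needed grows at most like a logarithm. -/
lemma exists_shift {δ C ε : ℝ} (hδ : 0 < δ) (hδ1 : δ < 1) (hC : 1 < C) (hε : 0 < ε)
    (hε1 : ε ≤ 1 / 2) :
    ∃ k : ℕ, 5 ≤ k ∧ (k : ℝ) + 2 ≤ 50 * (Real.log (C / ε) / δ) ∧
      ((1 / 2 : ℝ) ^ k) ^ δ ≤ ε / (2 ^ 20 * C ^ 8) ∧
      ε / (2 ^ 21 * C ^ 8) ≤ ((1 / 2 : ℝ) ^ k) ^ δ := by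
  have hC0 : 0 < C := by linarith
  have hl := Real.log_two_gt_d9
  set l := Real.log 2 with hl_def
  set L := Real.log (C / ε) with hL
  have hlC : 0 < Real.log C := Real.log_pos hC
  have hL' : L = Real.log C - Real.log ε := Real.log_div hC0.ne' hε.ne'
  have hlε : Real.log ε ≤ -l := by
    rw [hl_def, ← Real.log_inv]
    exact Real.log_le_log hε (by linarith)
  set A := 20 * l + 8 * Real.log C - Real.log ε with hA
  have hexpA : Real.exp (-A) = ε / (2 ^ 20 * C ^ 8) := by
    rw [← Real.exp_log (show 0 < ε / (2 ^ 20 * C ^ 8) by positivity),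
      Real.log_div hε.ne' (by positivity), Real.log_mul (by positivity) (by positivity),
      Real.log_pow, Real.log_pow]
    congr 1
    push_cast
    ring
  have hη : ∀ k : ℕ, ((1 / 2 : ℝ) ^ k) ^ δ = Real.exp (-(k * (δ * l))) := fun k => by
    rw [Real.rpow_def_of_pos (by positivity), Real.log_pow, one_div, Real.log_inv, ← hl_def]
    ring_nf
  have hl0 : 0 < l := by linarith
  have hδl : 0 < δ * l := by positivity
  have hA1 : 0 ≤ A := by linarith
  have hA0 : 20 * l ≤ A := by linarith
  have hδl1 : δ * l ≤ l := by nlinarith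
  have hk1 := Nat.le_ceil (A / (δ * l))
  have hk2 := Nat.ceil_lt_add_one (show 0 ≤ A / (δ * l) by positivity)
  rw [div_le_iff₀ hδl] at hk1
  set k := ⌈A / (δ * l)⌉₊ with hk
  refine ⟨k, ?_, ?_, ?_, ?_⟩
  · have : (5 : ℝ) ≤ k := by
      by_contra! h5
      nlinarith
    exact_mod_cast this
  · rw [← mul_div_assoc, le_div_iff₀ hδ]
    have h3 : (k - 1) * δ * l < A := by
      have := (lt_div_iff₀ hδl).1 (show (k : ℝ) - 1 < A / (δ * l) by linarith)
      linarith
    have h4 : A ≤ 28 * L := by linarith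
    have h5 : (k - 1) * δ ≤ 43 * L := by
      by_contra! h5
      nlinarith
    nlinarith
  · rw [hη, ← hexpA, Real.exp_le_exp]
    linarith
  · rw [hη, show ε / (2 ^ 21 * C ^ 8) = Real.exp (-A) * (1 / 2) by rw [hexpA]; field_simp,
      show (1 / 2 : ℝ) = Real.exp (-l) by
        rw [Real.exp_neg, Real.exp_log two_pos, one_div], ← Real.exp_add, Real.exp_le_exp]
    have := (lt_div_iff₀ hδl).1 (show (k : ℝ) - 1 < A / (δ * l) by linarith)
    linarith

lemma scale_inequality {C ε η N K : ℝ} (hC : 1 < C) (hε : 0 < ε) (hε1 : ε ≤ 1 / 2) (hη0 : 0 < η)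
    (hη1 : η ≤ ε / (2 ^ 20 * C ^ 8)) (hη2 : ε / (2 ^ 21 * C ^ 8) ≤ η) (hK : 0 ≤ K)
    (hN : 10 ^ 12 * (C ^ 16 / ε ^ 2 * (K + 2)) ≤ N) :
    36 * C ^ 4 + 16 * C ^ 3 / η * ((K + 2) * (9 * C) ^ 3) +
      36 * C ^ 2 * (1 + N) * (1152 * C ^ 4 * η) ≤ N * ε / (2 * C ^ 2) := by
  have hC0 : 0 < C := by linarith
  set D := C ^ 16 / ε ^ 2 with hD
  have hD4 : 4 ≤ D := by
    rw [hD, le_div_iff₀ (by positivity)]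
    have : 1 ≤ C ^ 16 := one_le_pow₀ hC.le
    nlinarith
  have hDk : D * 2 ≤ D * (K + 2) := by
    gcongr
    linarith
  have hN1 : 1 ≤ N := by linarith
  have hDε : D * ε ^ 2 = C ^ 16 := by
    rw [hD]
    field_simp
  have t3 : 36 * C ^ 2 * (1 + N) * (1152 * C ^ 4 * η) ≤ N * ε / (4 * C ^ 2) := by
    calc 36 * C ^ 2 * (1 + N) * (1152 * C ^ 4 * η)
        ≤ 36 * C ^ 2 * (N + N) * (1152 * C ^ 4 * (ε / (2 ^ 20 * C ^ 8))) := by gcongr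
      _ = 36 * 2 * 1152 / 2 ^ 20 * (N * ε / C ^ 2) := by
        field_simp
        norm_num
      _ ≤ 1 / 4 * (N * ε / C ^ 2) := by
        refine mul_le_mul_of_nonneg_right (by norm_num) (by positivity)
      _ = _ := by
        field_simp
  have t2 : 16 * C ^ 3 / η * ((K + 2) * (9 * C) ^ 3) ≤ N * ε / (8 * C ^ 2) := by
    calc 16 * C ^ 3 / η * ((K + 2) * (9 * C) ^ 3)
        ≤ 16 * C ^ 3 / (ε / (2 ^ 21 * C ^ 8)) * ((K + 2) * (9 * C) ^ 3) := by gcongr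
      _ = 16 * 729 * 2 ^ 21 * (D * (K + 2)) * (ε / C ^ 2) := by
        rw [hD]
        field_simp
        norm_num
      _ ≤ 10 ^ 12 / 8 * (D * (K + 2)) * (ε / C ^ 2) := by
        rw [mul_assoc, mul_assoc (10 ^ 12 / 8)]
        refine mul_le_mul_of_nonneg_right (by norm_num) (by positivity)
      _ = 10 ^ 12 * (D * (K + 2)) * ε / (8 * C ^ 2) := by
        field_simp
      _ ≤ _ := by gcongr
  have t1 : 36 * C ^ 4 ≤ N * ε / (8 * C ^ 2) := by
    rw [le_div_iff₀ (by positivity)]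
    have h1 : C ^ 6 ≤ C ^ 16 := pow_le_pow_right₀ hC.le (by norm_num)
    have h2 : 288 * D ≤ N := by linarith
    have h3 : D * ε ^ 2 ≤ D * ε := by
      gcongr
      nlinarith
    have h4 : 288 * D * ε ≤ N * ε := by gcongr
    linarith
  have : N * ε / (2 * C ^ 2) = N * ε / (4 * C ^ 2) + N * ε / (8 * C ^ 2) + N * ε / (8 * C ^ 2) := by
    field_simp
    norm_num
  linarith

lemma exists_scales {δ C ε : ℝ} (hδ : 0 < δ) (hδ1 : δ < 1) (hC : 1 < C) (hε : 0 < ε)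
    (hε1 : ε ≤ 1 / 2) :
    ∃ k n : ℕ, 5 ≤ k ∧
      Real.exp (-(10 ^ 15 * C ^ 16 * Real.log (C / ε) ^ 2 / (ε ^ 2 * min δ (1 - δ)))) ≤
        (1 / 2) ^ (n + k) ∧
      36 * C ^ 4 + 16 * C ^ 3 / ((1 / 2) ^ k) ^ δ * ((k + 2) * (9 * C) ^ 3) +
        36 * C ^ 2 * (1 + n * (1 - δ)) * (1152 * C ^ 4 * ((1 / 2) ^ k) ^ δ) ≤
      n * ((1 - δ) / 2 * C⁻¹) * (ε / C) := by
  obtain ⟨k, hk5, hk, hη1, hη2⟩ := exists_shift hδ hδ1 hC hε hε1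
  have hC0 : 0 < C := by linarith
  have hθ : 0 < 1 - δ := by linarith
  have hl := Real.log_two_gt_d9
  have hl1 := Real.log_two_lt_d9
  have hL2 : 0.69 ≤ Real.log (C / ε) := by
    have : Real.log 2 ≤ Real.log (C / ε) :=
      Real.log_le_log two_pos ((le_div_iff₀ hε).2 (by linarith))
    linarith
  set L := Real.log (C / ε) with hL
  set m := min δ (1 - δ) with hm
  have hm0 : 0 < m := lt_min hδ hθ
  have hmδ : m ≤ δ := min_le_left _ _
  have hmm : m ≤ 2 * (δ * (1 - δ)) := by
    rcases le_total δ (1 - δ) with h | h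
    · rw [hm, min_eq_left h]
      nlinarith
    · rw [hm, min_eq_right h]
      nlinarith
  set η : ℝ := ((1 / 2) ^ k) ^ δ with hη
  have hη0 : 0 < η := by positivity
  set D := C ^ 16 / ε ^ 2 with hD
  have hD4 : 4 ≤ D := by
    rw [hD, le_div_iff₀ (by positivity)]
    have : 1 ≤ C ^ 16 := one_le_pow₀ hC.le
    nlinarith
  set W := D * L ^ 2 / m with hW
  have hexp : 10 ^ 15 * C ^ 16 * L ^ 2 / (ε ^ 2 * m) = 10 ^ 15 * W := by
    rw [hW, hD]
    field_simp
  have hL0 : 0 < L := by linarith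
  have hWL : L / δ ≤ W := by
    calc L / δ ≤ L / m := by gcongr
      _ ≤ D * L ^ 2 / m := by
        gcongr
        nlinarith
  have hW0 : 0 < W := lt_of_lt_of_le (by positivity) hWL
  have hfl := Nat.lt_floor_add_one (10 ^ 15 * W)
  have hfl' := Nat.floor_le (show 0 ≤ 10 ^ 15 * W by positivity)
  have hkle : k ≤ ⌊10 ^ 15 * W⌋₊ := Nat.le_floor (by linarith)
  obtain ⟨n, hn⟩ := Nat.exists_eq_add_of_le' hkle
  rw [hn, Nat.cast_add] at hfl hfl'
  have hn1 : 9 * 10 ^ 14 * W ≤ n := by linarith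
  have hnθ : 10 ^ 12 * (D * (k + 2)) ≤ n * (1 - δ) := by
    have h1 : D * (L / δ) ≤ 3 * (W * (1 - δ)) := by
      rw [hW, mul_div_assoc' D, div_le_iff₀ hδ, show 3 * (D * L ^ 2 / m * (1 - δ)) * δ =
        3 * (D * L ^ 2) * (δ * (1 - δ)) / m by ring, le_div_iff₀ hm0]
      have h2 : L ≤ 3 / 2 * L ^ 2 := by nlinarith
      calc D * L * m ≤ D * (3 / 2 * L ^ 2) * (2 * (δ * (1 - δ))) := by gcongr
        _ = _ := by ring
    have h3 : D * (k + 2) ≤ D * (50 * (L / δ)) := by gcongr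
    have h4 : 0 ≤ W * (1 - δ) := by positivity
    calc 10 ^ 12 * (D * (k + 2)) ≤ 9 * 10 ^ 14 * W * (1 - δ) := by linarith
      _ ≤ n * (1 - δ) := by gcongr
  refine ⟨k, n, hk5, ?_, ?_⟩
  · rw [hexp, show (1 / 2 : ℝ) ^ (n + k) = Real.exp (-((n + k) * Real.log 2)) by
      rw [← Real.exp_log (show (0 : ℝ) < (1 / 2) ^ (n + k) by positivity), Real.log_pow, one_div,
        Real.log_inv]
      push_cast
      ring_nf, Real.exp_le_exp]
    have : (0 : ℝ) ≤ n + k := by positivity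
    nlinarith
  · refine (scale_inequality hC hε hε1 hη0 hη1 hη2 k.cast_nonneg hnθ).trans_eq ?_
    field_simp

/-- **Slight gain over the trivial energy bound in one dimension.** There is an absolute
constant `C₂ > 0` such that, setting
`r₀ = exp(-C₂ C¹⁶ (log(C/ε))² / (ε² min(δ,1-δ)))`, every `δ`-regular set `X ⊆ ℝ` on
scales `[r₀,1]` with constant `C` and associated regular measure `μ` satisfies
`E(μ|_{[-1,1]}, r₀) ≤ ε r₀^δ`. -/
theorem slight_gain_one_dim :
    ∃ C₂ : ℝ, 0 < C₂ ∧
      ∀ (δ C ε : ℝ), 0 < δ → δ < 1 → 1 < C → 0 < ε → ε ≤ 1 / 2 →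
        ∀ (X : Set ℝ) (μ : Measure ℝ),
          IsClosed X → X.Nonempty →
          IsRegularMeasure δ
            (Real.exp (-(C₂ * C ^ (16 : ℝ) * Real.log (C / ε) ^ 2 /
              (ε ^ 2 * min δ (1 - δ))))) 1 C X μ →
          addEnergy (μ.restrict (Set.Icc (-1 : ℝ) 1))
              (Real.exp (-(C₂ * C ^ (16 : ℝ) * Real.log (C / ε) ^ 2 /
                (ε ^ 2 * min δ (1 - δ))))) ≤
            ENNReal.ofReal
              (ε * Real.exp (-(C₂ * C ^ (16 : ℝ) * Real.log (C / ε) ^ 2 /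
                (ε ^ 2 * min δ (1 - δ)))) ^ δ) := by
  refine ⟨10 ^ 15, by norm_num, fun δ C ε hδ hδ1 hC hε hε1 X μ hX hne h => ?_⟩
  rw [show C ^ (16 : ℝ) = C ^ 16 from mod_cast Real.rpow_natCast C 16] at h ⊢
  obtain ⟨k, n, hk, hr, hkn⟩ := exists_scales hδ hδ1 hC hε hε1
  have hwin := h.isWindowRegular (Real.exp_pos _)
    (hr.trans (pow_le_one₀ (by norm_num) (by norm_num))) hC hδ hδ1 hX hne
  have : IsFiniteMeasure (μ.restrict (Icc (-9 : ℝ) 9)) :=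
    ⟨by simpa using h.1 _ isCompact_Icc⟩
  have hE := hwin.addEnergy_le_of_scales hk hr hkn
  rwa [Measure.restrict_restrict measurableSet_Icc,
    inter_eq_left.2 (Icc_subset_Icc (by norm_num) (by norm_num))] at hE
end

section
/- There exists an absolute constant A > 0 with the following property. Let 0 < δ < 1, C > 1 and 0 < r₀ < 1. Let X ⊆ ℝ be a δ-regular set on scales [r₀, 1] with constant C, and let μ = μ_X be an associated regular measure. Then for every measurable subset E of [−1,1]² one has E(μ|_{[−1,1]}, r₀) ≤ A · C³ · r₀^δ · ( μ²(E) + sup_{z ∈ [−3,3]} μ(π(X² ∩ S_z ∖ E)) ), where μ² = μ × μ, π : ℝ² → ℝ is the first-coordinate projection π(x,y) := x, and S_z := {(x,y) ∈ [−1,1]² : |x + y − z| ≤ r₀}. -/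
open MeasureTheory Metric Set
open scoped ENNReal Pointwise

/-- The strip `S_z = {(x,y) ∈ [-1,1]² : |x + y - z| ≤ r₀}`. -/
def strip (r₀ z : ℝ) : Set (ℝ × ℝ) :=
  {p : ℝ × ℝ | p.1 ∈ Set.Icc (-1 : ℝ) 1 ∧ p.2 ∈ Set.Icc (-1 : ℝ) 1 ∧ |p.1 + p.2 - z| ≤ r₀}

/-- A measurable planar set whose vertical sections have mass at most `c` has product mass at most
`c` times the outer measure of its projection to the first coordinate. -/
lemma MeasureTheory.Measure.prod_le_mul_image_fst {α β : Type*} [MeasurableSpace α]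
    [MeasurableSpace β] {μ : Measure α} {ν : Measure β} [SFinite ν] {T : Set (α × β)}
    (hT : MeasurableSet T) {c : ℝ≥0∞} (hc : ∀ x, ν (Prod.mk x ⁻¹' T) ≤ c) :
    (μ.prod ν) T ≤ c * μ (Prod.fst '' T) := by
  set P := toMeasurable μ (Prod.fst '' T)
  calc (μ.prod ν) T = ∫⁻ x, ν (Prod.mk x ⁻¹' T) ∂μ := Measure.prod_apply hT
    _ ≤ ∫⁻ x, P.indicator (fun _ ↦ c) x ∂μ := by
        refine lintegral_mono fun x ↦ ?_
        by_cases hx : x ∈ P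
        · simpa [hx] using hc x
        · have : Prod.mk x ⁻¹' T = ∅ := by
            ext y
            simp only [mem_preimage, mem_empty_iff_false, iff_false]
            exact fun hy ↦ hx (subset_toMeasurable _ _ ⟨_, hy, rfl⟩)
          simp [this]
    _ = c * μ (Prod.fst '' T) := by
        rw [lintegral_indicator_const (measurableSet_toMeasurable _ _), measure_toMeasurable]

/-- A measurable set whose horizontal sections have mass at most `c` over a base set `E`, and are
empty elsewhere, has product mass at most `c * ν E`. -/
lemma MeasureTheory.Measure.prod_le_mul_of_snd_mem {α β : Type*} [MeasurableSpace α]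
    [MeasurableSpace β] {μ : Measure α} {ν : Measure β} [SFinite μ] [SFinite ν] {T : Set (α × β)}
    (hT : MeasurableSet T) {E : Set β} (hE : MeasurableSet E) (hTE : ∀ p ∈ T, p.2 ∈ E)
    {c : ℝ≥0∞} (hc : ∀ y, μ ((fun x ↦ (x, y)) ⁻¹' T) ≤ c) :
    (μ.prod ν) T ≤ c * ν E := by
  calc (μ.prod ν) T = ∫⁻ y, μ ((fun x ↦ (x, y)) ⁻¹' T) ∂ν := Measure.prod_apply_symm hT
    _ ≤ ∫⁻ y, E.indicator (fun _ ↦ c) y ∂ν := by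
        refine lintegral_mono fun y ↦ ?_
        by_cases hy : y ∈ E
        · simpa [hy] using hc y
        · have : (fun x ↦ (x, y)) ⁻¹' T = ∅ := by
            ext x
            simp only [mem_preimage, mem_empty_iff_false, iff_false]
            exact fun hx ↦ hy (hTE _ hx)
          simp [this]
    _ = c * ν E := lintegral_indicator_const hE c

/-- The additive energy of a measure on `ℝ`, split according to whether the second pair lies in
`E`. -/
lemma addEnergy_le_of_ball_le {ν : Measure ℝ} [SFinite ν] {r : ℝ} {c s : ℝ≥0∞}
    (hc : ∀ x, ν (closedBall x r) ≤ c) {I : Set ℝ} (hI : ∀ᵐ x ∂ν, x ∈ I)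
    {E : Set (ℝ × ℝ)} (hE : MeasurableSet E)
    (hs : ∀ x ∈ I, ∀ y ∈ I, (ν.prod ν) ({q | |q.1 + q.2 - (x + y)| ≤ r} \ E) ≤ s) :
    addEnergy ν r ≤ ν univ * (c * (ν.prod ν) E) + ν univ * ν univ * s := by
  set S : Set (ℝ × ℝ × ℝ × ℝ) := {p | ‖p.1 + p.2.1 - p.2.2.1 - p.2.2.2‖ ≤ r}
  have hS : MeasurableSet S := (isClosed_le (by fun_prop) continuous_const).measurableSet
  set F : Set (ℝ × ℝ × ℝ × ℝ) := {p | p.2.2 ∈ E}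
  have hF : MeasurableSet F := hE.preimage (by fun_prop)
  have h₁ : (ν.prod (ν.prod (ν.prod ν))) (S ∩ F) ≤ ν univ * (c * (ν.prod ν) E) := by
    rw [Measure.prod_apply (hS.inter hF), mul_comm (ν univ), ← lintegral_const]
    refine lintegral_mono fun x ↦ ?_
    refine Measure.prod_le_mul_of_snd_mem ((hS.inter hF).preimage (by fun_prop)) hE
      (fun p hp ↦ hp.2) fun q ↦ (measure_mono ?_).trans (hc (q.1 + q.2 - x))
    rintro y ⟨hy, -⟩
    simp only [S, mem_ofPred_eq, Real.norm_eq_abs] at hy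
    rw [mem_closedBall, Real.dist_eq]
    convert hy using 2
    ring
  have h₂ : (ν.prod (ν.prod (ν.prod ν))) (S \ F) ≤ ν univ * ν univ * s := by
    rw [Measure.prod_apply (hS.diff hF), mul_comm, ← mul_assoc, ← lintegral_const]
    refine lintegral_mono_ae (hI.mono fun x hx ↦ ?_)
    rw [Measure.prod_apply ((hS.diff hF).preimage (by fun_prop)), ← lintegral_const]
    refine lintegral_mono_ae (hI.mono fun y hy ↦ (measure_mono ?_).trans (hs x hx y hy))
    rintro q ⟨hq, hqF⟩
    refine ⟨?_, hqF⟩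
    simp only [S, mem_ofPred_eq, Real.norm_eq_abs] at hq ⊢
    rw [abs_sub_comm]
    convert hq using 2
    ring
  calc addEnergy ν r = _ := (measure_inter_add_sdiff S hF).symm
    _ ≤ _ := add_le_add h₁ h₂

/-- **Bounding the additive energy after removing an exceptional set.** There is an
absolute constant `A > 0` such that for every `δ`-regular `X ⊆ ℝ` on scales `[r₀,1]`
with constant `C`, associated regular measure `μ`, and every measurable `E ⊆ [-1,1]²`,
`E(μ|_{[-1,1]}, r₀) ≤ A C³ r₀^δ (μ²(E) + sup_{z∈[-3,3]} μ(π(X² ∩ S_z ∖ E)))`. -/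
theorem energy_le_exceptional :
    ∃ A : ℝ, 0 < A ∧
      ∀ (δ C r₀ : ℝ), 0 < δ → δ < 1 → 1 < C → 0 < r₀ → r₀ < 1 →
        ∀ (X : Set ℝ) (μ : Measure ℝ),
          IsClosed X → X.Nonempty →
          IsRegularMeasure δ r₀ 1 C X μ →
          ∀ E : Set (ℝ × ℝ), MeasurableSet E → E ⊆ Set.Icc (-1 : ℝ) 1 ×ˢ Set.Icc (-1 : ℝ) 1 →
            addEnergy (μ.restrict (Set.Icc (-1 : ℝ) 1)) r₀ ≤
              ENNReal.ofReal (A * C ^ 3 * r₀ ^ δ) *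
                ((μ.prod μ) E +
                  ⨆ z ∈ Set.Icc (-3 : ℝ) 3,
                    μ (Prod.fst '' (((X ×ˢ X) ∩ strip r₀ z) \ E))) := by
  refine ⟨1, one_pos, fun δ C r₀ _ _ hC hr₀ hr₁ X μ hX _ ⟨hfin, hXc, hup, _⟩ E hE _ ↦ ?_⟩
  have : IsFiniteMeasureOnCompacts μ := ⟨fun K hK ↦ hfin K hK⟩
  set I : Set ℝ := Icc (-1) 1
  set c := ENNReal.ofReal (C * r₀ ^ δ)
  set M := ⨆ z ∈ Icc (-3 : ℝ) 3, μ (Prod.fst '' (((X ×ˢ X) ∩ strip r₀ z) \ E))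
  have hball (x : ℝ) : μ (closedBall x r₀) ≤ c := hup x r₀ le_rfl hr₁.le
  have hXae : (X : Set ℝ) =ᵐ[μ] univ := ae_eq_univ.2 hXc
  have hν : μ.restrict I = μ.restrict (X ∩ I) := by
    refine Measure.restrict_congr_set ?_
    simpa using (hXae.inter (ae_eq_refl I)).symm
  have huniv : μ.restrict I univ ≤ ENNReal.ofReal C := by
    have h := hup 0 1 hr₁.le le_rfl
    rw [Real.closedBall_eq_Icc] at h
    simpa [I] using h
  have hstrip : ∀ x ∈ I, ∀ y ∈ I, ((μ.restrict I).prod (μ.restrict I))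
      ({q | |q.1 + q.2 - (x + y)| ≤ r₀} \ E) ≤ c * M := by
    intro x hx y hy
    have hD : MeasurableSet ({q : ℝ × ℝ | |q.1 + q.2 - (x + y)| ≤ r₀} \ E) :=
      (isClosed_le (by fun_prop) continuous_const).measurableSet.diff hE
    have hXI : MeasurableSet (X ∩ I) := hX.measurableSet.inter measurableSet_Icc
    have heq : ({q : ℝ × ℝ | |q.1 + q.2 - (x + y)| ≤ r₀} \ E) ∩ (X ∩ I) ×ˢ (X ∩ I) =
        ((X ×ˢ X) ∩ strip r₀ (x + y)) \ E := by
      ext q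
      simp only [strip, mem_inter_iff, mem_sdiff, mem_ofPred_eq, mem_prod]
      tauto
    rw [hν, Measure.prod_restrict, Measure.restrict_apply hD, heq]
    refine (Measure.prod_le_mul_image_fst (heq ▸ hD.inter (hXI.prod hXI)) fun u ↦
      (measure_mono ?_).trans (hball (x + y - u))).trans ?_
    · rintro v ⟨⟨-, -, -, hv⟩, -⟩
      rw [mem_closedBall, Real.dist_eq]
      convert hv using 2
      ring
    · gcongr
      have hz : x + y ∈ Icc (-3 : ℝ) 3 := by
        constructor <;> linarith [hx.1, hx.2, hy.1, hy.2]
      exact le_iSup₂_of_le (f := fun z (_ : z ∈ Icc (-3 : ℝ) 3) ↦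
        μ (Prod.fst '' (((X ×ˢ X) ∩ strip r₀ z) \ E))) _ hz le_rfl
  have hE' : ((μ.restrict I).prod (μ.restrict I)) E ≤ (μ.prod μ) E := by
    rw [Measure.prod_restrict]
    exact Measure.restrict_apply_le _ _
  have hrδ : 0 < r₀ ^ δ := Real.rpow_pos_of_pos hr₀ δ
  have hC₀ : 0 < C := one_pos.trans hC
  have hconst : ENNReal.ofReal C * ENNReal.ofReal C * c = ENNReal.ofReal (1 * C ^ 3 * r₀ ^ δ) := by
    rw [← ENNReal.ofReal_mul hC₀.le, ← ENNReal.ofReal_mul (by positivity)]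
    congr 1
    ring
  have hconst' : ENNReal.ofReal C * c ≤ ENNReal.ofReal (1 * C ^ 3 * r₀ ^ δ) := by
    rw [← hconst, mul_assoc]
    exact le_mul_of_one_le_left' (ENNReal.one_le_ofReal.2 hC.le)
  calc addEnergy (μ.restrict I) r₀
      ≤ μ.restrict I univ * (c * ((μ.restrict I).prod (μ.restrict I)) E) +
          μ.restrict I univ * μ.restrict I univ * (c * M) :=
        addEnergy_le_of_ball_le (fun x ↦ (Measure.restrict_apply_le _ _).trans (hball x))
          (ae_restrict_mem measurableSet_Icc) hE hstrip
    _ ≤ ENNReal.ofReal C * (c * (μ.prod μ) E) +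
          ENNReal.ofReal C * ENNReal.ofReal C * (c * M) := by gcongr
    _ ≤ ENNReal.ofReal (1 * C ^ 3 * r₀ ^ δ) * ((μ.prod μ) E + M) := by
        rw [mul_add, ← mul_assoc, ← mul_assoc, hconst]
        gcongr
end

section
/- There exists an absolute constant C₀ > 0 with the following property. Let 0 < δ < 1, C > 1 and 0 < r₀ < 1, let X ⊆ ℝ be a δ-regular set on scales [r₀, 1] with constant C, and let K ≥ 1000 be a perfect square and a multiple of 100 satisfying K^{δ/2} ≥ C₀·C² and K^{(1−δ)/2} ≥ C₀·C². Let n ≥ 1 be an integer with K^{−2n} ∈ [K²·r₀, 1], and let I be an active K-adic interval of length K^{−2n}. Then the union I⁻ ∪ I of I with its left shift contains a left edge J of length K^{−2(n+1)}. Furthermore, if J' is a left near-edge whose associated left edge is J, and J' is contained in a left near-edge J̃ of strictly greater length, then I is also contained in some left near-edge of the same length as J̃. -/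
open MeasureTheory Metric Set
open scoped ENNReal

/-- The `K`-adic interval `[j K⁻ⁿ, (j+1) K⁻ⁿ)` (indexed by `j`, at scale `n`). -/
def kadic (K : ℕ) (j n : ℤ) : Set ℝ :=
  Set.Ico ((j : ℝ) * (K : ℝ) ^ (-n)) (((j : ℝ) + 1) * (K : ℝ) ^ (-n))

/-- A `K`-adic interval is active (for the set `X`) if it intersects `X`. -/
def KadicActive (X : Set ℝ) (K : ℕ) (j n : ℤ) : Prop :=
  (kadic K j n ∩ X).Nonempty

/-- The index of the parent of the `K`-adic interval indexed by `j` (floor division). -/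
def kadicParent (K : ℕ) (j : ℤ) : ℤ := Int.fdiv j (K : ℤ)

/-- The `K`-adic interval indexed by `(j, n)` is a left edge: its length `K⁻ⁿ` equals
`K^{-2m} ∈ [r₀, 1]` for some `m ≥ 1`, it is active, all its left siblings are inactive,
and the left shift of its parent is inactive. -/
def IsLeftEdge (X : Set ℝ) (K : ℕ) (r₀ : ℝ) (j n : ℤ) : Prop :=
  (∃ m : ℤ, 1 ≤ m ∧ n = 2 * m) ∧
  r₀ ≤ (K : ℝ) ^ (-n) ∧ (K : ℝ) ^ (-n) ≤ 1 ∧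
  KadicActive X K j n ∧
  (∀ j' : ℤ, j' < j → kadicParent K j' = kadicParent K j → ¬ KadicActive X K j' n) ∧
  ¬ KadicActive X K (kadicParent K j - 1) (n - 1)

/-- The `K`-adic interval indexed by `(j, n)` is a left near-edge with associated left
edge indexed by `(i, n)`: `(i, n)` is a left edge, lies at or to the left of `(j, n)`,
and all `K`-adic intervals at scale `n` between them are active. -/
def IsLeftNearEdge (X : Set ℝ) (K : ℕ) (r₀ : ℝ) (j n i : ℤ) : Prop :=
  IsLeftEdge X K r₀ i n ∧ i ≤ j ∧ ∀ j' : ℤ, i ≤ j' → j' < j → KadicActive X K j' n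

theorem mem_kadic_iff {K : ℕ} (hK : 0 < K) {j n : ℤ} {x : ℝ} :
    x ∈ kadic K j n ↔ ⌊x * (K : ℝ) ^ n⌋ = j := by
  have hK' : (0 : ℝ) < (K : ℝ) ^ n := zpow_pos (by exact_mod_cast hK) n
  rw [kadic, Set.mem_Ico, Int.floor_eq_iff, zpow_neg, ← div_eq_mul_inv, ← div_eq_mul_inv,
    div_le_iff₀ hK', lt_div_iff₀ hK']

theorem kadic_subset_ancestor {K : ℕ} (hK : 0 < K) (j n : ℤ) (e : ℕ) :
    kadic K j (n + e) ⊆ kadic K (j / (K : ℤ) ^ e) n := by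
  intro x hx
  have hK' : (K : ℝ) ≠ 0 := by exact_mod_cast hK.ne'
  rw [mem_kadic_iff hK] at hx ⊢
  have h := Int.floor_div_natCast (x * (K : ℝ) ^ (n + (e : ℤ))) (K ^ e)
  rw [hx] at h
  push_cast at h
  rw [← h, zpow_add₀ hK', zpow_natCast]
  congr 1
  field_simp

theorem left_endpoint_mem_kadic {K : ℕ} (hK : 0 < K) (j n : ℤ) :
    (j : ℝ) * (K : ℝ) ^ (-n) ∈ kadic K j n := by
  have hK' : (K : ℝ) ≠ 0 := by exact_mod_cast hK.ne'
  rw [mem_kadic_iff hK, mul_assoc, ← zpow_add₀ hK']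
  simp

theorem kadic_index_unique {K : ℕ} (hK : 0 < K) {i j n : ℤ} {x : ℝ}
    (hi : x ∈ kadic K i n) (hj : x ∈ kadic K j n) : i = j :=
  ((mem_kadic_iff hK).1 hi).symm.trans ((mem_kadic_iff hK).1 hj)

theorem eq_ancestor_of_kadic_subset {K : ℕ} (hK : 0 < K) {i j n : ℤ} {e : ℕ}
    (h : kadic K i (n + e) ⊆ kadic K j n) : i / (K : ℤ) ^ e = j :=
  kadic_index_unique hK
    (kadic_subset_ancestor hK i n e (left_endpoint_mem_kadic hK i (n + e)))
    (h (left_endpoint_mem_kadic hK i (n + e)))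

theorem KadicActive.ancestor {X : Set ℝ} {K : ℕ} (hK : 0 < K) {j n : ℤ} {e : ℕ}
    (h : KadicActive X K j (n + e)) : KadicActive X K (j / (K : ℤ) ^ e) n :=
  h.mono (Set.inter_subset_inter_left X (kadic_subset_ancestor hK j n e))

theorem KadicActive.exists_child {X : Set ℝ} {K : ℕ} (hK : 0 < K) {j n : ℤ}
    (h : KadicActive X K j n) :
    ∃ i : ℤ, i / (K : ℤ) = j ∧ KadicActive X K i (n + 1) := by
  obtain ⟨x, hx, hxX⟩ := h
  have hx' := (mem_kadic_iff hK).2 (rfl : ⌊x * (K : ℝ) ^ (n + 1)⌋ = _)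
  refine ⟨_, ?_, x, hx', hxX⟩
  have h1 := kadic_subset_ancestor hK _ n 1 (by exact_mod_cast hx')
  simpa using kadic_index_unique hK h1 hx

theorem kadicParent_eq_ediv (K : ℕ) (j : ℤ) : kadicParent K j = j / (K : ℤ) :=
  Int.fdiv_eq_ediv_of_nonneg j (Int.natCast_nonneg K)

/-- The left shift of a left edge is inactive. -/
theorem IsLeftEdge.not_active_pred {X : Set ℝ} {K : ℕ} (hK : 0 < K) {r₀ : ℝ} {i n : ℤ}
    (h : IsLeftEdge X K r₀ i n) : ¬ KadicActive X K (i - 1) n := by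
  obtain ⟨-, -, -, -, hsib, hpar⟩ := h
  intro hact
  have hK' : (0 : ℤ) < K := by exact_mod_cast hK
  by_cases heq : (i - 1) / (K : ℤ) = i / (K : ℤ)
  · exact hsib (i - 1) (by omega) (by simpa [kadicParent_eq_ediv] using heq) hact
  · have h1 : KadicActive X K ((i - 1) / (K : ℤ) ^ 1) (n - 1) :=
      KadicActive.ancestor hK (by simpa using hact)
    have h2 : (i - 1) / (K : ℤ) = i / (K : ℤ) - 1 := by
      have hle : (i - 1) / (K : ℤ) ≤ i / (K : ℤ) := Int.ediv_le_ediv hK' (by omega)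
      have hge : (i - (K : ℤ)) / (K : ℤ) ≤ (i - 1) / (K : ℤ) :=
        Int.ediv_le_ediv hK' (by omega)
      have hsub : (i - (K : ℤ)) / (K : ℤ) = i / (K : ℤ) - 1 := by
        rw [Int.sub_ediv_of_dvd _ dvd_rfl, Int.ediv_self hK'.ne']
      omega
    rw [kadicParent_eq_ediv] at hpar
    rw [pow_one, h2] at h1
    exact hpar h1

theorem exists_active_pred_inactive {P : ℤ → Prop} {a b : ℤ} (ha : ¬ P a) (hb : P b)
    (hab : a < b) : ∃ p, a < p ∧ p ≤ b ∧ P p ∧ ¬ P (p - 1) := by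
  obtain ⟨p, ⟨hp, hap⟩, hmin⟩ := Int.exists_least_of_bdd (P := fun p => P p ∧ a < p)
    ⟨a, fun z hz => hz.2.le⟩ ⟨b, hb, hab⟩
  refine ⟨p, hap, hmin b ⟨hb, hab⟩, hp, fun hp' => ?_⟩
  have hne : a ≠ p - 1 := fun h => ha (h ▸ hp')
  have := hmin (p - 1) ⟨hp', by omega⟩
  omega

/-- A parent that is active with inactive left shift contains a left edge. -/
theorem exists_leftEdge_child {X : Set ℝ} {K : ℕ} (hK : 0 < K) {r₀ : ℝ} {p m : ℤ}
    (hm : 1 ≤ m) (hr : r₀ ≤ (K : ℝ) ^ (-(2 * m))) (hp : KadicActive X K p (2 * m - 1))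
    (hp' : ¬ KadicActive X K (p - 1) (2 * m - 1)) :
    ∃ c : ℤ, c / (K : ℤ) = p ∧ IsLeftEdge X K r₀ c (2 * m) := by
  have hK' : (0 : ℤ) < K := by exact_mod_cast hK
  have hK1 : (1 : ℝ) ≤ K := by exact_mod_cast hK
  obtain ⟨c₀, hc₀, hc₀'⟩ := hp.exists_child hK
  rw [sub_add_cancel] at hc₀'
  obtain ⟨c, ⟨hc, hact⟩, hmin⟩ := Int.exists_least_of_bdd
    (P := fun c => c / (K : ℤ) = p ∧ KadicActive X K c (2 * m))
    ⟨p * K, fun z hz => by rw [← hz.1]; exact Int.ediv_mul_le z hK'.ne'⟩ ⟨c₀, hc₀, hc₀'⟩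
  refine ⟨c, hc, ⟨m, hm, rfl⟩, hr, zpow_le_one_of_nonpos₀ hK1 (by omega), hact, ?_, ?_⟩
  · intro j' hj' hpar hj'act
    rw [kadicParent_eq_ediv, kadicParent_eq_ediv, hc] at hpar
    have := hmin j' ⟨hpar, hj'act⟩
    omega
  · rwa [kadicParent_eq_ediv, hc]

/-- If all the children of a `K`-adic interval are active, then `K ^ (1 - δ) ≤ 4 C ^ 2`. -/
theorem IsRegularSet.rpow_le_of_children_active {δ C r₀ : ℝ} (hC : 0 < C) {X : Set ℝ}
    (hX : IsRegularSet δ r₀ 1 C X) {K : ℕ} (hK4 : 4 ∣ K) (hK : 0 < K) {i n : ℤ}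
    (hr : r₀ ≤ (K : ℝ) ^ (-(n + 1))) (hn : (K : ℝ) ^ (-n) ≤ 1)
    (hact : ∀ p : ℤ, i * K ≤ p → p < (i + 1) * K → KadicActive X K p (n + 1)) :
    (K : ℝ) ^ (1 - δ) ≤ 4 * C ^ 2 := by
  obtain ⟨-, -, μ, -, -, hup, hlow⟩ := hX
  obtain ⟨M, rfl⟩ := hK4
  set K : ℕ := 4 * M with hKM
  have hK0 : (0 : ℝ) < K := by exact_mod_cast hK
  have hK4' : (4 : ℝ) ≤ K := by
    have : 4 ≤ K := by omega
    exact_mod_cast this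
  set h : ℝ := (K : ℝ) ^ (-(n + 1)) with hh
  have hpos : 0 < h := zpow_pos hK0 _
  have hKh : (K : ℝ) ^ (-n) = K * h := by
    rw [hh, show -n = 1 + -(n + 1) by ring, zpow_add₀ hK0.ne', zpow_one]
  rw [hKh] at hn
  have hh1 : h ≤ 1 := by nlinarith
  have hx : ∀ t : ℕ, ∃ x : ℝ, t < M →
      x ∈ X ∧ ((i * K + 4 * t : ℤ) : ℝ) * h ≤ x ∧ x < (((i * K + 4 * t : ℤ) : ℝ) + 1) * h := by
    intro t
    by_cases ht : t < M
    · obtain ⟨x, hx, hxX⟩ := hact (i * K + 4 * t) (by omega) (by rw [add_mul]; omega)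
      exact ⟨x, fun _ => ⟨hxX, hx⟩⟩
    · exact ⟨0, fun h => absurd h ht⟩
  choose x hx using hx
  have hdisj : (↑(Finset.range M) : Set ℕ).PairwiseDisjoint (fun t => closedBall (x t) h) := by
    have key : ∀ a b : ℕ, a < M → b < M → a < b →
        Disjoint (closedBall (x a) h) (closedBall (x b) h) := by
      intro a b ha hb hab
      obtain ⟨-, -, ha2⟩ := hx a ha
      obtain ⟨-, hb1, -⟩ := hx b hb
      apply closedBall_disjoint_closedBall
      have hab' : (a : ℝ) + 1 ≤ b := by exact_mod_cast hab
      rw [dist_comm, Real.dist_eq]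
      refine lt_of_lt_of_le ?_ (le_abs_self _)
      push_cast at ha2 hb1
      nlinarith
    intro a ha b hb hab
    rw [Finset.coe_range, Set.mem_Iio] at ha hb
    rcases lt_or_gt_of_ne hab with hlt | hlt
    · exact key a b ha hb hlt
    · exact (key b a hb ha hlt).symm
  have hsub : (⋃ t ∈ Finset.range M, closedBall (x t) h) ⊆
      closedBall ((i * K + K / 2 : ℝ) * h) (K * h) := by
    intro y hy
    simp only [Set.mem_iUnion, Finset.mem_range] at hy
    obtain ⟨t, ht, hy⟩ := hy
    obtain ⟨-, h1, h2⟩ := hx t ht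
    have ht' : (4 : ℝ) * t + 4 ≤ K := by
      have : 4 * t + 4 ≤ K := by omega
      exact_mod_cast this
    have ht0 : (0 : ℝ) ≤ t := Nat.cast_nonneg t
    rw [Real.closedBall_eq_Icc, Set.mem_Icc] at hy ⊢
    push_cast at h1 h2
    constructor <;> nlinarith
  have hmeas : ENNReal.ofReal (M * (C⁻¹ * h ^ δ)) ≤ ENNReal.ofReal (C * (K * h) ^ δ) := by
    calc ENNReal.ofReal (M * (C⁻¹ * h ^ δ))
        = ∑ _t ∈ Finset.range M, ENNReal.ofReal (C⁻¹ * h ^ δ) := by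
          rw [Finset.sum_const, Finset.card_range, nsmul_eq_mul,
            ENNReal.ofReal_mul (Nat.cast_nonneg M), ENNReal.ofReal_natCast]
      _ ≤ ∑ t ∈ Finset.range M, μ (closedBall (x t) h) :=
          Finset.sum_le_sum fun t ht =>
            hlow (x t) (hx t (Finset.mem_range.1 ht)).1 h hr hh1
      _ = μ (⋃ t ∈ Finset.range M, closedBall (x t) h) :=
          (measure_biUnion_finset hdisj fun t _ => measurableSet_closedBall).symm
      _ ≤ μ (closedBall ((i * K + K / 2 : ℝ) * h) (K * h)) := measure_mono hsub
      _ ≤ ENNReal.ofReal (C * (K * h) ^ δ) := hup _ _ (by nlinarith) hn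
  rw [ENNReal.ofReal_le_ofReal_iff (by positivity), Real.mul_rpow hK0.le hpos.le] at hmeas
  have hhδ : 0 < h ^ δ := Real.rpow_pos_of_pos hpos δ
  have hKδ : 0 < (K : ℝ) ^ δ := Real.rpow_pos_of_pos hK0 δ
  have hMK : (K : ℝ) = 4 * M := by rw [hKM]; push_cast; ring
  have h1 : (M : ℝ) * C⁻¹ ≤ C * (K : ℝ) ^ δ := by
    refine le_of_mul_le_mul_right ?_ hhδ
    linarith
  rw [← div_eq_mul_inv, div_le_iff₀ hC] at h1
  rw [Real.rpow_sub hK0, Real.rpow_one, div_le_iff₀ hKδ]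
  linarith

/-- If a left near-edge of shorter length, associated to a left edge in `I⁻ ∪ I`, is contained in
a left near-edge, then the ancestor of `I` of the same length is also a left near-edge. -/
theorem IsLeftNearEdge.ancestor_of_contains {X : Set ℝ} {K : ℕ} (hK : 0 < K) {r₀ : ℝ}
    {j jJ j' k i₂ n : ℤ} {e f : ℕ}
    (hJ : j - 1 ≤ jJ / (K : ℤ) ^ f) (hJ' : jJ / (K : ℤ) ^ f ≤ j)
    (hnear : IsLeftNearEdge X K r₀ j' (n + ↑(e + f)) jJ)
    (hk : IsLeftNearEdge X K r₀ k n i₂)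
    (hsub : kadic K j' (n + ↑(e + f)) ⊆ kadic K k n) :
    IsLeftNearEdge X K r₀ (j / (K : ℤ) ^ e) n i₂ := by
  have hK' : (0 : ℤ) < K := by exact_mod_cast hK
  have hKe : (0 : ℤ) < (K : ℤ) ^ e := by positivity
  have hKef : (0 : ℤ) < (K : ℤ) ^ (e + f) := by positivity
  obtain ⟨hedge, hi₂k, hbetween⟩ := hk
  obtain ⟨hJedge, hJj', hrun⟩ := hnear
  have hkeq := eq_ancestor_of_kadic_subset hK hsub
  set a := jJ / (K : ℤ) ^ (e + f) with ha
  have haact : KadicActive X K a n := hJedge.2.2.2.1.ancestor hK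
  have ha' : a = jJ / (K : ℤ) ^ f / (K : ℤ) ^ e := by
    rw [ha, Int.ediv_ediv_of_nonneg (by positivity), add_comm e f, pow_add]
  have hale : a ≤ j / (K : ℤ) ^ e := ha' ▸ Int.ediv_le_ediv hKe hJ'
  have hage : j / (K : ℤ) ^ e - 1 ≤ a := by
    have h1 : (j - (K : ℤ) ^ e) / (K : ℤ) ^ e ≤ a :=
      ha' ▸ Int.ediv_le_ediv hKe (by omega)
    rwa [Int.sub_ediv_of_dvd _ dvd_rfl, Int.ediv_self hKe.ne'] at h1
  have hak : a ≤ k := hkeq ▸ Int.ediv_le_ediv hKef hJj'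
  have hrun' : ∀ p, a ≤ p → p < k → KadicActive X K p n := by
    intro p hap hpk
    have h1 : jJ < (p + 1) * (K : ℤ) ^ (e + f) :=
      (Int.ediv_lt_iff_lt_mul hKef).1 (by omega)
    have h2 : (p + 1) * (K : ℤ) ^ (e + f) ≤ j' :=
      (Int.le_ediv_iff_mul_le hKef).1 (by omega)
    have h3 := (hrun ((p + 1) * (K : ℤ) ^ (e + f) - 1) (by omega) (by omega)).ancestor hK
    have h4 : ((p + 1) * (K : ℤ) ^ (e + f) - 1) / (K : ℤ) ^ (e + f) = p := by
      rw [Int.ediv_eq_iff_of_pos hKef]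
      constructor <;> linarith
    rwa [h4] at h3
  have hi₂ : i₂ ≤ j / (K : ℤ) ^ e := by
    by_contra! hlt
    exact hedge.not_active_pred hK (hrun' (i₂ - 1) (by omega) (by omega))
  refine ⟨hedge, hi₂, fun q hq hq' => ?_⟩
  by_cases hqk : q < k
  · exact hbetween q hq hqk
  · have hqa : q = a := by omega
    exact hqa ▸ haact

/-- **Many left edges.** There is an absolute constant `C₀ > 0` with the following
property.  In the setting of a `δ`-regular set `X` and a suitable `K`, for every
integer `n ≥ 1` with `K^{-2n} ∈ [K² r₀, 1]` and every active `K`-adic interval `I`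
(indexed by `j`) of length `K^{-2n}`, the set `I⁻ ∪ I` contains a left edge `J` of
length `K^{-2(n+1)}`; moreover if a left near-edge `J'` associated to `J` is contained
in a left near-edge `J̃` of strictly greater length, then `I` is contained in some left
near-edge of the same length as `J̃`. -/
theorem many_left_edges :
    ∃ C₀ : ℝ, 0 < C₀ ∧
      ∀ (δ C r₀ : ℝ), 0 < δ → δ < 1 → 1 < C → 0 < r₀ → r₀ < 1 →
        ∀ X : Set ℝ, IsRegularSet δ r₀ 1 C X →
          ∀ (K s : ℕ), K = s * s → 100 ∣ K → 1000 ≤ K →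
            C₀ * C ^ 2 ≤ (K : ℝ) ^ (δ / 2) →
            C₀ * C ^ 2 ≤ (K : ℝ) ^ ((1 - δ) / 2) →
            ∀ n : ℤ, 1 ≤ n →
              (K : ℝ) ^ 2 * r₀ ≤ (K : ℝ) ^ (-(2 * n)) → (K : ℝ) ^ (-(2 * n)) ≤ 1 →
              ∀ j : ℤ, KadicActive X K j (2 * n) →
                ∃ jJ : ℤ,
                  IsLeftEdge X K r₀ jJ (2 * (n + 1)) ∧
                  kadic K jJ (2 * (n + 1)) ⊆ kadic K (j - 1) (2 * n) ∪ kadic K j (2 * n) ∧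
                  ∀ j' iT nT i₂ : ℤ,
                    IsLeftNearEdge X K r₀ j' (2 * (n + 1)) jJ →
                    IsLeftNearEdge X K r₀ iT nT i₂ →
                    nT < 2 * (n + 1) →
                    kadic K j' (2 * (n + 1)) ⊆ kadic K iT nT →
                    ∃ j₃ i₃ : ℤ,
                      IsLeftNearEdge X K r₀ j₃ nT i₃ ∧
                      kadic K j (2 * n) ⊆ kadic K j₃ nT := by
  refine ⟨4, by norm_num, ?_⟩
  intro δ C r₀ _ _ hC hr₀ _ X hX K s _ hK100 hK1000 _ hKδ n hn hr hn1 j hj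
  have hK : 0 < K := by omega
  have hK' : (0 : ℤ) < K := by exact_mod_cast hK
  have hK0 : (0 : ℝ) < K := by exact_mod_cast hK
  have hK1 : (1 : ℝ) ≤ K := by exact_mod_cast hK
  have hr2 : r₀ ≤ (K : ℝ) ^ (-(2 * (n + 1))) := by
    rw [show -(2 * (n + 1)) = -(2 * n) - 2 by ring, zpow_sub₀ hK0.ne', le_div_iff₀ (by positivity)]
    rw [mul_comm]
    exact_mod_cast hr
  have hr1 : r₀ ≤ (K : ℝ) ^ (-(2 * n + 1)) :=
    hr2.trans (zpow_le_zpow_right₀ hK1 (by omega))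
  obtain ⟨p₀, hp₀, hp₀', hinact⟩ : ∃ p : ℤ, (j - 1) * K ≤ p ∧ p < (j - 1 + 1) * K ∧
      ¬ KadicActive X K p (2 * n + 1) := by
    by_contra! hall
    have h1 := hX.rpow_le_of_children_active (by linarith)
      ((by norm_num : 4 ∣ 100).trans hK100) hK hr1 hn1 hall
    have h2 : (K : ℝ) ^ (1 - δ) = (K : ℝ) ^ ((1 - δ) / 2) * (K : ℝ) ^ ((1 - δ) / 2) := by
      rw [← Real.rpow_add hK0, add_halves]
    have h3 : 1 < C ^ 2 := by nlinarith
    nlinarith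
  obtain ⟨p₁, hp₁, hp₁act⟩ := hj.exists_child hK
  have hp₁le : j * K ≤ p₁ := hp₁ ▸ Int.ediv_mul_le p₁ hK'.ne'
  rw [sub_add_cancel] at hp₀'
  obtain ⟨p, hp₀p, hpp₁, hpact, hpinact⟩ := exists_active_pred_inactive
    (P := fun p => KadicActive X K p (2 * n + 1)) hinact hp₁act (by omega)
  have hscale : 2 * (n + 1) - 1 = 2 * n + 1 := by ring
  obtain ⟨c, hc, hedge⟩ := exists_leftEdge_child hK (m := n + 1) (by omega) hr2
    (hscale ▸ hpact) (hscale ▸ hpinact)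
  have hc2 : c / (K : ℤ) ^ 2 = p / K := by
    rw [← hc, Int.ediv_ediv_of_nonneg hK'.le, sq]
  have hge : j - 1 ≤ c / (K : ℤ) ^ 2 := by
    rw [hc2, Int.le_ediv_iff_mul_le hK']
    omega
  have hle : c / (K : ℤ) ^ 2 ≤ j := by
    rw [hc2, ← hp₁]
    exact Int.ediv_le_ediv hK' hpp₁
  refine ⟨c, hedge, ?_, ?_⟩
  · have hsub := kadic_subset_ancestor hK c (2 * n) 2
    rw [show 2 * n + ((2 : ℕ) : ℤ) = 2 * (n + 1) by push_cast; ring] at hsub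
    refine hsub.trans ?_
    rcases (by omega : c / (K : ℤ) ^ 2 = j - 1 ∨ c / (K : ℤ) ^ 2 = j) with h | h
    · rw [h]; exact Set.subset_union_left
    · rw [h]; exact Set.subset_union_right
  · intro j' k nT i₂ hJ' hk hnT hsub
    obtain ⟨m, -, hm⟩ := hk.1.1
    obtain ⟨e, he⟩ := Int.eq_ofNat_of_zero_le (by omega : 0 ≤ 2 * n - nT)
    have he1 : 2 * n = nT + e := by omega
    have he2 : 2 * (n + 1) = nT + ↑(e + 2) := by push_cast; omega
    rw [he2] at hJ' hsub
    rw [he1]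
    exact ⟨j / (K : ℤ) ^ e, i₂, IsLeftNearEdge.ancestor_of_contains hK hge hle hJ' hk hsub, kadic_subset_ancestor hK j nT e⟩
end
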